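/- arXiv:1703.00870 — 2 statements merged into one kernel-verified Lean document; each statement's English description precedes it below -/
import Mathlib

section
/- A holomorphic function that has polynomial growth on a relatively compact open subset U of ℂⁿ is tempered on U, i.e. all of its derivatives also have polynomial growth on U. -/
open scoped Topology
open Set

/-- A function `f`, considered on the open set `U`, has *polynomial growth* at a point `p`:
there are a compact neighbourhood `K` of `p` and a positive integer `N` with
`sup_{x ∈ K ∩ U} dist(x, K \ U)^N ‖f x‖ < ∞`. -/
def HasPolyGrowthAt {E F : Type*} [NormedAddCommGroup E] [NormedSpace ℝ E]
    [NormedAddCommGroup F] (f : E → F) (U : Set E) (p : E) : Prop :=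
  ∃ K : Set E, IsCompact K ∧ K ∈ 𝓝 p ∧ ∃ N : ℕ, 0 < N ∧ ∃ C : ℝ,
    ∀ x ∈ K ∩ U, Metric.infDist x (K \ U) ^ N * ‖f x‖ ≤ C

/-- A smooth function on the open set `U` is *tempered* if all of its (iterated) derivatives
have polynomial growth at every point. -/
def IsTemperedOn {E : Type*} [NormedAddCommGroup E] [NormedSpace ℝ E]
    (f : E → ℂ) (U : Set E) : Prop :=
  ∀ (k : ℕ) (p : E),
    HasPolyGrowthAt (fun x => ‖iteratedFDerivWithin ℝ k f U x‖) U p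

open Metric MeasureTheory in
/-- Cauchy estimate for the first derivative on a ball. -/
theorem cauchy_fderiv_bound {E F : Type} [NormedAddCommGroup E] [NormedSpace ℂ E]
    [NormedAddCommGroup F] [NormedSpace ℂ F] {g : E → F} {x : E} {R M : ℝ} (hR : 0 < R)
    (hg : DifferentiableOn ℂ g (ball x R)) (hM : ∀ y ∈ ball x R, ‖g y‖ ≤ M) :
    ‖fderiv ℂ g x‖ ≤ 2 * M / R := by
  refine Complex.norm_fderiv_le_div_of_mapsTo_ball hg (fun y hy => ?_) hR
  rw [mem_closedBall, dist_eq_norm]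
  have h1 := hM y hy
  have h2 := hM x (mem_ball_self hR)
  have h3 := norm_sub_le (g y) (g x)
  linarith

open Metric MeasureTheory in
theorem differentiableAt_fderiv_apply {E F : Type} [NormedAddCommGroup E] [NormedSpace ℂ E]
    [FiniteDimensional ℂ E] [NormedAddCommGroup F] [NormedSpace ℂ F] [FiniteDimensional ℂ F]
    {g : E → F} {U : Set E} (hU : IsOpen U) (hg : DifferentiableOn ℂ g U) {x₀ : E} (hx : x₀ ∈ U)
    (v : E) : DifferentiableAt ℂ (fun x => fderiv ℂ g x v) x₀ := by
  have : CompleteSpace F := FiniteDimensional.complete ℂ F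
  have : ProperSpace E := FiniteDimensional.proper ℂ E
  have : FiniteDimensional ℂ (E →L[ℂ] F) := inferInstance
  have : ProperSpace (E →L[ℂ] F) := FiniteDimensional.proper ℂ _
  have hcont : ContinuousAt g x₀ := (hg.differentiableAt (hU.mem_nhds hx)).continuousAt
  obtain ⟨M, hM⟩ : ∃ M, ∀ᶠ y in 𝓝 x₀, ‖g y‖ ≤ M :=
    ⟨‖g x₀‖ + 1, (hcont.norm.eventually_lt_const (lt_add_one _)).mono fun _ h => h.le⟩
  obtain ⟨R, hR, hball⟩ := Metric.eventually_nhds_iff_ball.1 (hM.and (hU.mem_nhds hx))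
  set ρ := R / 3 with hρ
  have hρ0 : 0 < ρ := by positivity
  set r := ρ / (‖v‖ + 1) with hr
  have hr0 : 0 < r := by positivity
  have hrv : r * ‖v‖ ≤ ρ := by
    rw [hr, div_mul_eq_mul_div, div_le_iff₀ (by positivity)]
    nlinarith
  have hsub : ∀ x ∈ ball x₀ ρ, ∀ t : ℂ, ‖t‖ ≤ r → ball (x + t • v) ρ ⊆ ball x₀ R := by
    intro x hx t ht y hy
    rw [mem_ball, dist_eq_norm] at *
    have h1 : ‖t • v‖ ≤ ρ := by
      rw [norm_smul]
      exact (mul_le_mul_of_nonneg_right ht (norm_nonneg _)).trans hrv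
    have : y - x₀ = (y - (x + t • v)) + (x - x₀) + t • v := by abel
    rw [this]
    have := norm_add₃_le (a := y - (x + t • v)) (b := x - x₀) (c := t • v)
    linarith
  have hin : ∀ x ∈ ball x₀ ρ, ∀ t : ℂ, ‖t‖ ≤ r → x + t • v ∈ U := fun x hx t ht =>
    (hball _ (hsub x hx t ht (mem_ball_self hρ0))).2
  have hgd : ∀ x ∈ ball x₀ ρ, ∀ t : ℂ, ‖t‖ ≤ r → DifferentiableAt ℂ g (x + t • v) :=
    fun x hx t ht => hg.differentiableAt (hU.mem_nhds (hin x hx t ht))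
  have hbd : ∀ x ∈ ball x₀ ρ, ∀ t : ℂ, ‖t‖ ≤ r → ‖fderiv ℂ g (x + t • v)‖ ≤ 2 * M / ρ :=
    fun x hx t ht => cauchy_fderiv_bound hρ0
      (hg.mono fun y hy => (hball _ (hsub x hx t ht hy)).2)
      (fun y hy => (hball _ (hsub x hx t ht hy)).1)
  have hcm : ∀ θ : ℝ, ‖circleMap 0 r θ‖ ≤ r := fun θ => by simp [abs_of_pos hr0]
  set c : ℝ → ℂ := fun θ => deriv (circleMap 0 r) θ * ((circleMap 0 r θ - 0) ^ 2)⁻¹ with hc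
  have hcc : Continuous c := by
    have h0 : ∀ θ, (circleMap 0 r θ - 0) ^ 2 ≠ 0 := fun θ => by
      simpa using hr0.ne'
    have : Continuous (circleMap 0 r) := continuous_circleMap 0 r
    simp only [hc, deriv_circleMap]
    exact (by fun_prop : Continuous fun θ => circleMap 0 r θ * Complex.I).mul
      (Continuous.inv₀ (by fun_prop) h0)
  let G : E → ℝ → F := fun x θ => c θ • g (x + circleMap 0 r θ • v)
  let G' : E → ℝ → E →L[ℂ] F := fun x θ => c θ • fderiv ℂ g (x + circleMap 0 r θ • v)
  have hline : ∀ x : E, Continuous fun θ : ℝ => x + circleMap 0 r θ • v := fun x => by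
    have : Continuous (circleMap 0 r) := continuous_circleMap 0 r
    fun_prop
  have hGc : ∀ x ∈ ball x₀ ρ, Continuous (G x) := fun x hx => by
    refine hcc.smul (continuous_iff_continuousAt.2 fun θ => ?_)
    exact ContinuousAt.comp (g := g) (f := fun θ : ℝ => x + circleMap 0 r θ • v)
      (hgd x hx _ (hcm θ)).continuousAt (hline x).continuousAt
  have hmeas : AEStronglyMeasurable (G' x₀) (volume.restrict (Ioc 0 (2 * Real.pi))) := by
    borelize E
    borelize (E →L[ℂ] F)
    have : Measurable fun θ : ℝ => fderiv ℂ g (x₀ + circleMap 0 r θ • v) :=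
      (measurable_fderiv ℂ g).comp (hline x₀).measurable
    have h2 := this.stronglyMeasurable
    exact (hcc.stronglyMeasurable.smul h2).aestronglyMeasurable
  have key := hasFDerivAt_integral_of_dominated_of_fderiv_le (𝕜 := ℂ) (F := G) (F' := G')
    (μ := volume.restrict (Ioc 0 (2 * Real.pi))) (x₀ := x₀) (s := ball x₀ ρ)
    (bound := fun θ => ‖c θ‖ * (2 * M / ρ)) (ball_mem_nhds _ hρ0)
    (Filter.eventually_of_mem (ball_mem_nhds _ hρ0) fun x hx =>
      (hGc x hx).aestronglyMeasurable)
    (hGc x₀ (mem_ball_self hρ0)).integrableOn_Ioc hmeas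
    (Filter.Eventually.of_forall fun θ x hx => by
      simp only [G', norm_smul]
      exact mul_le_mul_of_nonneg_left (hbd x hx _ (hcm θ)) (norm_nonneg _))
    (hcc.norm.mul continuous_const).integrableOn_Ioc
    (Filter.Eventually.of_forall fun θ x hx => by
      have h := (hgd x hx _ (hcm θ)).hasFDerivAt
      have h2 : HasFDerivAt (fun x => g (x + circleMap 0 r θ • v))
          (fderiv ℂ g (x + circleMap 0 r θ • v)) x :=
        (hasFDerivAt_comp_add_right (circleMap 0 r θ • v)).2 h
      exact h2.const_smul (c θ))
  have hrep : ∀ x ∈ ball x₀ ρ, fderiv ℂ g x v =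
      (2 * Real.pi * Complex.I : ℂ)⁻¹ • ∫ θ in Ioc 0 (2 * Real.pi), G x θ := by
    intro x hx
    have hlin : Continuous fun t : ℂ => x + t • v := by fun_prop
    have hV : IsOpen ((fun t : ℂ => x + t • v) ⁻¹' U) := hU.preimage hlin
    have h := Complex.two_pi_I_inv_smul_circleIntegral_sub_sq_inv_smul_of_differentiable
      (U := (fun t : ℂ => x + t • v) ⁻¹' U) hV (c := 0) (w₀ := 0) (R := r)
      (f := fun t : ℂ => g (x + t • v))
      (fun t ht => hin x hx t (by simpa using ht))
      (hg.comp (by fun_prop) fun t ht => ht) (mem_ball_self hr0)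
    have hd : HasDerivAt (fun t : ℂ => g (x + t • v)) (fderiv ℂ g x v) 0 := by
      have h1 : HasDerivAt (fun t : ℂ => x + t • v) v 0 := by
        simpa using ((hasDerivAt_id (0 : ℂ)).smul_const v).const_add x
      have h2 : HasFDerivAt g (fderiv ℂ g x) (x + (0 : ℂ) • v) := by
        have := hgd x hx 0 (by simpa using hr0.le)
        simpa using this.hasFDerivAt
      exact h2.comp_hasDerivAt (0 : ℂ) h1
    rw [hd.deriv] at h
    rw [← h, circleIntegral, intervalIntegral.integral_of_le (by positivity)]
    simp only [G, hc, smul_smul]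
  have : DifferentiableAt ℂ (fun x => (2 * Real.pi * Complex.I : ℂ)⁻¹ •
      ∫ θ in Ioc 0 (2 * Real.pi), G x θ) x₀ := key.differentiableAt.const_smul _
  exact this.congr_of_eventuallyEq
    (Filter.eventually_of_mem (ball_mem_nhds _ hρ0) hrep)

theorem differentiableOn_fderiv_of_holo {E F : Type} [NormedAddCommGroup E] [NormedSpace ℂ E]
    [FiniteDimensional ℂ E] [NormedAddCommGroup F] [NormedSpace ℂ F] [FiniteDimensional ℂ F]
    {g : E → F} {U : Set E} (hU : IsOpen U) (hg : DifferentiableOn ℂ g U) :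
    DifferentiableOn ℂ (fderiv ℂ g) U := by
  intro x hx
  refine DifferentiableAt.differentiableWithinAt ?_
  let b := Module.finBasis ℂ E
  have : fderiv ℂ g = fun y => ∑ i, ContinuousLinearMap.smulRightL ℂ E F
      (LinearMap.toContinuousLinearMap (b.coord i)) (fderiv ℂ g y (b i)) := by
    funext y
    ext w
    conv_lhs => rw [← b.sum_repr w]
    simp only [map_sum, map_smul]
    simp
  rw [this]
  refine DifferentiableAt.fun_sum fun i _ => ?_
  exact (ContinuousLinearMap.differentiableAt _).comp x
    (differentiableAt_fderiv_apply hU hg hx (b i))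

theorem contDiffOn_of_holo {E : Type} [NormedAddCommGroup E] [NormedSpace ℂ E]
    [FiniteDimensional ℂ E] {U : Set E} (hU : IsOpen U) (k : ℕ) :
    ∀ {F : Type} [NormedAddCommGroup F] [NormedSpace ℂ F] [FiniteDimensional ℂ F]
    {g : E → F}, DifferentiableOn ℂ g U → ContDiffOn ℂ k g U := by
  induction k with
  | zero => intro F _ _ _ g hg; exact contDiffOn_zero.2 hg.continuousOn
  | succ k ih =>
    intro F _ _ _ g hg
    rw [Nat.cast_succ, contDiffOn_succ_iff_fderiv_of_isOpen hU]
    exact ⟨hg, fun h => by simp at h, ih (differentiableOn_fderiv_of_holo hU hg)⟩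

open Metric in
theorem cauchy_iteratedFDeriv_bound {E : Type} [NormedAddCommGroup E] [NormedSpace ℂ E]
    [FiniteDimensional ℂ E] (k : ℕ) :
    ∃ A : ℝ, ∀ {F : Type} [NormedAddCommGroup F] [NormedSpace ℂ F] [FiniteDimensional ℂ F]
    {g : E → F} {x : E} {R M : ℝ}, 0 < R → DifferentiableOn ℂ g (ball x R) →
    (∀ y ∈ ball x R, ‖g y‖ ≤ M) → R ^ k * ‖iteratedFDeriv ℂ k g x‖ ≤ A * M := by
  induction k with
  | zero =>
    refine ⟨1, ?_⟩
    intro F _ _ _ g x R M hR hg hM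
    simpa using hM x (mem_ball_self hR)
  | succ k ih =>
    obtain ⟨A, hA⟩ := ih
    refine ⟨2 ^ k * A * 4, ?_⟩
    intro F _ _ _ g x R M hR hg hM
    have hR2 : 0 < R / 2 := by positivity
    have h := hA (g := fderiv ℂ g) (x := x) (R := R / 2) (M := 2 * M / (R / 2)) hR2
      ((differentiableOn_fderiv_of_holo isOpen_ball hg).mono (ball_subset_ball (by linarith)))
      (fun y hy => by
        have hs : ball y (R / 2) ⊆ ball x R := ball_subset_ball' (by
          rw [mem_ball] at hy; linarith)
        exact cauchy_fderiv_bound hR2 (hg.mono hs) fun z hz => hM z (hs hz))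
    rw [norm_iteratedFDeriv_fderiv] at h
    have h3 : R ^ (k + 1) * ‖iteratedFDeriv ℂ (k + 1) g x‖
        = (2 ^ k * R) * ((R / 2) ^ k * ‖iteratedFDeriv ℂ (k + 1) g x‖) := by
      rw [div_pow]; field_simp; ring
    rw [h3]
    refine (mul_le_mul_of_nonneg_left h (by positivity)).trans (le_of_eq ?_)
    field_simp
    ring

/-- **Polynomial growth implies temperedness for holomorphic functions.**
A holomorphic function with polynomial growth on a relatively compact open subset `U` of
`ℂⁿ` is tempered on `U`: all its derivatives also have polynomial growth. -/
theorem isTemperedOn_of_polyGrowth {n : ℕ}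
    (U : Set (EuclideanSpace ℂ (Fin n))) (hUo : IsOpen U) (hUb : Bornology.IsBounded U)
    (f : EuclideanSpace ℂ (Fin n) → ℂ) (hf : DifferentiableOn ℂ f U)
    (hgrowth : ∀ p, HasPolyGrowthAt f U p) :
    IsTemperedOn f U := by
  intro k p
  have : ProperSpace (EuclideanSpace ℂ (Fin n)) := FiniteDimensional.proper ℂ _
  by_cases hp : p ∈ U
  · obtain ⟨r, hr, hrU⟩ := Metric.nhds_basis_closedBall.mem_iff.1 (hUo.mem_nhds hp)
    refine ⟨Metric.closedBall p r, isCompact_closedBall p r, Metric.closedBall_mem_nhds p hr,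
      1, one_pos, 0, fun x _ => ?_⟩
    rw [diff_eq_empty.2 hrU]
    simp
  obtain ⟨K, hK, hKp, N, hN, C, hC⟩ := hgrowth p
  obtain ⟨R, hR, hRK⟩ := Metric.nhds_basis_ball.mem_iff.1 hKp
  obtain ⟨A, hA⟩ := cauchy_iteratedFDeriv_bound (E := EuclideanSpace ℂ (Fin n)) k
  set r := R / 4 with hr
  have hr0 : 0 < r := by positivity
  have hpK : p ∈ K := mem_of_mem_nhds hKp
  set S := Metric.closedBall p (2 * r) \ U with hS
  have hpS : p ∈ S := ⟨Metric.mem_closedBall_self (by positivity), hp⟩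
  have hdiff : (Metric.closedBall p r ∪ S) \ U = S := by
    ext y
    constructor
    · rintro ⟨h | h, hy⟩
      · exact ⟨Metric.closedBall_subset_closedBall (by linarith) h, hy⟩
      · exact h
    · intro h
      exact ⟨Or.inr h, h.2⟩
  refine ⟨Metric.closedBall p r ∪ S,
    (isCompact_closedBall p r).union ((isCompact_closedBall p (2 * r)).diff hUo),
    Filter.mem_of_superset (Metric.closedBall_mem_nhds p hr0) subset_union_left,
    N + k, by omega, 2 ^ N * 2 ^ k * (A * C), ?_⟩
  rintro x ⟨hx1, hxU⟩
  rw [hdiff, norm_norm, iteratedFDerivWithin_of_isOpen k hUo hxU]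
  have hxr : dist x p ≤ r := by
    rcases hx1 with h | h
    · exact h
    · exact absurd hxU h.2
  set d := Metric.infDist x S with hd
  have hdr : d ≤ r := (Metric.infDist_le_dist_of_mem hpS).trans hxr
  have hScl : IsClosed S := ((isCompact_closedBall p (2 * r)).diff hUo).isClosed
  have hd0 : 0 < d := (hScl.notMem_iff_infDist_pos ⟨p, hpS⟩).1 fun h => h.2 hxU
  have hfar : ∀ y, y ∉ U → d ≤ dist x y := by
    intro y hy
    by_contra! hlt
    have : y ∈ S := by
      refine ⟨?_, hy⟩
      rw [Metric.mem_closedBall]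
      have := dist_triangle y x p
      rw [dist_comm y x] at this
      linarith
    exact absurd (Metric.infDist_le_dist_of_mem this) (not_le.2 hlt)
  have hbU : Metric.ball x (d / 2) ⊆ U := by
    intro y hy
    by_contra hyU
    have := hfar y hyU
    rw [Metric.mem_ball, dist_comm] at hy
    linarith
  have hbd : ∀ y ∈ Metric.ball x (d / 2), ‖f y‖ ≤ C / (d / 2) ^ N := by
    intro y hy
    have hyU := hbU hy
    rw [Metric.mem_ball] at hy
    have hyK : y ∈ K := hRK (by
      rw [Metric.mem_ball]
      have := dist_triangle y x p
      linarith)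
    have h1 : d / 2 ≤ Metric.infDist y (K \ U) := by
      refine (Metric.le_infDist (s := K \ U) ⟨p, hpK, hp⟩).2 fun z hz => ?_
      have h2 := hfar z hz.2
      have h3 := dist_triangle x y z
      rw [dist_comm x y] at h3
      linarith
    rw [le_div_iff₀ (by positivity), mul_comm]
    exact (mul_le_mul_of_nonneg_right (pow_le_pow_left₀ (by positivity) h1 N)
      (norm_nonneg _)).trans (hC y ⟨hyK, hyU⟩)
  have hmain := hA (half_pos hd0) (hf.mono hbU) hbd
  have hcd : ContDiffAt ℂ k f x := (contDiffOn_of_holo hUo k hf).contDiffAt (hUo.mem_nhds hxU)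
  have hnorm : ‖iteratedFDeriv ℝ k f x‖ = ‖iteratedFDeriv ℂ k f x‖ := by
    rw [← hcd.restrictScalars_iteratedFDeriv (𝕜 := ℝ), Function.comp_apply,
      ContinuousMultilinearMap.norm_restrictScalars]
  rw [hnorm]
  have h4 : d ^ (N + k) * ‖iteratedFDeriv ℂ k f x‖
      = d ^ N * 2 ^ k * ((d / 2) ^ k * ‖iteratedFDeriv ℂ k f x‖) := by
    rw [div_pow, pow_add]; field_simp
  rw [h4]
  refine (mul_le_mul_of_nonneg_left hmain (by positivity)).trans (le_of_eq ?_)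
  rw [div_pow]
  field_simp
end

section
/- Let A be a subanalytic subset of ℝⁿ. Then the distance function ℝⁿ → ℝ, x ↦ dist(x, A), is a subanalytic function (its graph is subanalytic in ℝⁿ × ℝ). -/
open scoped Topology
open Set

/-- A subset of a real normed space is *semianalytic* if, locally, it is a finite union of
finite intersections of zero sets and positivity sets of real-analytic functions. -/
def Semianalytic {E : Type*} [NormedAddCommGroup E] [NormedSpace ℝ E] (A : Set E) : Prop :=
  ∀ x : E, ∃ U ∈ 𝓝 x, ∃ (p q : ℕ) (f g : Fin p → Fin q → E → ℝ),
    (∀ i j, AnalyticOnNhd ℝ (f i j) U) ∧ (∀ i j, AnalyticOnNhd ℝ (g i j) U) ∧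
    A ∩ U = (⋃ i, ⋂ j, {y | f i j y = 0} ∩ {y | 0 < g i j y}) ∩ U

/-- A subset of a real normed space is *subanalytic* if, locally, it is the projection of a
relatively compact semianalytic subset of a product with some `ℝ^m`. -/
def Subanalytic {E : Type*} [NormedAddCommGroup E] [NormedSpace ℝ E] (A : Set E) : Prop :=
  ∀ x : E, ∃ U ∈ 𝓝 x, ∃ (m : ℕ) (B : Set (E × (Fin m → ℝ))),
    Semianalytic B ∧ IsCompact (closure B) ∧ A ∩ U = (Prod.fst '' B) ∩ U

section P1part
open scoped Topology
open Set

/-- Functional calculus: substituting `σ S` for the last variable of an analytic function. -/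
theorem fcalc {E V : Type*} [NormedAddCommGroup E] [NormedSpace ℝ E]
    [NormedRing V] [NormedAlgebra ℝ V] [CompleteSpace V] [NormOneClass V] (S : V) (hS : ‖S‖ ≤ 1)
    (f : E × ℝ → ℝ) (hf : AnalyticAt ℝ f 0) :
    ∃ G : E × ℝ → V, AnalyticAt ℝ G 0 ∧ G 0 = f 0 • (1 : V) ∧
      ∀ᶠ z in 𝓝 (0 : E × ℝ), ∀ τ : ℝ, |τ| ≤ 1 → ∀ l : V →L[ℝ] ℝ,
        (∀ n : ℕ, l (S ^ n) = τ ^ n * l 1) → l (G z) = f (z.1, z.2 * τ) * l 1 := by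
  obtain ⟨p, r, hp⟩ := hf
  let L1 : E × ℝ →L[ℝ] E × ℝ := (ContinuousLinearMap.inl ℝ E ℝ).comp (ContinuousLinearMap.fst ℝ E ℝ)
  let L2 : E × ℝ →L[ℝ] E × ℝ := (ContinuousLinearMap.inr ℝ E ℝ).comp (ContinuousLinearMap.snd ℝ E ℝ)
  have hSn : ∀ n : ℕ, ‖S ^ n‖ ≤ 1 := fun n => by
    induction n with
    | zero => simp
    | succ n ih =>
      rw [pow_succ]
      exact (norm_mul_le _ _).trans (mul_le_one₀ ih (norm_nonneg _) hS)
  let P : FormalMultilinearSeries ℝ (E × ℝ) V := fun n =>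
    ∑ s : Finset (Fin n), ((p n).compContinuousLinearMap
      (fun i => if i ∈ s then L1 else L2)).smulRight (S ^ (sᶜ).card)
  have hL : ∀ (b : Prop) [Decidable b] (z : E × ℝ), ‖(if b then L1 else L2) z‖ ≤ ‖z‖ := by
    intro b _ z
    split_ifs
    · simp [L1, Prod.norm_def]
    · simp [L2, Prod.norm_def]
  have hPn : ∀ n, ‖P n‖ ≤ 2 ^ n * ‖p n‖ := by
    intro n
    refine ContinuousMultilinearMap.opNorm_le_bound (by positivity) fun m => ?_
    have : P n m = ∑ s : Finset (Fin n), (p n (fun i => (if i ∈ s then L1 else L2) (m i))) •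
        (S ^ (sᶜ).card) := by
      simp [P]
    rw [this]
    refine (norm_sum_le _ _).trans ?_
    calc _ ≤ ∑ s : Finset (Fin n), ‖p n‖ * ∏ i, ‖m i‖ := by
          refine Finset.sum_le_sum fun s _ => ?_
          refine (norm_smul_le _ _).trans ?_
          calc _ ≤ (‖p n‖ * ∏ i, ‖m i‖) * 1 := by
                refine mul_le_mul ?_ (hSn _) (norm_nonneg _) (by positivity)
                refine ((p n).le_opNorm _).trans ?_
                gcongr
                exact hL _ _
            _ = _ := mul_one _
      _ = _ := by simp [mul_assoc]
  -- radius
  obtain ⟨r0, hr0, hr0r⟩ : ∃ r0 : NNReal, 0 < r0 ∧ (r0 : ENNReal) < r := by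
    obtain ⟨q, hq, hq'⟩ := ENNReal.lt_iff_exists_nnreal_btwn.1 hp.r_pos
    exact ⟨q, by exact_mod_cast hq, hq'⟩
  obtain ⟨C, hC, hCb⟩ := p.norm_mul_pow_le_of_lt_radius (hr0r.trans_le hp.r_le)
  have hrad : ((r0 / 2 : NNReal) : ENNReal) ≤ P.radius := by
    refine P.le_radius_of_bound C fun n => ?_
    calc ‖P n‖ * ((r0 / 2 : NNReal) : ℝ) ^ n ≤ (2 ^ n * ‖p n‖) * ((r0 / 2 : NNReal) : ℝ) ^ n := by
          gcongr; exact hPn n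
      _ = ‖p n‖ * (r0 : ℝ) ^ n := by
          push_cast; rw [div_pow]; field_simp
      _ ≤ C := hCb n
  have hradpos : 0 < P.radius := lt_of_lt_of_le (by positivity) hrad
  have hG := P.hasFPowerSeriesOnBall hradpos
  have hPapp : ∀ n (z : E × ℝ), P n (fun _ => z) = ∑ s : Finset (Fin n),
      (p n (s.piecewise (fun _ => (z.1, (0:ℝ))) (fun _ => ((0:E), z.2)))) • (S ^ (sᶜ).card) := by
    intro n z
    simp only [P, sum_apply, ContinuousMultilinearMap.smulRight_apply,
      ContinuousMultilinearMap.compContinuousLinearMap_apply]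
    refine Finset.sum_congr rfl fun s _ => ?_
    congr 2
    funext i
    by_cases hi : i ∈ s <;> simp [hi, L1, L2]
  refine ⟨P.sum, ⟨P, hG.hasFPowerSeriesAt⟩, ?_, ?_⟩
  · have h1 := hG.coeff_zero (fun _ => 0)
    have h2 := hp.coeff_zero (fun _ => 0)
    rw [← h1, ← h2]
    have := hPapp 0 0
    have e : ∀ q : Fin 0 → E × ℝ, q = fun _ => 0 := fun q => Subsingleton.elim _ _
    rw [e (fun _ => 0), this]
    rw [Fintype.sum_unique, e (Finset.piecewise _ _ _)]
    have : ((default : Finset (Fin 0))ᶜ).card = 0 := by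
      rw [Finset.card_eq_zero]; exact Subsingleton.elim _ _
    rw [this, pow_zero]
  · have hball : Metric.eball (0 : E × ℝ) (min P.radius r) ∈ 𝓝 (0 : E × ℝ) :=
      Metric.eball_mem_nhds _ (lt_min hradpos hp.r_pos)
    filter_upwards [hball] with z hz τ hτ l hl
    have hz1 : z ∈ Metric.eball (0 : E × ℝ) P.radius :=
      Metric.eball_subset_eball (min_le_left _ _) hz
    have hz2 : z ∈ Metric.eball (0 : E × ℝ) r :=
      Metric.eball_subset_eball (min_le_right _ _) hz
    have hz3 : (z.1, z.2 * τ) ∈ Metric.eball (0 : E × ℝ) r := by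
      rw [Metric.mem_eball] at hz2 ⊢
      refine lt_of_le_of_lt ?_ hz2
      rw [edist_zero_right, edist_zero_right, enorm_le_iff_norm_le]
      simp only [Prod.norm_def, norm_mul, Real.norm_eq_abs]
      refine max_le_max le_rfl ?_
      exact mul_le_of_le_one_right (abs_nonneg _) hτ
    have s1 := (hG.hasSum hz1).mapL l
    have s2 := (hp.hasSum hz3).mul_right (l 1)
    rw [zero_add] at s1 s2
    have key : ∀ n, l (P n fun _ => z) = (p n fun _ => (z.1, z.2 * τ)) * l 1 := by
      intro n
      have h0 : (fun _ : Fin n => (z.1, z.2 * τ)) =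
          (fun _ => (z.1, (0:ℝ))) + (fun _ => ((0:E), z.2 * τ)) := by
        funext i; simp
      rw [h0, (p n).map_add_univ, hPapp, map_sum, Finset.sum_mul]
      refine Finset.sum_congr rfl fun s _ => ?_
      rw [map_smul, hl, smul_eq_mul]
      have h1 : s.piecewise (fun _ => (z.1, (0:ℝ))) (fun _ => ((0:E), z.2 * τ)) =
          (sᶜ).piecewise (fun i => τ • (s.piecewise (fun _ => (z.1, (0:ℝ)))
            (fun _ => ((0:E), z.2)) : Fin n → E × ℝ) i) (s.piecewise (fun _ => (z.1, (0:ℝ)))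
            (fun _ => ((0:E), z.2))) := by
        funext i
        by_cases hi : i ∈ s <;> simp [hi, mul_comm]
      rw [h1, (p n).map_piecewise_smul (fun _ => τ)]
      simp
      ring
    simp only [key] at s1
    exact s1.unique s2

end P1part

section P2part
open scoped Topology BoundedContinuousFunction
open Set

/-- The space of bounded sequences, used as a space of power series. -/
def Lseq : Type := BoundedContinuousFunction ℕ ℝ

noncomputable instance : NormedAddCommGroup Lseq :=
  inferInstanceAs (NormedAddCommGroup (BoundedContinuousFunction ℕ ℝ))
noncomputable instance : NormedSpace ℝ Lseq :=
  inferInstanceAs (NormedSpace ℝ (BoundedContinuousFunction ℕ ℝ))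
instance : CompleteSpace Lseq :=
  inferInstanceAs (CompleteSpace (BoundedContinuousFunction ℕ ℝ))
instance : FunLike Lseq ℕ ℝ :=
  inferInstanceAs (FunLike (BoundedContinuousFunction ℕ ℝ) ℕ ℝ)

@[ext] theorem Lseq.ext {a b : Lseq} (h : ∀ n, a n = b n) : a = b := DFunLike.ext _ _ h
@[simp] theorem Lseq.add_apply (a b : Lseq) (n : ℕ) : (a + b) n = a n + b n := rfl
@[simp] theorem Lseq.sub_apply (a b : Lseq) (n : ℕ) : (a - b) n = a n - b n := rfl
@[simp] theorem Lseq.smul_apply (c : ℝ) (b : Lseq) (n : ℕ) : (c • b) n = c * b n := rfl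
@[simp] theorem Lseq.zero_apply (n : ℕ) : (0 : Lseq) n = 0 := rfl
theorem Lseq.norm_coe_le (a : Lseq) (n : ℕ) : |a n| ≤ ‖a‖ :=
  BoundedContinuousFunction.norm_coe_le_norm (α := ℕ) (β := ℝ) a n

/-- build a bounded sequence -/
noncomputable def Lseq.mk (f : ℕ → ℝ) (C : ℝ) (h : ∀ n, |f n| ≤ C) : Lseq :=
  BoundedContinuousFunction.ofNormedAddCommGroupDiscrete f C h
@[simp] theorem Lseq.mk_apply (f : ℕ → ℝ) (C : ℝ) (h : ∀ n, |f n| ≤ C) (n : ℕ) :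
    Lseq.mk f C h n = f n := rfl
theorem Lseq.norm_mk_le (f : ℕ → ℝ) (C : ℝ) (h : ∀ n, |f n| ≤ C) (hC : 0 ≤ C) :
    ‖Lseq.mk f C h‖ ≤ C :=
  BoundedContinuousFunction.norm_ofNormedAddCommGroup_le continuous_of_discreteTopology hC h

/-- backward shift -/
noncomputable def bshift : Lseq →L[ℝ] Lseq :=
  LinearMap.mkContinuous
    { toFun := fun a => Lseq.mk
        (fun n => a (n + 1)) ‖a‖ (fun n => a.norm_coe_le _)
      map_add' := fun a b => by ext; rfl
      map_smul' := fun c b => by ext; rfl } 1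
    (fun a => by
      rw [one_mul]
      exact Lseq.norm_mk_le _ _ (fun n => a.norm_coe_le _) (norm_nonneg _))

/-- forward shift -/
noncomputable def fshift : Lseq →L[ℝ] Lseq :=
  LinearMap.mkContinuous
    { toFun := fun a => Lseq.mk
        (fun n => Nat.casesOn n 0 (fun k => a k)) ‖a‖
        (fun n => by cases n with
          | zero => simp
          | succ n => exact a.norm_coe_le _)
      map_add' := fun a b => by ext n; cases n <;> simp
      map_smul' := fun c b => by ext n; cases n <;> simp } 1
    (fun a => by
      rw [one_mul]
      exact Lseq.norm_mk_le _ _ (fun n => by cases n with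
          | zero => simp
          | succ n => exact a.norm_coe_le _) (norm_nonneg _))

/-- zeroth coefficient -/
noncomputable def coef0 : Lseq →L[ℝ] ℝ :=
  LinearMap.mkContinuous
    { toFun := fun a => a 0
      map_add' := fun a b => rfl
      map_smul' := fun c b => rfl } 1
    (fun a => by
      rw [one_mul]
      exact a.norm_coe_le _)

/-- the constant series one -/
noncomputable def lone : Lseq :=
  Lseq.mk
        (fun n => if n = 0 then 1 else 0) 1
        (fun n => by split_ifs <;> simp)

@[simp] theorem bshift_apply (a : Lseq) (n : ℕ) : bshift a n = a (n + 1) := rfl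
@[simp] theorem fshift_zero (a : Lseq) : fshift a 0 = 0 := rfl
@[simp] theorem fshift_succ (a : Lseq) (n : ℕ) : fshift a (n + 1) = a n := rfl
@[simp] theorem coef0_apply (a : Lseq) : coef0 a = a 0 := rfl
@[simp] theorem lone_apply (n : ℕ) : lone n = if n = 0 then 1 else 0 := rfl

theorem norm_bshift_le : ‖bshift‖ ≤ 1 := LinearMap.mkContinuous_norm_le _ zero_le_one _
theorem norm_fshift_le : ‖fshift‖ ≤ 1 := LinearMap.mkContinuous_norm_le _ zero_le_one _

theorem bshift_fshift (a : Lseq) : bshift (fshift a) = a := by ext n; simp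

theorem bshift_pow_apply (k : ℕ) (a : Lseq) (n : ℕ) : (bshift ^ k) a n = a (n + k) := by
  induction k generalizing a n with
  | zero => simp
  | succ k ih => rw [pow_succ', mul_apply_eq_comp, bshift_apply, ih]; congr 1; ring

theorem fshift_pow_apply (k : ℕ) (a : Lseq) (n : ℕ) :
    (fshift ^ k) a n = if n < k then 0 else a (n - k) := by
  induction k generalizing a n with
  | zero => simp
  | succ k ih =>
    rw [pow_succ', mul_apply_eq_comp]
    cases n with
    | zero => simp
    | succ n => rw [fshift_succ, ih]; simp

instance : Nontrivial Lseq := ⟨⟨lone, 0, fun h => by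
  have := congrArg (fun a : Lseq => a 0) h
  simp at this⟩⟩

/-- evaluation of a sequence, viewed as a power series, at `τ`. -/
noncomputable def lev (τ : ℝ) : Lseq →L[ℝ] ℝ :=
  coef0.comp (Ring.inverse (1 - τ • bshift))

theorem isUnit_lev {τ : ℝ} (h : |τ| < 1) : IsUnit (1 - τ • bshift) := by
  have : ‖τ • bshift‖ < 1 := by
    rw [norm_smul]
    calc _ ≤ |τ| * 1 := by gcongr; exact le_rfl; exact norm_bshift_le
      _ < 1 := by simpa using h
  exact isUnit_one_sub_of_norm_lt_one this

theorem lev_sub {τ : ℝ} (h : |τ| < 1) (a : Lseq) :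
    lev τ (a - τ • bshift a) = a 0 := by
  have h1 := Ring.inverse_mul_cancel _ (isUnit_lev h)
  have h2 := congrArg (fun T : Lseq →L[ℝ] Lseq => T a) h1
  simp only [mul_apply_eq_comp, sub_apply,
    one_apply_eq_self, smul_apply] at h2
  rw [lev, ContinuousLinearMap.comp_apply, h2, coef0_apply]

theorem lev_eq {τ : ℝ} (h : |τ| < 1) (a : Lseq) :
    lev τ a = a 0 + τ * lev τ (bshift a) := by
  have := lev_sub h a
  rw [map_sub, map_smul, smul_eq_mul] at this
  linarith

theorem lev_fshift {τ : ℝ} (h : |τ| < 1) (a : Lseq) : lev τ (fshift a) = τ * lev τ a := by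
  rw [lev_eq h, bshift_fshift, fshift_zero, zero_add]

theorem lev_fshift_pow {τ : ℝ} (h : |τ| < 1) (n : ℕ) (a : Lseq) :
    lev τ ((fshift ^ n) a) = τ ^ n * lev τ a := by
  induction n with
  | zero => simp
  | succ n ih => rw [pow_succ', mul_apply_eq_comp, lev_fshift h, ih]; ring

theorem lev_lone {τ : ℝ} (h : |τ| < 1) : lev τ lone = 1 := by
  have h0 : bshift lone = 0 := by ext n; simp
  rw [lev_eq h, h0]; simp

theorem lev_analytic : AnalyticAt ℝ lev 0 := by
  have h1 : AnalyticAt ℝ (fun τ : ℝ => (1 : Lseq →L[ℝ] Lseq) - τ • bshift) 0 := by fun_prop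
  have h2 : AnalyticAt ℝ (Ring.inverse : (Lseq →L[ℝ] Lseq) → _) (1 - (0:ℝ) • bshift) := by
    have := analyticAt_inverse (𝕜 := ℝ) (1 : (Lseq →L[ℝ] Lseq)ˣ)
    simpa using this
  have h3 := AnalyticAt.fun_comp (g := Ring.inverse) (f := fun τ : ℝ => (1 : Lseq →L[ℝ] Lseq) - τ • bshift) h2 h1
  exact ((ContinuousLinearMap.compL ℝ Lseq Lseq ℝ coef0).analyticAt _).fun_comp h3

theorem lev_zero (a : Lseq) : lev 0 a = a 0 := by
  rw [lev_eq (by simp)]; simp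

theorem lev_sep (a : Lseq) (h : ∀ᶠ τ in 𝓝[≠] (0:ℝ), lev τ a = 0) : a = 0 := by
  have hsm : ∀ᶠ τ in 𝓝[≠] (0:ℝ), |τ| < 1 := by
    have : ∀ᶠ τ in 𝓝 (0:ℝ), |τ| < 1 := by
      have := Metric.ball_mem_nhds (0:ℝ) one_pos
      filter_upwards [this] with τ hτ
      simpa using hτ
    exact this.filter_mono nhdsWithin_le_nhds
  have h0 : ∀ a : Lseq, (∀ᶠ τ in 𝓝[≠] (0:ℝ), lev τ a = 0) → a 0 = 0 := by
    intro a h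
    have hc : ContinuousAt (fun τ => lev τ a) 0 :=
      (((ContinuousLinearMap.apply ℝ ℝ a).analyticAt _).fun_comp lev_analytic).continuousAt
    have h1 : Filter.Tendsto (fun τ => lev τ a) (𝓝[≠] 0) (𝓝 (lev 0 a)) :=
      hc.tendsto.mono_left nhdsWithin_le_nhds
    have h2 : Filter.Tendsto (fun τ => lev τ a) (𝓝[≠] 0) (𝓝 0) :=
      tendsto_const_nhds.congr' (by filter_upwards [h] with τ hτ using hτ.symm)
    rw [← lev_zero]
    exact tendsto_nhds_unique h1 h2
  have hn : ∀ n, ∀ a : Lseq, (∀ᶠ τ in 𝓝[≠] (0:ℝ), lev τ a = 0) → a n = 0 := by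
    intro n
    induction n with
    | zero => exact h0
    | succ n ih =>
      intro a ha
      rw [← bshift_apply]
      apply ih
      have := h0 a ha
      filter_upwards [ha, hsm, self_mem_nhdsWithin] with τ h1 h2 h3
      rw [lev_eq h2, this, zero_add] at h1
      exact (mul_eq_zero.1 h1).resolve_left h3
  ext n
  exact hn n a h

end P2part

section P3part
open scoped Topology
open Set

theorem an_clm_apply {E V W : Type*} [NormedAddCommGroup E] [NormedSpace ℝ E]
    [NormedAddCommGroup V] [NormedSpace ℝ V] [NormedAddCommGroup W] [NormedSpace ℝ W]
    {T : E → V →L[ℝ] W} {v : E → V} {x : E} (hT : AnalyticAt ℝ T x) (hv : AnalyticAt ℝ v x) :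
    AnalyticAt ℝ (fun y => T y (v y)) x :=
  AnalyticAt.fun_comp (g := fun p : (V →L[ℝ] W) × V => p.1 p.2) (f := fun y => (T y, v y))
    (((ContinuousLinearMap.id ℝ (V →L[ℝ] W)).analyticAt_bilinear _)) (hT.prod hv)

theorem wdiv {E : Type*} [NormedAddCommGroup E] [NormedSpace ℝ E]
    (f : E × ℝ → ℝ) (hf : AnalyticAt ℝ f 0) (d : ℕ) (u : ℝ → ℝ) (hu : AnalyticAt ℝ u 0)
    (hu0 : u 0 ≠ 0) (hfu : ∀ᶠ t in 𝓝 (0:ℝ), f (0, t) = t ^ d * u t)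
    (g : E × ℝ → ℝ) (hg : AnalyticAt ℝ g 0) :
    ∃ (q : E × ℝ → ℝ) (r : Fin d → E → ℝ), AnalyticAt ℝ q 0 ∧ (∀ j, AnalyticAt ℝ (r j) 0) ∧
      ∀ᶠ z in 𝓝 (0 : E × ℝ), g z = q z * f z + ∑ j : Fin d, r j z.1 * z.2 ^ (j : ℕ) := by
  obtain ⟨Gf, Gfa, -, Gfl⟩ := fcalc fshift norm_fshift_le f hf
  obtain ⟨Gg, Gga, -, Ggl⟩ := fcalc fshift norm_fshift_le g hg
  have hu' : AnalyticAt ℝ (fun z : E × ℝ => u z.2) 0 :=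
    AnalyticAt.fun_comp (g := u) (f := fun z : E × ℝ => z.2) hu analyticAt_snd
  obtain ⟨Gu, Gua, Gu0, Gul⟩ := fcalc fshift norm_fshift_le _ hu'
  -- the choice of `ε`
  have hunit : ∀ᶠ z in 𝓝 (0 : E × ℝ), IsUnit (Gu z) := by
    have h1 : IsUnit (Gu 0) := by
      rw [Gu0]
      have : IsUnit (u 0 • (1 : Lseq →L[ℝ] Lseq)) := by
        rw [← Algebra.algebraMap_eq_smul_one]
        exact (IsUnit.mk0 _ hu0).map _
      simpa using this
    exact Gua.continuousAt.eventually (Units.isOpen.mem_nhds h1)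
  have hall : ∀ᶠ z in 𝓝 (0 : E × ℝ), IsUnit (Gu z) ∧ AnalyticAt ℝ Gf z ∧ AnalyticAt ℝ Gg z ∧ _ ∧ _ ∧ _ :=
    hunit.and (Gfa.eventually_analyticAt.and (Gga.eventually_analyticAt.and
      (Gfl.eventually_nhds.and (Ggl.eventually_nhds.and Gul.eventually_nhds))))
  have hcur : Filter.Tendsto (fun t : ℝ => ((0 : E), t)) (𝓝[>] 0) (𝓝 (0 : E × ℝ)) := by
    have : Continuous (fun t : ℝ => ((0 : E), t)) := by fun_prop
    exact (this.tendsto 0).mono_left nhdsWithin_le_nhds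
  obtain ⟨ε, ⟨hU, hGf, hGg, hfl, hgl, hul⟩, hε⟩ :=
    ((hcur.eventually hall).and self_mem_nhdsWithin).exists
  replace hε : 0 < ε := hε
  clear hall hunit hcur
  have lift : ∀ {h : E × ℝ → ℝ} {G : E × ℝ → Lseq →L[ℝ] Lseq},
      (∀ᶠ z in 𝓝 ((0 : E), ε), ∀ τ, |τ| ≤ 1 → ∀ l : (Lseq →L[ℝ] Lseq) →L[ℝ] ℝ,
        (∀ n, l (fshift ^ n) = τ ^ n * l 1) → l (G z) = h (z.1, z.2 * τ) * l 1) →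
      ∀ᶠ x in 𝓝 (0 : E), ∀ τ, |τ| < 1 → ∀ v, lev τ (G (x, ε) v) = h (x, ε * τ) * lev τ v := by
    intro h G H
    have hc : Continuous (fun x : E => (x, ε)) := by fun_prop
    filter_upwards [hc.continuousAt.eventually H] with x hx τ hτ v
    have := hx τ hτ.le ((lev τ).comp (ContinuousLinearMap.apply ℝ Lseq v)) (by
      intro n
      exact lev_fshift_pow hτ n v)
    simpa using this
  replace hfl := lift hfl
  replace hgl := lift hgl
  replace hul := lift (h := fun z => u z.2) hul
  obtain ⟨U, hU⟩ := hU
  have key : Gf (0, ε) = ε ^ d • (fshift ^ d * Gu (0, ε)) := by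
    ext1 v
    rw [← sub_eq_zero]
    apply lev_sep
    have hsm : ∀ᶠ τ in 𝓝 (0:ℝ), |τ| < 1 := by
      filter_upwards [Metric.ball_mem_nhds (0:ℝ) one_pos] with τ hτ
      simpa using hτ
    have hfu' : ∀ᶠ τ in 𝓝 (0:ℝ), f (0, ε * τ) = (ε * τ) ^ d * u (ε * τ) := by
      have hc : Filter.Tendsto (fun τ : ℝ => ε * τ) (𝓝 0) (𝓝 0) := by
        have : Continuous (fun τ : ℝ => ε * τ) := by fun_prop
        simpa using this.tendsto 0
      exact hc.eventually hfu
    refine Filter.Eventually.filter_mono nhdsWithin_le_nhds ?_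
    filter_upwards [hsm, hfu'] with τ h1 h2
    rw [map_sub, hfl.self_of_nhds τ h1, smul_apply, map_smul, mul_apply_eq_comp,
      lev_fshift_pow h1, hul.self_of_nhds τ h1, h2, smul_eq_mul]
    ring
  -- the linear operators
  let R : (Fin d → ℝ) →L[ℝ] Lseq :=
    ∑ j : Fin d, (ContinuousLinearMap.proj (R := ℝ) (φ := fun _ : Fin d => ℝ) j).smulRight
      ((fshift ^ (j : ℕ)) lone)
  let Ti : Lseq →L[ℝ] Lseq × (Fin d → ℝ) :=
    ((ε ^ d)⁻¹ • ((↑U⁻¹ : Lseq →L[ℝ] Lseq) * bshift ^ d)).prod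
      (ContinuousLinearMap.pi fun j : Fin d => coef0.comp (bshift ^ (j : ℕ)))
  let M : E → Lseq →L[ℝ] Lseq := fun x =>
    Gf (x, ε) * ((ε ^ d)⁻¹ • ((↑U⁻¹ : Lseq →L[ℝ] Lseq) * bshift ^ d)) +
      R.comp (ContinuousLinearMap.pi fun j : Fin d => coef0.comp (bshift ^ (j : ℕ)))
  have M0 : M 0 = 1 := by
    simp only [M, key]
    rw [← hU]
    have : ε ^ d • (fshift ^ d * (U : Lseq →L[ℝ] Lseq)) *
        ((ε ^ d)⁻¹ • ((↑U⁻¹ : Lseq →L[ℝ] Lseq) * bshift ^ d)) = fshift ^ d * bshift ^ d := by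
      rw [smul_mul_smul_comm, mul_inv_cancel₀ (by positivity), one_smul, mul_assoc,
        Units.mul_inv_cancel_left]
    rw [this]
    ext v n
    have hsum : ∀ (s : Finset (Fin d)) (F : Fin d → Lseq), (∑ j ∈ s, F j) n = ∑ j ∈ s, F j n := by
      intro s F
      classical
      induction s using Finset.induction_on with
      | empty => simp
      | insert a s ha ih => rw [Finset.sum_insert ha, Finset.sum_insert ha, Lseq.add_apply, ih]
    simp only [R, add_apply, mul_apply_eq_comp, fshift_pow_apply, bshift_pow_apply,
      Lseq.add_apply, ContinuousLinearMap.comp_apply, sum_apply, one_apply_eq_self, hsum]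
    simp only [ContinuousLinearMap.smulRight_apply, ContinuousLinearMap.proj_apply,
      ContinuousLinearMap.coe_pi', ContinuousLinearMap.comp_apply, coef0_apply, bshift_pow_apply,
      Lseq.smul_apply, fshift_pow_apply, lone_apply, zero_add]
    by_cases hn : n < d
    · rw [if_pos hn, zero_add, Finset.sum_eq_single ⟨n, hn⟩]
      · simp
      · intro b _ hb
        have : (b : ℕ) ≠ n := fun h => hb (Fin.ext h)
        by_cases h : n < b
        · simp [h]
        · have : n - b ≠ 0 := by omega
          simp [h, this]
      · simp
    · rw [if_neg hn, Finset.sum_eq_zero, add_zero]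
      · congr 1; omega
      · intro b _
        have : n - b ≠ 0 := by omega
        have h : ¬ n < b := by omega
        simp [h, this]
  have hpair : AnalyticAt ℝ (fun x : E => (x, ε)) 0 := by fun_prop
  have hGf' : AnalyticAt ℝ (fun x => Gf (x, ε)) 0 :=
    AnalyticAt.fun_comp (g := Gf) (f := fun x : E => (x, ε)) hGf hpair
  have hGg' : AnalyticAt ℝ (fun x => Gg (x, ε)) 0 :=
    AnalyticAt.fun_comp (g := Gg) (f := fun x : E => (x, ε)) hGg hpair
  have hM : AnalyticAt ℝ M 0 := (hGf'.mul analyticAt_const).add analyticAt_const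
  have hMi : AnalyticAt ℝ (fun x => Ring.inverse (M x)) 0 := by
    refine AnalyticAt.fun_comp (g := Ring.inverse) (f := M) ?_ hM
    rw [M0]
    exact analyticAt_inverse (𝕜 := ℝ) (1 : (Lseq →L[ℝ] Lseq)ˣ)
  have hMu : ∀ᶠ x in 𝓝 (0:E), IsUnit (M x) := by
    refine hM.continuousAt.eventually (Units.isOpen.mem_nhds ?_)
    rw [M0]; exact isUnit_one
  let w : E → Lseq := fun x => Ring.inverse (M x) (Gg (x, ε) lone)
  have hw : AnalyticAt ℝ w 0 := by
    refine an_clm_apply hMi ?_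
    exact an_clm_apply hGg' analyticAt_const
  have hdivi : AnalyticAt ℝ (fun z : E × ℝ => z.2 / ε) 0 :=
    analyticAt_snd.fun_div analyticAt_const hε.ne'
  have hlev : AnalyticAt ℝ (fun z : E × ℝ => lev (z.2 / ε)) 0 := by
    refine AnalyticAt.fun_comp (g := lev) (f := fun z : E × ℝ => z.2 / ε) ?_ hdivi
    simpa using lev_analytic
  refine ⟨fun z => lev (z.2 / ε) ((Ti (w z.1)).1), fun j x => (Ti (w x)).2 j / ε ^ (j : ℕ),
    ?_, ?_, ?_⟩
  · refine an_clm_apply hlev ?_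
    have h1 : AnalyticAt ℝ (fun z : E × ℝ => w z.1) 0 :=
      AnalyticAt.fun_comp (g := w) (f := fun z : E × ℝ => z.1) hw analyticAt_fst
    exact (((ContinuousLinearMap.fst ℝ _ _).comp Ti).analyticAt _).fun_comp h1
  · intro j
    refine AnalyticAt.fun_div ?_ analyticAt_const (by positivity)
    exact (((ContinuousLinearMap.proj (R := ℝ) (φ := fun _ : Fin d => ℝ) j).comp
      ((ContinuousLinearMap.snd ℝ _ _).comp Ti)).analyticAt _).fun_comp hw
  · have hfst : Filter.Tendsto (fun z : E × ℝ => z.1) (𝓝 0) (𝓝 0) := continuous_fst.tendsto 0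
    have hτ : ∀ᶠ z in 𝓝 (0 : E × ℝ), |z.2 / ε| < 1 := by
      have : ContinuousAt (fun z : E × ℝ => |z.2 / ε|) 0 := by fun_prop
      exact this.eventually (gt_mem_nhds (by simp))
    filter_upwards [hfst.eventually hfl, hfst.eventually hgl, hfst.eventually hMu, hτ]
      with z h1 h2 h3 h4
    have e1 : M z.1 (w z.1) = Gg (z.1, ε) lone := by
      have := Ring.mul_inverse_cancel _ h3
      have := congrArg (fun T : Lseq →L[ℝ] Lseq => T (Gg (z.1, ε) lone)) this
      simpa using this
    have e2 : M z.1 (w z.1) = Gf (z.1, ε) (Ti (w z.1)).1 + R (Ti (w z.1)).2 := rfl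
    rw [e2] at e1
    have e3 := congrArg (lev (z.2 / ε)) e1
    have hz : ε * (z.2 / ε) = z.2 := by field_simp
    rw [map_add, h1 _ h4, h2 _ h4, lev_lone h4, hz, mul_one] at e3
    rw [show g z = g (z.1, z.2) from rfl, ← e3, mul_comm]
    congr 1
    simp only [R, sum_apply, map_sum, ContinuousLinearMap.smulRight_apply,
      ContinuousLinearMap.proj_apply, map_smul, lev_fshift_pow h4, lev_lone h4, smul_eq_mul]
    refine Finset.sum_congr rfl fun j _ => ?_
    rw [div_pow]; ring

end P3part

section P3bpart
open scoped Topology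
open Set

theorem wprep_aux (d : ℕ) : ∀ (r : ℕ → ℝ) (w : ℝ → ℝ), ContinuousAt w 0 →
    (∀ᶠ t in 𝓝[≠] (0:ℝ), ∑ j ∈ Finset.range d, r j * t ^ j = t ^ d * w t) → w 0 = 0 := by
  induction d with
  | zero =>
    intro r w hw h
    have h2 : Filter.Tendsto w (𝓝[≠] 0) (𝓝 0) :=
      tendsto_const_nhds.congr' (by filter_upwards [h] with τ hτ using by simpa using hτ)
    exact tendsto_nhds_unique (hw.tendsto.mono_left nhdsWithin_le_nhds) h2
  | succ d ih =>
    intro r w hw h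
    have h1 : r 0 = 0 := by
      have c1 : ContinuousAt (fun t : ℝ => ∑ j ∈ Finset.range (d+1), r j * t ^ j) 0 := by fun_prop
      have c2 : ContinuousAt (fun t : ℝ => t ^ (d+1) * w t) 0 := by fun_prop
      have := tendsto_nhds_unique (c1.tendsto.mono_left nhdsWithin_le_nhds)
        ((c2.tendsto.mono_left nhdsWithin_le_nhds).congr'
          (by filter_upwards [h] with τ hτ using hτ.symm))
      simpa [Finset.sum_range_succ'] using this
    refine ih (fun j => r (j+1)) w hw ?_
    filter_upwards [h, self_mem_nhdsWithin] with t ht h0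
    rw [Finset.sum_range_succ', h1] at ht
    have h0 : t ≠ 0 := h0
    apply mul_left_cancel₀ h0
    rw [Finset.mul_sum]
    calc _ = ∑ k ∈ Finset.range d, r (k + 1) * t ^ (k + 1) := by
          refine Finset.sum_congr rfl fun k _ => by ring
      _ = _ := by linear_combination ht

theorem order_exists (h : ℝ → ℝ) (hh : AnalyticAt ℝ h 0) (hn : ¬ ∀ᶠ t in 𝓝 (0:ℝ), h t = 0) :
    ∃ (d : ℕ) (u : ℝ → ℝ), AnalyticAt ℝ u 0 ∧ u 0 ≠ 0 ∧ ∀ᶠ t in 𝓝 (0:ℝ), h t = t ^ d * u t := by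
  obtain ⟨d, u, h1, h2, h3⟩ := hh.exists_eventuallyEq_pow_smul_nonzero_iff.2 hn
  exact ⟨d, u, h1, h2, by simpa using h3⟩

theorem wprep0 {E : Type*} [NormedAddCommGroup E] [NormedSpace ℝ E]
    (f : E × ℝ → ℝ) (hf : AnalyticAt ℝ f 0) (hn : ¬ ∀ᶠ t in 𝓝 (0:ℝ), f (0, t) = 0) :
    ∃ (d : ℕ) (U : E × ℝ → ℝ) (c : Fin d → E → ℝ), AnalyticAt ℝ U 0 ∧ U 0 ≠ 0 ∧
      (∀ j, AnalyticAt ℝ (c j) 0) ∧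
      ∀ᶠ z in 𝓝 (0 : E × ℝ), f z = U z * (z.2 ^ d + ∑ j : Fin d, c j z.1 * z.2 ^ (j : ℕ)) := by
  have hcur : AnalyticAt ℝ (fun t : ℝ => ((0 : E), t)) 0 := by fun_prop
  obtain ⟨d, u, h1, h2, h3⟩ := order_exists (fun t => f (0, t))
    (AnalyticAt.fun_comp (g := f) (f := fun t : ℝ => ((0 : E), t)) hf hcur) hn
  obtain ⟨q, r, hq, hr, hqr⟩ := wdiv f hf d u h1 h2 h3 (fun z => z.2 ^ d) (analyticAt_snd.pow d)
  have hq0 : 1 - q 0 * u 0 = 0 := by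
    have hcq : AnalyticAt ℝ (fun t : ℝ => q (0, t)) 0 :=
      AnalyticAt.fun_comp (g := q) (f := fun t : ℝ => ((0 : E), t)) hq hcur
    refine wprep_aux d (fun j => if hj : j < d then r ⟨j, hj⟩ 0 else 0)
      (fun t => 1 - q (0, t) * u t) ?_ ?_
    · exact (analyticAt_const.sub (hcq.mul h1)).continuousAt
    · refine Filter.Eventually.filter_mono nhdsWithin_le_nhds ?_
      filter_upwards [hcur.continuousAt.eventually hqr, h3] with t ht h3t
      simp only [h3t] at ht
      rw [← Fin.sum_univ_eq_sum_range (fun j => (if hj : j < d then r ⟨j, hj⟩ 0 else 0) * t ^ j)]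
      simp only [Fin.is_lt, dite_true, Fin.eta]
      linear_combination -ht
  have hq00 : q 0 ≠ 0 := by rintro h; simp [h] at hq0
  refine ⟨d, fun z => (q z)⁻¹, fun j x => - r j x, hq.inv hq00, inv_ne_zero hq00,
    fun j => (hr j).neg, ?_⟩
  filter_upwards [hqr, hq.continuousAt.eventually_ne hq00] with z hz hz0
  rw [eq_inv_mul_iff_mul_eq₀ hz0]
  simp only [neg_mul, Finset.sum_neg_distrib]
  linear_combination -hz

/-- Weierstrass preparation at a base point. -/
theorem wprep {E : Type*} [NormedAddCommGroup E] [NormedSpace ℝ E] (p : E)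
    (f : E × ℝ → ℝ) (hf : AnalyticAt ℝ f (p, 0)) (hn : ¬ ∀ᶠ t in 𝓝 (0:ℝ), f (p, t) = 0) :
    ∃ (d : ℕ) (U : E × ℝ → ℝ) (c : Fin d → E → ℝ), AnalyticAt ℝ U (p, 0) ∧ U (p, 0) ≠ 0 ∧
      (∀ j, AnalyticAt ℝ (c j) p) ∧
      ∀ᶠ z in 𝓝 (p, (0:ℝ)), f z = U z * (z.2 ^ d + ∑ j : Fin d, c j z.1 * z.2 ^ (j : ℕ)) := by
  have hs : AnalyticAt ℝ (fun z : E × ℝ => z + (p, 0)) 0 := analyticAt_id.add analyticAt_const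
  obtain ⟨d, U, c, h1, h2, h3, h4⟩ := wprep0 (fun z => f (z + (p, 0)))
    (AnalyticAt.fun_comp (g := f) (f := fun z : E × ℝ => z + (p, 0)) (by simpa using hf) hs)
    (by simpa using hn)
  have hb : AnalyticAt ℝ (fun z : E × ℝ => z - (p, 0)) (p, 0) := analyticAt_id.sub analyticAt_const
  have hb1 : AnalyticAt ℝ (fun x : E => x - p) p := analyticAt_id.sub analyticAt_const
  refine ⟨d, fun z => U (z - (p, 0)), fun j x => c j (x - p), ?_, by simpa using h2, ?_, ?_⟩
  · exact AnalyticAt.fun_comp (g := U) (f := fun z : E × ℝ => z - (p, 0)) (by simpa using h1) hb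
  · intro j
    exact AnalyticAt.fun_comp (g := c j) (f := fun x : E => x - p) (by simpa using h3 j) hb1
  · have ht : Filter.Tendsto (fun z : E × ℝ => z - (p, 0)) (𝓝 (p, 0)) (𝓝 0) := by
      simpa [ContinuousAt] using hb.continuousAt
    filter_upwards [ht.eventually h4] with z hz
    simpa using hz

/-- Hadamard division. -/
theorem hadamard {E : Type*} [NormedAddCommGroup E] [NormedSpace ℝ E]
    (g : E × ℝ → ℝ) (hg : AnalyticAt ℝ g 0) :
    ∃ q : E × ℝ → ℝ, AnalyticAt ℝ q 0 ∧ ∀ᶠ z in 𝓝 (0 : E × ℝ), g z - g (z.1, 0) = z.2 * q z := by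
  obtain ⟨q, r, hq, hr, hqr⟩ := wdiv (fun z : E × ℝ => z.2) analyticAt_snd 1 (fun _ => 1)
    analyticAt_const one_ne_zero (by simp) g hg
  refine ⟨q, hq, ?_⟩
  have hc : Filter.Tendsto (fun z : E × ℝ => (z.1, (0:ℝ))) (𝓝 0) (𝓝 0) := by
    have : Continuous (fun z : E × ℝ => (z.1, (0:ℝ))) := by fun_prop
    exact this.tendsto 0
  filter_upwards [hqr, hc.eventually hqr] with z h1 h2
  simp at h1 h2
  rw [h1, h2]; ring

end P3bpart

section P4part
open scoped Topology
open Set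

section germs
variable {E F G : Type*} [NormedAddCommGroup E] [NormedSpace ℝ E] [NormedAddCommGroup F]
  [NormedSpace ℝ F] [NormedAddCommGroup G] [NormedSpace ℝ G]

theorem ray_zero {f : E → ℝ} {p : E} (hf : AnalyticAt ℝ f p)
    (h : ∀ v : E, ∀ᶠ t in 𝓝 (0:ℝ), f (p + t • v) = 0) : ∀ᶠ x in 𝓝 p, f x = 0 := by
  obtain ⟨r, hr, hball⟩ := Metric.eventually_nhds_iff_ball.1 hf.eventually_analyticAt
  filter_upwards [Metric.ball_mem_nhds p hr] with x hx
  have han : AnalyticOnNhd ℝ (fun t : ℝ => f (p + t • (x - p))) (Icc 0 1) := by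
    intro t ht
    refine AnalyticAt.fun_comp (g := f) (f := fun t : ℝ => p + t • (x - p)) (hball _ ?_)
      (by fun_prop)
    rw [Metric.mem_ball, dist_eq_norm] at hx ⊢
    rw [add_sub_cancel_left, norm_smul, Real.norm_eq_abs, abs_of_nonneg ht.1]
    calc t * ‖x - p‖ ≤ 1 * ‖x - p‖ := by gcongr; exact ht.2
      _ < r := by simpa using hx
  have := han.eqOn_zero_of_preconnected_of_eventuallyEq_zero isPreconnected_Icc
    (left_mem_Icc.2 zero_le_one) (h (x - p)) (right_mem_Icc.2 zero_le_one)
  simpa using this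

theorem exists_ray [Nontrivial E] {f : E → ℝ} {p : E} (hf : AnalyticAt ℝ f p)
    (h : ¬ ∀ᶠ x in 𝓝 p, f x = 0) : ∃ v : E, v ≠ 0 ∧ ¬ ∀ᶠ t in 𝓝 (0:ℝ), f (p + t • v) = 0 := by
  by_contra! hcon
  apply h
  apply ray_zero hf
  intro v
  by_cases hv : v = 0
  · obtain ⟨w, hw⟩ := exists_ne (0 : E)
    have := (hcon w hw).self_of_nhds
    simp only [zero_smul, add_zero] at this
    simp [hv, this]
  · exact hcon v hv

theorem mul_zero_germ {f g : E → ℝ} {p : E} (hf : AnalyticAt ℝ f p) (hg : AnalyticAt ℝ g p)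
    (h : ∀ᶠ x in 𝓝 p, f x * g x = 0) : (∀ᶠ x in 𝓝 p, f x = 0) ∨ ∀ᶠ x in 𝓝 p, g x = 0 := by
  by_contra hcon
  rw [not_or] at hcon
  obtain ⟨h1, h2⟩ := hcon
  obtain ⟨r, hr, hball⟩ := Metric.eventually_nhds_iff_ball.1
    (hf.eventually_analyticAt.and (hg.eventually_analyticAt.and h))
  apply h1
  filter_upwards [Metric.ball_mem_nhds p hr] with x hx
  by_contra hfx
  apply h2
  have hg0 : ∀ᶠ y in 𝓝 x, g y = 0 := by
    filter_upwards [(hball x hx).1.continuousAt.eventually_ne hfx,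
      Metric.isOpen_ball.mem_nhds hx] with y hy hy2
    exact (mul_eq_zero.1 (hball y hy2).2.2).resolve_left hy
  have := AnalyticOnNhd.eqOn_zero_of_preconnected_of_eventuallyEq_zero
    (fun y hy => (hball y hy).2.1) (convex_ball p r).isPreconnected hx hg0
  filter_upwards [Metric.ball_mem_nhds p hr] with y hy
  exact this hy

/-- functions analytic at the origin -/
def An (E : Type*) [NormedAddCommGroup E] [NormedSpace ℝ E] : Subring (E → ℝ) where
  carrier := {f | AnalyticAt ℝ f 0}
  mul_mem' := fun h1 h2 => AnalyticAt.mul h1 h2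
  add_mem' := fun h1 h2 => AnalyticAt.add h1 h2
  neg_mem' := fun h1 => AnalyticAt.neg h1
  zero_mem' := analyticAt_const
  one_mem' := analyticAt_const

/-- functions with zero germ at the origin -/
def nulI (E : Type*) [NormedAddCommGroup E] [NormedSpace ℝ E] : Ideal (An E) where
  carrier := {f | ∀ᶠ x in 𝓝 0, f.1 x = 0}
  add_mem' := fun {a b} (h1 : ∀ᶠ x in 𝓝 0, a.1 x = 0) (h2 : ∀ᶠ x in 𝓝 0, b.1 x = 0) => by
    change ∀ᶠ x in 𝓝 0, a.1 x + b.1 x = 0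
    filter_upwards [h1, h2] with x k1 k2
    rw [k1, k2, add_zero]
  zero_mem' := by change ∀ᶠ x in 𝓝 (0:E), (0:ℝ) = 0; simp
  smul_mem' := fun c {a} (h1 : ∀ᶠ x in 𝓝 0, a.1 x = 0) => by
    change ∀ᶠ x in 𝓝 0, c.1 x * a.1 x = 0
    filter_upwards [h1] with x k1
    rw [k1, mul_zero]

/-- the ring of analytic germs at the origin -/
def Og (E : Type*) [NormedAddCommGroup E] [NormedSpace ℝ E] : Type _ := An E ⧸ nulI E

noncomputable instance : CommRing (Og E) := inferInstanceAs (CommRing (An E ⧸ nulI E))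

/-- the germ of an analytic function -/
noncomputable def og (f : E → ℝ) (hf : AnalyticAt ℝ f 0) : Og E :=
  Ideal.Quotient.mk (nulI E) ⟨f, hf⟩

theorem og_surj (x : Og E) : ∃ f hf, x = og (E := E) f hf := by
  obtain ⟨⟨f, hf⟩, rfl⟩ := Ideal.Quotient.mk_surjective (I := nulI E) x
  exact ⟨f, hf, rfl⟩

theorem og_eq {f g : E → ℝ} {hf : AnalyticAt ℝ f 0} {hg : AnalyticAt ℝ g 0} :
    og f hf = og g hg ↔ ∀ᶠ x in 𝓝 0, f x = g x := by
  unfold og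
  refine (Ideal.Quotient.eq (I := nulI E)).trans ?_
  change (∀ᶠ x in 𝓝 0, f x - g x = 0) ↔ _
  simp only [sub_eq_zero]

theorem og_add {f g : E → ℝ} {hf : AnalyticAt ℝ f 0} {hg : AnalyticAt ℝ g 0} :
    og f hf + og g hg = og (fun x => f x + g x) (hf.add hg) := rfl
theorem og_sub {f g : E → ℝ} {hf : AnalyticAt ℝ f 0} {hg : AnalyticAt ℝ g 0} :
    og f hf - og g hg = og (fun x => f x - g x) (hf.sub hg) := rfl
theorem og_mul {f g : E → ℝ} {hf : AnalyticAt ℝ f 0} {hg : AnalyticAt ℝ g 0} :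
    og f hf * og g hg = og (fun x => f x * g x) (hf.mul hg) := rfl
theorem og_zero : (0 : Og E) = og (fun _ => 0) analyticAt_const := rfl
theorem og_one : (1 : Og E) = og (fun _ => 1) analyticAt_const := rfl
theorem og_eq_zero {f : E → ℝ} {hf : AnalyticAt ℝ f 0} :
    og f hf = 0 ↔ ∀ᶠ x in 𝓝 0, f x = 0 := by rw [og_zero, og_eq]
theorem og_sum {ι : Type*} (s : Finset ι) (f : ι → E → ℝ) (hf : ∀ i, AnalyticAt ℝ (f i) 0) :
    ∑ i ∈ s, og (f i) (hf i) = og (fun x => ∑ i ∈ s, f i x)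
      (Finset.analyticAt_fun_sum _ fun i _ => hf i) := by
  classical
  induction s using Finset.induction_on with
  | empty => simp [og_zero]
  | insert a s ha ih =>
    rw [Finset.sum_insert ha, ih, og_add, og_eq]
    filter_upwards with x
    rw [Finset.sum_insert ha]

/-- pull back of germs -/
noncomputable def pull (φ : E →L[ℝ] F) : Og F →+* Og E :=
  Ideal.quotientMap (nulI E)
    ({ toFun := fun f => ⟨fun x => f.1 (φ x), AnalyticAt.fun_comp (g := f.1) (f := φ)
        (by rw [map_zero]; exact f.2) (φ.analyticAt 0)⟩
       map_one' := rfl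
       map_mul' := fun _ _ => rfl
       map_zero' := rfl
       map_add' := fun _ _ => rfl } : An F →+* An E)
    (fun f (hf : ∀ᶠ x in 𝓝 0, f.1 x = 0) => by
      change ∀ᶠ x in 𝓝 0, f.1 (φ x) = 0
      have : Filter.Tendsto φ (𝓝 0) (𝓝 0) := by simpa using φ.continuous.tendsto 0
      exact this.eventually hf)

theorem an_comp {f : F → ℝ} (hf : AnalyticAt ℝ f 0) (φ : E →L[ℝ] F) :
    AnalyticAt ℝ (fun x => f (φ x)) 0 :=
  AnalyticAt.fun_comp (g := f) (f := φ) (by rwa [map_zero]) (φ.analyticAt 0)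

theorem pull_og (φ : E →L[ℝ] F) (f : F → ℝ) (hf : AnalyticAt ℝ f 0) :
    pull φ (og f hf) = og (fun x => f (φ x)) (an_comp hf φ) := rfl

theorem pull_pull (φ : E →L[ℝ] F) (ψ : F →L[ℝ] G) (x : Og G) :
    pull φ (pull ψ x) = pull (ψ.comp φ) x := by
  obtain ⟨f, hf, rfl⟩ := og_surj x
  rfl

theorem pull_id (x : Og E) : pull (ContinuousLinearMap.id ℝ E) x = x := by
  obtain ⟨f, hf, rfl⟩ := og_surj x
  rfl

/-- value at the origin -/
noncomputable def ev0 : Og E →+* ℝ :=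
  Ideal.Quotient.lift (nulI E)
    ({ toFun := fun f => f.1 0
       map_one' := rfl
       map_mul' := fun _ _ => rfl
       map_zero' := rfl
       map_add' := fun _ _ => rfl } : An E →+* ℝ)
    (fun f (hf : ∀ᶠ x in 𝓝 0, f.1 x = 0) => hf.self_of_nhds)

theorem ev0_og (f : E → ℝ) (hf : AnalyticAt ℝ f 0) : ev0 (og f hf) = f 0 := rfl

theorem isUnit_of_ev0 {x : Og E} (h : ev0 x ≠ 0) : IsUnit x := by
  obtain ⟨f, hf, rfl⟩ := og_surj x
  rw [ev0_og] at h
  refine IsUnit.of_mul_eq_one (og (fun x => (f x)⁻¹) (hf.inv h)) ?_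
  rw [og_mul, og_one, og_eq]
  filter_upwards [hf.continuousAt.eventually_ne h] with x hx
  exact mul_inv_cancel₀ hx

theorem mem_jac_of_ev0 {x : Og E} (h : ev0 x = 0) : x ∈ Ideal.jacobson (⊥ : Ideal (Og E)) := by
  rw [Ideal.mem_jacobson_bot]
  intro y
  apply isUnit_of_ev0
  simp [h]

theorem noeth_abs {A R : Type*} [CommRing A] [CommRing R] [IsNoetherianRing A]
    (h : ∀ f : R, f ≠ 0 → ∃ (φ : A →+* R) (d : ℕ) (b : Fin d → R), ∀ g : R, ∃ (q : R) (r : Fin d → A),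
      g = q * f + ∑ j, φ (r j) * b j) : IsNoetherianRing R := by
  refine (isNoetherianRing_iff_ideal_fg R).2 fun I => ?_
  by_cases hI : I = ⊥
  · rw [hI]; exact Submodule.fg_bot
  obtain ⟨f, hfI, hf0⟩ := Submodule.exists_mem_ne_zero_of_ne_bot hI
  obtain ⟨φ, d, b, hb⟩ := h f hf0
  let _ := φ.toAlgebra
  let ψ : (Fin d → A) →ₗ[A] R := Fintype.linearCombination A b
  have hψ : ∀ r, ψ r = ∑ j, φ (r j) * b j := fun r => by
    simp [ψ, Fintype.linearCombination_apply, Algebra.smul_def, RingHom.algebraMap_toAlgebra]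
  let M : Submodule A (Fin d → A) := (I.restrictScalars A).comap ψ
  obtain ⟨s, hs⟩ := IsNoetherian.noetherian M
  classical
  refine ⟨insert f (s.image ψ), le_antisymm ?_ ?_⟩
  · rw [Ideal.span_le]
    intro x hx
    rw [Finset.coe_insert, Finset.coe_image] at hx
    rcases hx with rfl | ⟨r, hr, rfl⟩
    · exact hfI
    · have : r ∈ M := hs ▸ Submodule.subset_span hr
      exact this
  · intro g hg
    obtain ⟨q, r, hqr⟩ := hb g
    rw [← hψ] at hqr
    have h1 : ψ r ∈ I := by
      have : ψ r = g - q * f := by rw [hqr]; ring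
      rw [this]
      exact I.sub_mem hg (I.mul_mem_left _ hfI)
    have h2 : r ∈ Submodule.span A (s : Set (Fin d → A)) := by rw [hs]; exact h1
    have h3 : ψ r ∈ Submodule.span A (ψ '' s) := by
      rw [← Submodule.map_span]; exact ⟨r, h2, rfl⟩
    have h4 : ψ r ∈ Ideal.span ((insert f (s.image ψ) : Finset R) : Set R) := by
      have := Submodule.span_le_restrictScalars A R (ψ '' s) h3
      refine Ideal.span_mono ?_ this
      rw [Finset.coe_insert, Finset.coe_image]
      exact subset_insert _ _
    rw [hqr]
    refine Ideal.add_mem _ (Ideal.mul_mem_left _ _ (Ideal.subset_span ?_)) h4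
    simp

theorem isNoeth_congr (e : E ≃L[ℝ] F) (h : IsNoetherianRing (Og F)) : IsNoetherianRing (Og E) := by
  refine isNoetherianRing_of_surjective (Og F) (Og E) (pull (e : E →L[ℝ] F)) fun x => ?_
  refine ⟨pull (e.symm : F →L[ℝ] E) x, ?_⟩
  rw [pull_pull]
  convert pull_id x
  ext; simp

theorem exists_equiv_prod [FiniteDimensional ℝ E] {n : ℕ} (hn : Module.finrank ℝ E = n + 1)
    {v : E} (hv : v ≠ 0) : ∃ e : E ≃L[ℝ] (Fin n → ℝ) × ℝ, e v = (0, 1) := by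
  have e0 : E ≃L[ℝ] (Fin n → ℝ) × ℝ := ContinuousLinearEquiv.ofFinrankEq (by simp [hn])
  have h1 : e0 v ≠ 0 := by simpa using hv
  obtain ⟨A, hA⟩ := SeparatingDual.exists_continuousLinearEquiv_apply_eq (R := ℝ) h1
    (show ((0 : Fin n → ℝ), (1:ℝ)) ≠ 0 by simp)
  exact ⟨e0.trans A, by simpa using hA⟩

theorem og_noeth_fin (n : ℕ) : ∀ (E : Type) [NormedAddCommGroup E] [NormedSpace ℝ E]
    [FiniteDimensional ℝ E], Module.finrank ℝ E = n → IsNoetherianRing (Og E) := by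
  induction n with
  | zero =>
    intro E _ _ _ hE
    have : Subsingleton E := Module.finrank_zero_iff.1 hE
    refine isNoetherianRing_of_surjective ℝ (Og E)
      ({ toFun := fun c => og (fun _ => c) analyticAt_const
         map_one' := rfl
         map_mul' := fun _ _ => rfl
         map_zero' := rfl
         map_add' := fun _ _ => rfl } : ℝ →+* Og E) fun x => ?_
    obtain ⟨f, hf, rfl⟩ := og_surj x
    refine ⟨f 0, og_eq.2 (Filter.Eventually.of_forall fun x => ?_)⟩
    rw [Subsingleton.elim x 0]
  | succ n ih =>
    intro E _ _ _ hE
    have hA := ih (Fin n → ℝ) (by simp)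
    refine noeth_abs (A := Og (Fin n → ℝ)) fun f hf => ?_
    obtain ⟨f0, hf0, rfl⟩ := og_surj f
    rw [Ne, og_eq_zero] at hf
    have : Nontrivial E := Module.nontrivial_of_finrank_pos (R := ℝ) (by omega)
    obtain ⟨v, hv, hfv⟩ := exists_ray hf0 hf
    obtain ⟨e, he⟩ := exists_equiv_prod hE hv
    have he' : ∀ t : ℝ, e.symm (0, t) = t • v := fun t => by
      rw [ContinuousLinearEquiv.symm_apply_eq, map_smul, he]; simp
    have hf1 : AnalyticAt ℝ (fun z => f0 (e.symm z)) 0 := an_comp hf0 (e.symm : (Fin n → ℝ) × ℝ →L[ℝ] E)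
    obtain ⟨d, u, hu, hu0, hfu⟩ := order_exists (fun t => f0 (e.symm (0, t)))
      (AnalyticAt.fun_comp (g := fun z => f0 (e.symm z)) (f := fun t : ℝ => ((0 : Fin n → ℝ), t))
        hf1 (by fun_prop)) (by simpa [he'] using hfv)
    refine ⟨pull ((ContinuousLinearMap.fst ℝ _ _).comp (e : E →L[ℝ] (Fin n → ℝ) × ℝ)), d,
      fun j => og (fun x => (((ContinuousLinearMap.snd ℝ _ _).comp (e : E →L[ℝ] (Fin n → ℝ) × ℝ)) x) ^ (j : ℕ))
        ((ContinuousLinearMap.analyticAt _ _).pow _), fun g => ?_⟩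
    obtain ⟨g0, hg0, rfl⟩ := og_surj g
    obtain ⟨q, r, hq, hr, hqr⟩ := wdiv _ hf1 d u hu hu0 hfu (fun z => g0 (e.symm z))
      (an_comp hg0 (e.symm : (Fin n → ℝ) × ℝ →L[ℝ] E))
    have hqe : AnalyticAt ℝ (fun x => q (e x)) 0 := an_comp hq (e : E →L[ℝ] (Fin n → ℝ) × ℝ)
    refine ⟨og (fun x => q (e x)) hqe, fun j => og (r j) (hr j), ?_⟩
    simp only [pull_og, og_mul]
    rw [og_sum, og_add, og_eq]
    have ht : Filter.Tendsto e (𝓝 0) (𝓝 0) := by simpa using e.continuous.tendsto 0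
    filter_upwards [ht.eventually hqr] with x hx
    simpa using hx

end germs

end P4part

section P5part
open scoped Topology
open Set

theorem abs_sep {R : Type*} [CommRing R] [IsNoetherianRing R] {m : ℕ} (y : Fin m → R)
    (hy : ∀ i, y i ∈ Ideal.jacobson (⊥ : Ideal R)) (ρ : R →+* R) (Q : Fin m → R → R)
    (hQadd : ∀ i a b, Q i (a + b) = Q i a + Q i b)
    (hdec : ∀ f, f = ρ f + ∑ i, y i * Q i f)
    (hQlin : ∀ i c h, ρ c = c → Q i (c * h) = c * Q i h) (hρρ : ∀ f, ρ (ρ f) = ρ f)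
    (ev : R →+* ℝ) (hev : ∀ r, ev r ≠ 0 → IsUnit r) (J : Ideal R)
    (hJQ : ∀ i, ∀ k ∈ J, Q i k ∈ J) (hJρ : ∀ k ∈ J, ρ k ∈ J) (hJev : ∀ k ∈ J, ev k = 0)
    (cst : ℝ →+* R) (hcst : ∀ r, ρ (cst r) = cst r) (hevc : ∀ r, ev (cst r) = r) (f : R) :
    ∃ (Λ : Type) (_ : Fintype Λ) (c h : Λ → R), (∀ i, ρ (c i) = c i) ∧ f = ∑ i, c i * h i ∧
      ∀ v : Λ → ℝ, ∑ i, cst (v i) * h i ∈ J → v = 0 := by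
  classical
  let Qw : List (Fin m) → R → R := fun w g => w.foldr (fun i g => Q i g) g
  let T : List (Fin m) → R → R := fun w g => ρ (Qw w g)
  have hQwadd : ∀ w a b, Qw w (a + b) = Qw w a + Qw w b := by
    intro w a b
    induction w with
    | nil => rfl
    | cons i w ih =>
      change Q i (Qw w (a + b)) = Q i (Qw w a) + Q i (Qw w b)
      rw [ih, hQadd]
  have hQwlin : ∀ w c h, ρ c = c → Qw w (c * h) = c * Qw w h := by
    intro w c h hc
    induction w with
    | nil => rfl
    | cons i w ih =>
      change Q i (Qw w (c * h)) = c * Q i (Qw w h)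
      rw [ih, hQlin _ _ _ hc]
  have hQwJ : ∀ w, ∀ k ∈ J, Qw w k ∈ J := by
    intro w k hk
    induction w with
    | nil => exact hk
    | cons i w ih => exact hJQ i _ ih
  have hTlin : ∀ w c h, ρ c = c → T w (c * h) = c * T w h := by
    intro w c h hc
    change ρ (Qw w (c * h)) = c * ρ (Qw w h)
    rw [hQwlin _ _ _ hc, map_mul, hc]
  have hTadd : ∀ w a b, T w (a + b) = T w a + T w b := by
    intro w a b
    change ρ _ = ρ _ + ρ _
    rw [hQwadd, map_add]
  have hTsum : ∀ w (ι : Type) (s : Finset ι) (F : ι → R), T w (∑ i ∈ s, F i) = ∑ i ∈ s, T w (F i) := by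
    intro w ι s F
    exact map_sum (AddMonoidHom.mk' (T w) (hTadd w)) F s
  let C : Set R := range fun w => T w f
  let N : Ideal R := Ideal.span (range fun w => Qw w f)
  have hN : N ≤ Ideal.span C := by
    refine Submodule.le_of_le_smul_of_le_jacobson_bot (I := Ideal.span (range y))
      (IsNoetherian.noetherian N) ?_ ?_
    · rw [Ideal.span_le]; rintro _ ⟨i, rfl⟩; exact hy i
    · rw [show N = Ideal.span (range fun w => Qw w f) from rfl, Ideal.span_le]
      rintro _ ⟨w, rfl⟩
      change Qw w f ∈ _
      rw [hdec (Qw w f)]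
      refine Submodule.add_mem_sup (Ideal.subset_span ⟨w, rfl⟩) (Submodule.sum_mem _ fun i _ => ?_)
      exact Submodule.smul_mem_smul (Ideal.subset_span ⟨i, rfl⟩) (Ideal.subset_span ⟨i :: w, rfl⟩)
  have hf : f ∈ Ideal.span C := hN (Ideal.subset_span ⟨[], rfl⟩)
  have hex : ∃ n : ℕ, ∃ t : Finset (List (Fin m)), t.card = n ∧
      Ideal.span C ≤ Ideal.span ((fun w => T w f) '' t) := by
    have h1 : (Submodule.span R C).FG := IsNoetherian.noetherian _
    obtain ⟨s, hs, hs2⟩ := (Submodule.fg_span_iff_fg_span_finset_subset C).1 h1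
    obtain ⟨t, -, rfl⟩ := Finset.subset_set_image_iff (s := univ) (t := s) (f := fun w => T w f)
      |>.1 (by rw [image_univ]; exact hs)
    refine ⟨t.card, t, rfl, ?_⟩
    rw [Finset.coe_image] at hs2
    exact le_of_eq hs2
  obtain ⟨Λ, hcard, hΛ⟩ := Nat.find_spec hex
  have hmin : ∀ w ∈ Λ, T w f ∉ Ideal.span ((fun w => T w f) '' (Λ.erase w : Finset _)) := by
    intro w hw hcon
    refine Nat.find_min hex (m := (Λ.erase w).card) ?_ ⟨_, rfl, ?_⟩
    · rw [← hcard]; exact Finset.card_erase_lt_of_mem hw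
    · refine hΛ.trans ?_
      rw [Ideal.span_le]
      rintro _ ⟨w', hw', rfl⟩
      by_cases h : w' = w
      · rw [h]; exact hcon
      · exact Ideal.subset_span ⟨w', by simpa [h] using hw', rfl⟩
  have hf2 := hΛ hf
  obtain ⟨h, hh⟩ : ∃ h : Λ → R, f = ∑ w : Λ, T w f * h w := by
    have : (fun w => T w f) '' (Λ : Set (List (Fin m))) = range fun w : Λ => T w f := by
      ext x
      constructor
      · rintro ⟨w, hw, rfl⟩; exact ⟨⟨w, hw⟩, rfl⟩
      · rintro ⟨w, rfl⟩; exact ⟨w, w.2, rfl⟩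
    rw [this] at hf2
    obtain ⟨h, hh⟩ := (Submodule.mem_span_range_iff_exists_fun R).1 hf2
    exact ⟨h, by conv_lhs => rw [← hh]
                 simp [mul_comm]⟩
  have hTρ : ∀ w, ρ (T w f) = T w f := fun w => hρρ _
  have hδ : ∀ α w : Λ, ev (T α (h w)) = if α = w then 1 else 0 := by
    intro α w
    by_contra hne
    have e1 : T α f = ∑ w : Λ, T w f * T α (h w) := by
      conv_lhs => rw [hh]
      rw [hTsum]
      exact Finset.sum_congr rfl fun i _ => hTlin _ _ _ (hTρ _)
    have e2 : ∑ w : Λ, T w f * (T α (h w) - if α = w then 1 else 0) = 0 := by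
      simp only [mul_sub, Finset.sum_sub_distrib, ← e1]
      simp
    rw [← Finset.add_sum_erase _ _ (Finset.mem_univ w)] at e2
    have hu : IsUnit (T α (h w) - if α = w then 1 else 0) := by
      apply hev
      rw [map_sub, sub_ne_zero]
      convert hne using 2
      split_ifs <;> simp
    refine hmin w w.2 ?_
    refine (Ideal.mul_unit_mem_iff_mem _ hu).1 ?_
    rw [eq_neg_of_add_eq_zero_left e2]
    refine Submodule.neg_mem _ (Submodule.sum_mem _ fun i hi => Ideal.mul_mem_right _ _ ?_)
    refine Ideal.subset_span ⟨i, ?_, rfl⟩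
    have : (i : List (Fin m)) ≠ w := fun h => (Finset.mem_erase.1 hi).1 (Subtype.ext h)
    simp [this]
  refine ⟨Λ, inferInstance, fun w => T w f, h, fun w => hTρ w, hh, fun v hv => ?_⟩
  funext α
  have h1 := hJev _ (hJρ _ (hQwJ α _ hv))
  change ev (T α _) = 0 at h1
  rw [hTsum, map_sum] at h1
  simp only [hTlin _ _ _ (hcst _), map_mul, hevc, hδ] at h1
  simpa using h1

end P5part

section P5bpart
open scoped Topology
open Set

section sep
variable {E F : Type} [NormedAddCommGroup E] [NormedSpace ℝ E] [NormedAddCommGroup F]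
  [NormedSpace ℝ F]

theorem hadamard' (g : E → ℝ) (hg : AnalyticAt ℝ g 0) (l : E →L[ℝ] ℝ) (v : E) :
    ∃ q : E → ℝ, AnalyticAt ℝ q 0 ∧ ∀ᶠ z in 𝓝 (0 : E), g z - g (z - l z • v) = l z * q z := by
  let φ : E × ℝ →L[ℝ] E := ContinuousLinearMap.fst ℝ E ℝ +
    ((ContinuousLinearMap.snd ℝ E ℝ) - l.comp (ContinuousLinearMap.fst ℝ E ℝ)).smulRight v
  obtain ⟨q, hq, h⟩ := hadamard (fun z => g (φ z)) (an_comp hg φ)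
  let ψ : E →L[ℝ] E × ℝ := (ContinuousLinearMap.id ℝ E).prod l
  refine ⟨fun z => q (ψ z), an_comp hq ψ, ?_⟩
  have ht : Filter.Tendsto ψ (𝓝 0) (𝓝 0) := by simpa using ψ.continuous.tendsto 0
  filter_upwards [ht.eventually h] with z hz
  simpa [φ, ψ, sub_eq_add_neg] using hz

/-- the germ of a linear functional -/
noncomputable def lg (l : E →L[ℝ] ℝ) : Og E := og (fun x => l x) (l.analyticAt 0)

theorem lg_cancel {l : E →L[ℝ] ℝ} {v : E} (hv : l v = 1) {a b : Og E} (h : lg l * a = lg l * b) :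
    a = b := by
  rw [← sub_eq_zero]
  have h1 : lg l * (a - b) = 0 := by rw [mul_sub, h, sub_self]
  obtain ⟨f, hf, hfe⟩ := og_surj (a - b)
  rw [hfe] at h1 ⊢
  rw [lg, og_mul, og_eq_zero] at h1
  rw [og_eq_zero]
  refine (mul_zero_germ (l.analyticAt 0) hf h1).resolve_left fun h0 => ?_
  have ht : Filter.Tendsto (fun t : ℝ => t • v) (𝓝[≠] 0) (𝓝 0) := by
    have : Continuous (fun t : ℝ => t • v) := by fun_prop
    have := this.tendsto 0
    rw [zero_smul] at this
    exact this.mono_left nhdsWithin_le_nhds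
  obtain ⟨t, h2, h3⟩ := ((ht.eventually h0).and self_mem_nhdsWithin).exists
  rw [map_smul, hv] at h2
  simp at h2
  exact h3 h2

/-- coordinates at least `i` are set to zero -/
noncomputable def PF (m i : ℕ) : (Fin m → ℝ) →L[ℝ] (Fin m → ℝ) :=
  ContinuousLinearMap.pi fun j => if (j : ℕ) < i then ContinuousLinearMap.proj j else 0

theorem PF_apply (m i : ℕ) (y : Fin m → ℝ) (j : Fin m) :
    PF m i y j = if (j : ℕ) < i then y j else 0 := by
  unfold PF
  rw [ContinuousLinearMap.coe_pi']
  split_ifs <;> simp [*]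

/-- same on a product -/
noncomputable def PZ (E : Type) [NormedAddCommGroup E] [NormedSpace ℝ E] (m i : ℕ) :
    E × (Fin m → ℝ) →L[ℝ] E × (Fin m → ℝ) :=
  (ContinuousLinearMap.id ℝ E).prodMap (PF m i)

theorem PZ_apply (m i : ℕ) (z : E × (Fin m → ℝ)) : PZ E m i z = (z.1, PF m i z.2) := rfl

/-- coordinate functionals -/
noncomputable def yl (E : Type) [NormedAddCommGroup E] [NormedSpace ℝ E] {m : ℕ} (i : Fin m) :
    E × (Fin m → ℝ) →L[ℝ] ℝ :=
  (ContinuousLinearMap.proj i).comp (ContinuousLinearMap.snd ℝ E (Fin m → ℝ))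

theorem yl_apply {m : ℕ} (i : Fin m) (z : E × (Fin m → ℝ)) : yl E i z = z.2 i := rfl

theorem exists_Q {m : ℕ} (i : Fin m) (g : Og (E × (Fin m → ℝ))) : ∃ q,
    lg (yl E i) * q = pull (PZ E m (i + 1)) g - pull (PZ E m i) g := by
  obtain ⟨f, hf, rfl⟩ := og_surj g
  obtain ⟨q, hq, h⟩ := hadamard' _ (an_comp hf (PZ E m (i + 1))) (yl E i) (0, Pi.single i 1)
  refine ⟨og q hq, ?_⟩
  rw [lg, og_mul, pull_og, pull_og, og_sub, og_eq]
  filter_upwards [h] with z hz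
  rw [← hz]
  congr 2
  rw [PZ_apply, PZ_apply]
  ext j
  · simp
  · simp only [PF_apply, yl_apply]
    by_cases h1 : j = i
    · subst h1; simp
    · have h2 : (j : ℕ) ≠ i := fun h => h1 (Fin.ext h)
      by_cases h3 : (j : ℕ) < i
      · have h4 : (j : ℕ) < i + 1 := by omega
        simp [h3, h4, h1]
      · have h4 : ¬ (j : ℕ) < i + 1 := by omega
        simp [h3, h4]

/-- constant germs -/
noncomputable def cstR : ℝ →+* Og E where
  toFun := fun c => og (fun _ => c) analyticAt_const
  map_one' := rfl
  map_mul' := fun _ _ => rfl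
  map_zero' := rfl
  map_add' := fun _ _ => rfl

theorem cstR_apply (c : ℝ) : cstR c = og (fun _ : E => c) analyticAt_const := rfl

theorem sep0 [FiniteDimensional ℝ E] {m : ℕ} (f : E × (Fin m → ℝ) → ℝ) (hf : AnalyticAt ℝ f 0) :
    ∃ (Λ : Type) (_ : Fintype Λ) (a : Λ → E → ℝ) (h : Λ → E × (Fin m → ℝ) → ℝ),
      (∀ γ, AnalyticAt ℝ (a γ) 0) ∧ (∀ γ, AnalyticAt ℝ (h γ) 0) ∧
      (∀ᶠ z in 𝓝 0, f z = ∑ γ, a γ z.1 * h γ z) ∧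
      ∀ v : Λ → ℝ, (∀ᶠ y in 𝓝 0, ∑ γ, v γ * h γ (0, y) = 0) → v = 0 := by
  have hno : IsNoetherianRing (Og (E × (Fin m → ℝ))) := og_noeth_fin _ _ rfl
  choose Q hQ using fun i : Fin m => exists_Q (E := E) i
  have hv : ∀ i : Fin m, yl E i (0, Pi.single i 1) = 1 := fun i => by simp [yl_apply]
  have hPF0 : ∀ i, (PZ E m 0).comp (PZ E m i) = PZ E m 0 := fun i => by
    ext z j <;> simp [PZ_apply, PF_apply]
  let rr := ContinuousLinearMap.inr ℝ E (Fin m → ℝ)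
  have hrP : ∀ i, (PZ E m i).comp rr = rr.comp (PF m i) := fun i => by
    ext z j <;> simp [PZ_apply, rr]
  obtain ⟨Λ, hΛ, c, h, hc, hfe, hind⟩ := abs_sep (R := Og (E × (Fin m → ℝ)))
    (fun i => lg (yl E i)) (fun i => mem_jac_of_ev0 (by rw [lg, ev0_og]; simp))
    (pull (PZ E m 0)) Q
    (fun i a b => by
      apply lg_cancel (hv i)
      rw [mul_add, hQ, hQ, hQ, map_add, map_add]; ring)
    (fun g => by
      simp only [hQ]
      rw [Fin.sum_univ_eq_sum_range (fun i => pull (PZ E m (i + 1)) g - pull (PZ E m i) g),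
        Finset.sum_range_sub (fun i => pull (PZ E m i) g), add_sub_cancel]
      have : PZ E m m = ContinuousLinearMap.id ℝ _ := by
        ext z j <;> simp [PZ_apply, PF_apply]
      rw [this, pull_id])
    (fun i c h hc => by
      have h1 : ∀ j, pull (PZ E m j) c = c := fun j => by
        conv_lhs => rw [← hc]
        rw [pull_pull, hPF0, hc]
      apply lg_cancel (hv i)
      rw [hQ, map_mul, map_mul, h1, h1, mul_left_comm, hQ]; ring)
    (fun g => by rw [pull_pull, hPF0])
    ev0 (fun r hr => isUnit_of_ev0 hr) (RingHom.ker (pull rr))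
    (fun i k hk => by
      rw [RingHom.mem_ker] at hk ⊢
      have h1 : lg (ContinuousLinearMap.proj i : (Fin m → ℝ) →L[ℝ] ℝ) * pull rr (Q i k) =
          lg (ContinuousLinearMap.proj i : (Fin m → ℝ) →L[ℝ] ℝ) * 0 := by
        have := congrArg (pull rr) (hQ i k)
        rw [map_mul, map_sub, pull_pull, pull_pull, hrP, hrP, ← pull_pull, ← pull_pull, hk,
          map_zero, map_zero, sub_zero] at this
        rw [mul_zero, ← this]
        rfl
      exact lg_cancel (v := Pi.single i 1) (by simp) h1)
    (fun k hk => by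
      rw [RingHom.mem_ker] at hk ⊢
      rw [pull_pull, hrP, ← pull_pull, hk, map_zero])
    (fun k hk => by
      obtain ⟨f, hf, rfl⟩ := og_surj k
      rw [RingHom.mem_ker, pull_og, og_eq_zero] at hk
      have := hk.self_of_nhds
      rw [ev0_og]
      simpa using this)
    cstR
    (fun _ => rfl) (fun _ => rfl) (og f hf)
  choose C hC hCe using fun γ => og_surj (c γ)
  choose H hH hHe using fun γ => og_surj (h γ)
  refine ⟨Λ, hΛ, fun γ x => C γ (x, 0), H, fun γ => ?_, hH, ?_, ?_⟩
  · exact an_comp (hC γ) (ContinuousLinearMap.inl ℝ E (Fin m → ℝ))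
  · simp only [hCe, hHe, og_mul] at hfe
    rw [og_sum, og_eq] at hfe
    have h2 : ∀ γ, ∀ᶠ z in 𝓝 (0 : E × (Fin m → ℝ)), C γ (z.1, 0) = C γ z := by
      intro γ
      have := hc γ
      rw [hCe, pull_og, og_eq] at this
      filter_upwards [this] with z hz
      rw [← hz, PZ_apply]
      congr 2
    filter_upwards [hfe, Filter.eventually_all.2 h2] with z hz h2
    rw [hz]
    exact Finset.sum_congr rfl fun γ _ => by rw [h2]
  · intro v hv
    apply hind
    rw [RingHom.mem_ker]
    simp only [hHe, cstR_apply, og_mul]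
    rw [og_sum, pull_og, og_eq_zero]
    exact hv

theorem sepS [FiniteDimensional ℝ E] [FiniteDimensional ℝ F] (p : E) (y0 : F) (f : E × F → ℝ)
    (hf : AnalyticAt ℝ f (p, y0)) :
    ∃ (Λ : Type) (_ : Fintype Λ) (_ : Nonempty Λ) (a : Λ → E → ℝ) (h : Λ → E × F → ℝ),
      (∀ γ, AnalyticAt ℝ (a γ) p) ∧ (∀ γ, AnalyticAt ℝ (h γ) (p, y0)) ∧
      (∀ᶠ z in 𝓝 (p, y0), f z = ∑ γ, a γ z.1 * h γ z) ∧
      ∀ v : Λ → ℝ, v ≠ 0 → ¬ ∀ᶠ y in 𝓝 y0, ∑ γ, v γ * h γ (p, y) = 0 := by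
  have e : F ≃L[ℝ] (Fin (Module.finrank ℝ F) → ℝ) := ContinuousLinearEquiv.ofFinrankEq (by simp)
  have hsh : AnalyticAt ℝ (fun z : E × (Fin (Module.finrank ℝ F) → ℝ) =>
      (p + z.1, y0 + e.symm z.2)) 0 :=
    (analyticAt_const.add analyticAt_fst).prod (analyticAt_const.add
      (AnalyticAt.fun_comp (g := e.symm) (e.symm.toContinuousLinearMap.analyticAt _) analyticAt_snd))
  obtain ⟨Λ, hΛ, a, h, ha, hh, hfe, hind⟩ := sep0
    (fun z : E × (Fin (Module.finrank ℝ F) → ℝ) => f (p + z.1, y0 + e.symm z.2))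
    (AnalyticAt.fun_comp (g := f) (f := fun z : E × (Fin (Module.finrank ℝ F) → ℝ) =>
      (p + z.1, y0 + e.symm z.2)) (by simpa using hf) hsh)
  have hb : AnalyticAt ℝ (fun z : E × F => (z.1 - p, e (z.2 - y0))) (p, y0) :=
    (analyticAt_fst.sub analyticAt_const).prod
      (AnalyticAt.fun_comp (g := e) (e.toContinuousLinearMap.analyticAt _)
        (analyticAt_snd.sub analyticAt_const))
  have hbt : Filter.Tendsto (fun z : E × F => (z.1 - p, e (z.2 - y0))) (𝓝 (p, y0)) (𝓝 0) := by
    have := hb.continuousAt.tendsto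
    have h0 : ((p, y0).1 - p, e ((p, y0).2 - y0)) = 0 := by simp
    rwa [h0] at this
  have hfe2 : ∀ᶠ z in 𝓝 (p, y0), f z = ∑ γ, a γ (z.1 - p) * h γ (z.1 - p, e (z.2 - y0)) := by
    filter_upwards [hbt.eventually hfe] with z hz
    simpa using hz
  by_cases hne : Nonempty Λ
  · refine ⟨Λ, hΛ, hne, fun γ x => a γ (x - p), fun γ z => h γ (z.1 - p, e (z.2 - y0)), ?_, ?_,
      hfe2, ?_⟩
    · intro γ
      exact AnalyticAt.fun_comp (g := a γ) (by simpa using ha γ) (analyticAt_id.sub analyticAt_const)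
    · intro γ
      exact AnalyticAt.fun_comp (g := h γ) (f := fun z : E × F => (z.1 - p, e (z.2 - y0)))
        (by
          have h0 : ((p, y0).1 - p, e ((p, y0).2 - y0)) = 0 := by simp
          rw [h0]; exact hh γ) hb
    · intro v hv hcon
      apply hv
      apply hind
      have ht : Filter.Tendsto (fun y => y0 + e.symm y) (𝓝 0) (𝓝 y0) := by
        have : Continuous (fun y => y0 + e.symm y) := by fun_prop
        simpa using this.tendsto 0
      filter_upwards [ht.eventually hcon] with y hy
      simpa using hy
  · rw [not_nonempty_iff] at hne
    refine ⟨Unit, inferInstance, inferInstance, fun _ _ => 0, fun _ _ => 1,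
      fun _ => analyticAt_const, fun _ => analyticAt_const, ?_, ?_⟩
    · filter_upwards [hfe2] with z hz
      simpa using hz
    · intro v hv hcon
      apply hv
      have := hcon.self_of_nhds
      funext u
      simpa using this
end sep

end P5bpart

section P6part
open scoped Topology
open Set

section tarski
open Polynomial

theorem sign_const {r : ℝ[X]} {a b : ℝ} (h : ∀ x ∈ uIcc a b, r.eval x ≠ 0) :
    SignType.sign (r.eval a) = SignType.sign (r.eval b) := by
  have key : ∀ a b : ℝ, (∀ x ∈ uIcc a b, r.eval x ≠ 0) → 0 < r.eval a → 0 < r.eval b := by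
    intro a b h ha
    by_contra hb
    have h0 : (0:ℝ) ∈ uIcc (r.eval a) (r.eval b) := by
      rw [mem_uIcc]; right; exact ⟨not_lt.1 hb, ha.le⟩
    obtain ⟨x, hx, hx0⟩ := intermediate_value_uIcc (f := fun x => r.eval x) (by fun_prop) h0
    exact h x hx hx0
  have hs : ∀ x ∈ uIcc b a, r.eval x ≠ 0 := by rwa [uIcc_comm]
  rcases lt_trichotomy (r.eval a) 0 with h1 | h1 | h1
  · rcases lt_trichotomy (r.eval b) 0 with h2 | h2 | h2
    · rw [sign_neg h1, sign_neg h2]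
    · exact absurd h2 (h b right_mem_uIcc)
    · exact absurd (key b a hs h2) h1.not_gt
  · exact absurd h1 (h a left_mem_uIcc)
  · rw [sign_pos h1, sign_pos (key a b h h1)]

theorem poly_mono {P : ℝ[X]} {a b : ℝ} (hab : a < b)
    (h : ∀ x ∈ Ioo a b, 0 < (derivative P).eval x) : P.eval a < P.eval b := by
  have : StrictMonoOn (fun x => P.eval x) (Icc a b) := by
    refine strictMonoOn_of_deriv_pos (convex_Icc a b) (by fun_prop) ?_
    intro x hx
    rw [interior_Icc] at hx
    rw [Polynomial.deriv]
    exact h x hx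
  exact this (left_mem_Icc.2 hab.le) (right_mem_Icc.2 hab.le) hab

theorem poly_top {P : ℝ[X]} {u : ℝ} (h : ∀ x, u ≤ x → 0 < (derivative P).eval x) :
    ∃ w, u < w ∧ 0 < P.eval w := by
  have hdeg : 0 < P.degree := by
    by_contra hd
    rw [not_lt] at hd
    have := h u le_rfl
    rw [eq_C_of_degree_le_zero hd] at this
    simp at this
  rcases le_total 0 P.leadingCoeff with h1 | h1
  · have := (P.tendsto_atTop_of_leadingCoeff_nonneg hdeg h1).eventually_gt_atTop 0
    obtain ⟨w, hw1, hw2⟩ := (this.and (Filter.eventually_gt_atTop u)).exists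
    exact ⟨w, hw2, hw1⟩
  · have := (P.tendsto_atBot_of_leadingCoeff_nonpos hdeg h1).eventually_lt_atBot (P.eval u)
    obtain ⟨w, hw1, hw2⟩ := (this.and (Filter.eventually_gt_atTop u)).exists
    exact absurd (poly_mono hw2 fun x hx => h x hx.1.le) hw1.not_gt

theorem poly_bot {P : ℝ[X]} {u : ℝ} (h : ∀ x, x ≤ u → 0 < (derivative P).eval x) :
    ∃ w, w < u ∧ P.eval w < 0 := by
  obtain ⟨w, h1, h2⟩ := poly_top (P := -(P.comp (-X))) (u := -u) (fun x hx => by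
    have := h (-x) (by linarith)
    simpa [derivative_comp] using this)
  refine ⟨-w, by linarith, by simpa using h2⟩

/-- existence of a point with prescribed sign in a component -/
theorem step_exists {P P2 : ℝ[X]} {f g : ℝ → ℝ} (hf : Monotone f)
    {Z Z2 : Set ℝ} (hZ2 : Z2.Finite) (hfZ : ∀ z ∈ Z, f z ∈ Z2) (hgZ : ∀ z ∈ Z2, g z ∈ Z)
    (hinj : InjOn f Z) (hfg : ∀ z ∈ Z2, f (g z) = z)
    (hD : ∀ x, (derivative P).eval x = 0 → x ∈ Z)
    (hD2 : ∀ x, (derivative P2).eval x = 0 → x ∈ Z2)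
    (hbg : ∀ z ∈ Z2, SignType.sign (P2.eval z) = SignType.sign (P.eval (g z)))
    {t : ℝ} (ht : t ∉ Z) (hft : f t ∉ Z2)
    (hpos : 0 < (derivative P).eval t) (hpos2 : 0 < (derivative P2).eval (f t)) :
    ∃ s, (∀ x ∈ uIcc (f t) s, x ∉ Z2) ∧ SignType.sign (P.eval t) = SignType.sign (P2.eval s) := by
  have pos_of : ∀ a b, (∀ x ∈ uIcc a b, x ∉ Z) → 0 < (derivative P).eval a →
      0 < (derivative P).eval b := by
    intro a b h h1
    have := sign_const (r := derivative P) (a := a) (b := b) (fun x hx h0 => h x hx (hD x h0))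
    rw [sign_pos h1] at this
    exact sign_eq_one_iff.1 this.symm
  have pos_of2 : ∀ a b, (∀ x ∈ uIcc a b, x ∉ Z2) → 0 < (derivative P2).eval a →
      0 < (derivative P2).eval b := by
    intro a b h h1
    have := sign_const (r := derivative P2) (a := a) (b := b) (fun x hx h0 => h x hx (hD2 x h0))
    rw [sign_pos h1] at this
    exact sign_eq_one_iff.1 this.symm
  -- right end
  have right : 0 ≤ P.eval t → ∃ w, f t < w ∧ 0 < P2.eval w ∧ ∀ x ∈ Ico (f t) w, x ∉ Z2 := by
    intro hPt
    by_cases hne : (Z2 ∩ Ioi (f t)).Nonempty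
    · obtain ⟨w, ⟨hw, hfw⟩, hmin⟩ := (hZ2.inter_of_left (Ioi (f t))).exists_minimalFor id _ hne
      have hmin' : ∀ x ∈ Ico (f t) w, x ∉ Z2 := by
        intro x hx hxZ
        rcases hx.1.eq_or_lt with h | h
        · exact hft (h ▸ hxZ)
        · exact absurd (hmin ⟨hxZ, h⟩ hx.2.le) hx.2.not_ge
      refine ⟨w, hfw, ?_, hmin'⟩
      have htg : t < g w := by
        by_contra hcon
        have := hf (not_lt.1 hcon)
        rw [hfg w hw] at this
        exact absurd hfw this.not_gt
      have hno : ∀ x ∈ Ico t (g w), x ∉ Z := by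
        intro x hx hxZ
        have h1 : f x ≤ w := by rw [← hfg w hw]; exact hf hx.2.le
        have h2 : f x ≠ w := by
          intro h
          rw [← hfg w hw] at h
          exact hx.2.ne (hinj hxZ (hgZ w hw) h)
        exact hmin' (f x) ⟨hf hx.1, lt_of_le_of_ne h1 h2⟩ (hfZ x hxZ)
      have hlt : P.eval t < P.eval (g w) := by
        refine poly_mono htg fun x hx => pos_of t x (fun y hy => ?_) hpos
        rw [uIcc_of_le hx.1.le] at hy
        exact hno y ⟨hy.1, hy.2.trans_lt hx.2⟩
      have := hbg w hw
      rw [sign_pos (lt_of_le_of_lt hPt hlt)] at this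
      exact sign_eq_one_iff.1 this
    · rw [not_nonempty_iff_eq_empty] at hne
      have hno : ∀ x, f t ≤ x → x ∉ Z2 := by
        intro x hx hxZ
        rcases hx.eq_or_lt with h | h
        · exact hft (h ▸ hxZ)
        · have : x ∈ Z2 ∩ Ioi (f t) := ⟨hxZ, h⟩
          rw [hne] at this; exact this
      obtain ⟨w, h1, h2⟩ := poly_top (P := P2) (u := f t) (fun x hx => by
        refine pos_of2 (f t) x (fun y hy => ?_) hpos2
        rw [uIcc_of_le hx] at hy
        exact hno y hy.1)
      exact ⟨w, h1, h2, fun x hx => hno x hx.1⟩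
  -- left end
  have left : P.eval t ≤ 0 → ∃ w, w < f t ∧ P2.eval w < 0 ∧ ∀ x ∈ Ioc w (f t), x ∉ Z2 := by
    intro hPt
    by_cases hne : (Z2 ∩ Iio (f t)).Nonempty
    · obtain ⟨w, ⟨hw, hfw⟩, hmin⟩ := (hZ2.inter_of_left (Iio (f t))).exists_maximalFor id _ hne
      have hmin' : ∀ x ∈ Ioc w (f t), x ∉ Z2 := by
        intro x hx hxZ
        rcases hx.2.eq_or_lt with h | h
        · exact hft (h ▸ hxZ)
        · exact absurd (hmin ⟨hxZ, h⟩ hx.1.le) hx.1.not_ge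
      refine ⟨w, hfw, ?_, hmin'⟩
      have htg : g w < t := by
        by_contra hcon
        have := hf (not_lt.1 hcon)
        rw [hfg w hw] at this
        exact absurd hfw this.not_gt
      have hno : ∀ x ∈ Ioc (g w) t, x ∉ Z := by
        intro x hx hxZ
        have h1 : w ≤ f x := by rw [← hfg w hw]; exact hf hx.1.le
        have h2 : w ≠ f x := by
          intro h
          rw [← hfg w hw] at h
          exact hx.1.ne (hinj (hgZ w hw) hxZ h)
        exact hmin' (f x) ⟨lt_of_le_of_ne h1 h2, hf hx.2⟩ (hfZ x hxZ)
      have hlt : P.eval (g w) < P.eval t := by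
        refine poly_mono htg fun x hx => pos_of t x (fun y hy => ?_) hpos
        rw [uIcc_of_ge hx.2.le] at hy
        exact hno y ⟨hx.1.trans_le hy.1, hy.2⟩
      have := hbg w hw
      rw [sign_neg (lt_of_lt_of_le hlt hPt)] at this
      exact sign_eq_neg_one_iff.1 this
    · rw [not_nonempty_iff_eq_empty] at hne
      have hno : ∀ x, x ≤ f t → x ∉ Z2 := by
        intro x hx hxZ
        rcases hx.eq_or_lt with h | h
        · exact hft (h ▸ hxZ)
        · have : x ∈ Z2 ∩ Iio (f t) := ⟨hxZ, h⟩
          rw [hne] at this; exact this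
      obtain ⟨w, h1, h2⟩ := poly_bot (P := P2) (u := f t) (fun x hx => by
        refine pos_of2 (f t) x (fun y hy => ?_) hpos2
        rw [uIcc_of_ge hx] at hy
        exact hno y hy.2)
      exact ⟨w, h1, h2, fun x hx => hno x hx.2⟩
  have goR : ∀ c, 0 ≤ P.eval t → P2.eval (f t) ≤ c → (∀ w, 0 < P2.eval w → ∃ c', P2.eval (f t) ≤ c' ∧
      c' < P2.eval w ∧ SignType.sign (P.eval t) = SignType.sign c') →
      ∃ s, (∀ x ∈ uIcc (f t) s, x ∉ Z2) ∧ SignType.sign (P.eval t) = SignType.sign (P2.eval s) := by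
    intro _ h1 _ h3
    obtain ⟨w, hw, hPw, hno⟩ := right h1
    obtain ⟨c, hc1, hc2, hc3⟩ := h3 w hPw
    obtain ⟨s, hs, hsc⟩ := intermediate_value_Icc (f := fun x => P2.eval x) hw.le (by fun_prop)
      (show c ∈ Icc _ _ from ⟨hc1, hc2.le⟩)
    simp only at hsc
    refine ⟨s, fun x hx => ?_, by rw [hsc, hc3]⟩
    rw [uIcc_of_le hs.1] at hx
    refine hno x ⟨hx.1, lt_of_le_of_lt hx.2 (lt_of_le_of_ne hs.2 ?_)⟩
    rintro rfl
    exact hc2.ne' hsc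
  have goL : 0 ≥ P.eval t → (∀ w, P2.eval w < 0 → ∃ c', c' ≤ P2.eval (f t) ∧
      P2.eval w < c' ∧ SignType.sign (P.eval t) = SignType.sign c') →
      ∃ s, (∀ x ∈ uIcc (f t) s, x ∉ Z2) ∧ SignType.sign (P.eval t) = SignType.sign (P2.eval s) := by
    intro h1 h3
    obtain ⟨w, hw, hPw, hno⟩ := left h1
    obtain ⟨c, hc1, hc2, hc3⟩ := h3 w hPw
    obtain ⟨s, hs, hsc⟩ := intermediate_value_Icc (f := fun x => P2.eval x) hw.le (by fun_prop)
      (show c ∈ Icc _ _ from ⟨hc2.le, hc1⟩)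
    simp only at hsc
    refine ⟨s, fun x hx => ?_, by rw [hsc, hc3]⟩
    rw [uIcc_of_ge hs.2] at hx
    refine hno x ⟨lt_of_lt_of_le (lt_of_le_of_ne hs.1 ?_) hx.1, hx.2⟩
    rintro rfl
    exact hc2.ne hsc
  by_cases heq : SignType.sign (P.eval t) = SignType.sign (P2.eval (f t))
  · exact ⟨f t, fun x hx => by
      rw [uIcc_self, mem_singleton_iff] at hx; rwa [hx], heq⟩
  rcases lt_trichotomy (P.eval t) 0 with h1 | h1 | h1
  · have h2 : 0 ≤ P2.eval (f t) := by
      by_contra h; exact heq (by rw [sign_neg h1, sign_neg (not_le.1 h)])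
    refine goL h1.le fun w hw => ⟨P2.eval w / 2, by linarith, by linarith, ?_⟩
    rw [sign_neg h1, sign_neg (by linarith)]
  · rcases lt_trichotomy (P2.eval (f t)) 0 with h2 | h2 | h2
    · exact goR 0 h1.ge h2.le fun w hw => ⟨0, h2.le, hw, by rw [h1]⟩
    · exact absurd (by rw [h1, h2]) heq
    · exact goL h1.le fun w hw => ⟨0, h2.le, hw, by rw [h1]⟩
  · have h2 : P2.eval (f t) ≤ 0 := by
      by_contra h; exact heq (by rw [sign_pos h1, sign_pos (not_le.1 h)])
    refine goR 0 h1.le h2 fun w hw => ⟨P2.eval w / 2, by linarith, by linarith, ?_⟩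
    rw [sign_pos h1, sign_pos (by linarith)]

end tarski

end P6part

section P6bpart
open scoped Topology
open Set

section tarski2
open Polynomial

theorem step_inj {p q : ℝ[X]} {f : ℝ → ℝ} (hf : Monotone f)
    (hpf : ∀ t, SignType.sign (p.eval t) = SignType.sign (q.eval (f t)))
    (hp : p ≠ 0) {z1 z2 : ℝ} (hz : z1 < z2) (h0 : p.eval z1 = 0) : f z1 ≠ f z2 := by
  intro h
  refine hp (Polynomial.eq_zero_of_infinite_isRoot p ((Icc_infinite hz).mono ?_))
  intro t ht
  have h1 : f t = f z1 := le_antisymm ((hf ht.2).trans h.ge) (hf ht.1)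
  have h2 := hpf t
  rw [h1, ← hpf z1, h0, sign_zero, sign_eq_zero_iff] at h2
  exact h2

theorem strictMonoOn_finite_id {Z : Set ℝ} (hZ : Z.Finite) {h : ℝ → ℝ} (hm : MapsTo h Z Z)
    (hs : StrictMonoOn h Z) : ∀ z ∈ Z, h z = z := by
  intro z hz
  haveI : Finite Z := hZ
  let k : Z → Z := hm.restrict h Z Z
  have hk : StrictMono k := fun a b hab => hs a.2 b.2 hab
  have h1 := hk.le_apply (x := ⟨z, hz⟩)
  have h2 := hk.apply_le (x := ⟨z, hz⟩)
  exact le_antisymm h2 h1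

theorem step {ι : Type*} [Finite ι] (p q : ι → ℝ[X]) (P P2 : ℝ[X]) {f g : ℝ → ℝ}
    (hf : Monotone f) (hg : Monotone g)
    (hpf : ∀ i t, SignType.sign ((p i).eval t) = SignType.sign ((q i).eval (f t)))
    (hqg : ∀ i t, SignType.sign ((q i).eval t) = SignType.sign ((p i).eval (g t)))
    (i0 : ι) (h0 : p i0 = derivative P) (h0' : q i0 = derivative P2) (hne : derivative P ≠ 0)
    (hbg : ∀ i z, q i ≠ 0 → (q i).eval z = 0 →
      SignType.sign (P2.eval z) = SignType.sign (P.eval (g z)))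
    (hbf : ∀ i z, p i ≠ 0 → (p i).eval z = 0 →
      SignType.sign (P.eval z) = SignType.sign (P2.eval (f z))) :
    ∃ f' : ℝ → ℝ, Monotone f' ∧
      (∀ i t, SignType.sign ((p i).eval t) = SignType.sign ((q i).eval (f' t))) ∧
      ∀ t, SignType.sign (P.eval t) = SignType.sign (P2.eval (f' t)) := by
  classical
  have hz : ∀ i, p i = 0 ↔ q i = 0 := by
    intro i
    constructor
    · intro h
      refine Polynomial.funext fun t => ?_
      have := hqg i t
      rw [h, eval_zero, sign_zero, sign_eq_zero_iff] at this
      simpa using this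
    · intro h
      refine Polynomial.funext fun t => ?_
      have := hpf i t
      rw [h, eval_zero, sign_zero, sign_eq_zero_iff] at this
      simpa using this
  let Z : Set ℝ := {t | ∃ i, p i ≠ 0 ∧ (p i).eval t = 0}
  let Z2 : Set ℝ := {t | ∃ i, q i ≠ 0 ∧ (q i).eval t = 0}
  have hZ2 : Z2.Finite := by
    have : Z2 = ⋃ i, {t | q i ≠ 0 ∧ (q i).eval t = 0} := by ext; simp [Z2]
    rw [this]
    refine finite_iUnion fun i => ?_
    by_cases hi : q i = 0
    · simp [hi]
    · exact (Polynomial.finite_setOf_isRoot hi).subset fun t ht => ht.2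
  have hfZ : ∀ z ∈ Z, f z ∈ Z2 := by
    rintro z ⟨i, h1, h2⟩
    refine ⟨i, fun h => h1 ((hz i).2 h), ?_⟩
    have := hpf i z
    rwa [h2, sign_zero, eq_comm, sign_eq_zero_iff] at this
  have hfZ' : ∀ z, f z ∈ Z2 → z ∈ Z := by
    rintro z ⟨i, h1, h2⟩
    refine ⟨i, fun h => h1 ((hz i).1 h), ?_⟩
    have := hpf i z
    rwa [h2, sign_zero, sign_eq_zero_iff] at this
  have hgZ : ∀ z ∈ Z2, g z ∈ Z := by
    rintro z ⟨i, h1, h2⟩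
    refine ⟨i, fun h => h1 ((hz i).1 h), ?_⟩
    have := hqg i z
    rwa [h2, sign_zero, eq_comm, sign_eq_zero_iff] at this
  have hfs : StrictMonoOn f Z := by
    rintro a ⟨i, h1, h2⟩ b hb hab
    exact lt_of_le_of_ne (hf hab.le) (step_inj hf (hpf i) h1 hab h2)
  have hgs : StrictMonoOn g Z2 := by
    rintro a ⟨i, h1, h2⟩ b hb hab
    exact lt_of_le_of_ne (hg hab.le) (step_inj hg (hqg i) h1 hab h2)
  have hfg : ∀ z ∈ Z2, f (g z) = z :=
    strictMonoOn_finite_id (h := fun z => f (g z)) hZ2 (fun z hz => hfZ _ (hgZ z hz))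
      (fun a ha b hb hab => hfs (hgZ a ha) (hgZ b hb) (hgs ha hb hab))
  have hne2 : derivative P2 ≠ 0 := by
    rw [← h0', Ne, ← hz, h0]; exact hne
  have hD : ∀ x, (derivative P).eval x = 0 → x ∈ Z := fun x hx => ⟨i0, by rwa [h0], by rwa [h0]⟩
  have hD2 : ∀ x, (derivative P2).eval x = 0 → x ∈ Z2 :=
    fun x hx => ⟨i0, by rwa [h0'], by rwa [h0']⟩
  have hder : ∀ t, SignType.sign ((derivative P).eval t) =
      SignType.sign ((derivative P2).eval (f t)) := by
    intro t; rw [← h0, ← h0']; exact hpf i0 t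
  have hbg' : ∀ z ∈ Z2, SignType.sign (P2.eval z) = SignType.sign (P.eval (g z)) := by
    rintro z ⟨i, h1, h2⟩; exact hbg i z h1 h2
  have hex : ∀ t, t ∉ Z → ∃ s, (∀ x ∈ uIcc (f t) s, x ∉ Z2) ∧
      SignType.sign (P.eval t) = SignType.sign (P2.eval s) := by
    intro t ht
    have hft : f t ∉ Z2 := fun h => ht (hfZ' t h)
    rcases lt_trichotomy ((derivative P).eval t) 0 with h | h | h
    · have h' := hder t
      rw [sign_neg h, eq_comm, sign_eq_neg_one_iff] at h'
      obtain ⟨s, hs1, hs2⟩ := step_exists (P := -P) (P2 := -P2) hf hZ2 hfZ hgZ hfs.injOn hfg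
        (fun x hx => hD x (by simpa using hx)) (fun x hx => hD2 x (by simpa using hx))
        (fun z hz => by
          rw [eval_neg, eval_neg, Left.sign_neg, Left.sign_neg, hbg' z hz]) ht hft
          (by simpa using h) (by simpa using h')
      refine ⟨s, hs1, ?_⟩
      rw [eval_neg, eval_neg, Left.sign_neg, Left.sign_neg, neg_inj] at hs2
      exact hs2
    · exact absurd (hD t h) ht
    · have h' := hder t
      rw [sign_pos h, eq_comm, sign_eq_one_iff] at h'
      exact step_exists hf hZ2 hfZ hgZ hfs.injOn hfg hD hD2 hbg' ht hft h h'
  let C : ℝ → ℝ → Prop := fun u s => ∀ x ∈ uIcc u s, x ∉ Z2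
  have Csymm : ∀ {u s}, C u s → C s u := fun {u s} h x hx => h x (by rwa [uIcc_comm])
  have Ctrans : ∀ {u s r}, C u s → C s r → C u r := fun {u s r} h h' x hx => by
    rcases uIcc_subset_uIcc_union_uIcc (b := s) hx with hx | hx
    · exact h x hx
    · exact h' x hx
  let f' : ℝ → ℝ := fun t => if t ∈ Z then f t else
    Classical.epsilon (fun s => C (f t) s ∧ SignType.sign (P.eval t) = SignType.sign (P2.eval s))
  have f'Z : ∀ t ∈ Z, f' t = f t := fun t ht => if_pos ht
  have f'n : ∀ t, t ∉ Z → f' t = Classical.epsilon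
      (fun s => C (f t) s ∧ SignType.sign (P.eval t) = SignType.sign (P2.eval s)) :=
    fun t ht => if_neg ht
  have f's : ∀ t, t ∉ Z → C (f t) (f' t) ∧
      SignType.sign (P.eval t) = SignType.sign (P2.eval (f' t)) := by
    intro t ht
    rw [f'n t ht]
    exact Classical.epsilon_spec (hex t ht)
  have hlast : ∀ t, SignType.sign (P.eval t) = SignType.sign (P2.eval (f' t)) := by
    intro t
    by_cases ht : t ∈ Z
    · rw [f'Z t ht]
      obtain ⟨i, h1, h2⟩ := ht
      exact hbf i t h1 h2
    · exact (f's t ht).2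
  refine ⟨f', ?_, ?_, hlast⟩
  · intro t t' htt
    rcases htt.eq_or_lt with rfl | htt
    · exact le_rfl
    by_cases hC : C (f t) (f t')
    · have htZ : t ∉ Z := fun h => hC (f t) left_mem_uIcc (hfZ t h)
      have htZ' : t' ∉ Z := fun h => hC (f t') right_mem_uIcc (hfZ t' h)
      have hnoZ : ∀ x ∈ Icc t t', x ∉ Z := fun x hx h =>
        hC (f x) (by rw [uIcc_of_le (hf htt.le)]; exact ⟨hf hx.1, hf hx.2⟩) (hfZ x h)
      by_cases hsg : SignType.sign (P.eval t) = SignType.sign (P.eval t')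
      · apply le_of_eq
        rw [f'n t htZ, f'n t' htZ', hsg]
        congr 1
        funext s
        exact propext ⟨fun h => ⟨Ctrans (Csymm hC) h.1, h.2⟩, fun h => ⟨Ctrans hC h.1, h.2⟩⟩
      · by_contra hcon
        rw [not_le] at hcon
        have hCC : C (f' t') (f' t) :=
          Ctrans (Csymm (f's t' htZ').1) (Ctrans (Csymm hC) (f's t htZ).1)
        have main : ∀ R R2 : ℝ[X], (∀ x, x ∉ Z → (derivative R).eval x ≠ 0) →
            (∀ x, x ∉ Z2 → (derivative R2).eval x ≠ 0) →
            (0 < (derivative R).eval t) → (0 < (derivative R2).eval (f t)) →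
            SignType.sign (R.eval t) = SignType.sign (R2.eval (f' t)) →
            SignType.sign (R.eval t') = SignType.sign (R2.eval (f' t')) →
            SignType.sign (R.eval t) = SignType.sign (R.eval t') := by
          intro R R2 e1 e2 e3 e4 e5 e6
          have a1 : R.eval t < R.eval t' := by
            refine poly_mono htt fun x hx => ?_
            have := sign_const (r := derivative R) (a := t) (b := x) (fun y hy => e1 y (by
              rw [uIcc_of_le hx.1.le] at hy
              exact hnoZ y ⟨hy.1, hy.2.trans hx.2.le⟩))
            rw [sign_pos e3] at this
            exact sign_eq_one_iff.1 this.symm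
          have a2 : R2.eval (f' t') < R2.eval (f' t) := by
            refine poly_mono hcon fun x hx => ?_
            have hCx : C (f t) x := Ctrans (Ctrans hC (f's t' htZ').1) (fun y hy => hCC y (by
              rw [uIcc_of_le hx.1.le] at hy
              rw [uIcc_of_le hcon.le]
              exact ⟨hy.1, hy.2.trans hx.2.le⟩))
            have := sign_const (r := derivative R2) (a := f t) (b := x) (fun y hy => e2 y (hCx y hy))
            rw [sign_pos e4] at this
            exact sign_eq_one_iff.1 this.symm
          refine le_antisymm (SignType.sign.monotone a1.le) ?_
          rw [e5, e6]
          exact SignType.sign.monotone a2.le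
        have hds := hder t
        rcases lt_trichotomy ((derivative P).eval t) 0 with h | h | h
        · rw [sign_neg h, eq_comm, sign_eq_neg_one_iff] at hds
          have := main (-P) (-P2) (fun x hx h => hx (hD x (by simpa using h)))
            (fun x hx h => hx (hD2 x (by simpa using h))) (by simpa using h) (by simpa using hds)
            (by simp only [eval_neg, Left.sign_neg, hlast t])
            (by simp only [eval_neg, Left.sign_neg, hlast t'])
          simp only [eval_neg, Left.sign_neg, neg_inj] at this
          exact hsg this
        · exact htZ (hD t h)
        · rw [sign_pos h, eq_comm, sign_eq_one_iff] at hds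
          exact hsg (main P P2 (fun x hx h => hx (hD x h))
            (fun x hx h => hx (hD2 x h)) h hds (hlast t) (hlast t'))
    · simp only [C, not_forall, not_not] at hC
      obtain ⟨z, hz1, hz2⟩ := hC
      rw [uIcc_of_le (hf htt.le)] at hz1
      have A1 : f' t ≤ z := by
        by_cases ht : t ∈ Z
        · rw [f'Z t ht]; exact hz1.1
        · by_contra hcon
          refine (f's t ht).1 z ?_ hz2
          rw [mem_uIcc]; left; exact ⟨hz1.1, (not_le.1 hcon).le⟩
      have A2 : z ≤ f' t' := by
        by_cases ht : t' ∈ Z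
        · rw [f'Z t' ht]; exact hz1.2
        · by_contra hcon
          refine (f's t' ht).1 z ?_ hz2
          rw [mem_uIcc]; right; exact ⟨(not_le.1 hcon).le, hz1.2⟩
      exact A1.trans A2
  · intro i t
    by_cases ht : t ∈ Z
    · rw [f'Z t ht]; exact hpf i t
    · by_cases hi : q i = 0
      · rw [hi, (hz i).2 hi]; simp
      · rw [hpf i t]
        exact sign_const fun x hx h => (f's t ht).1 x hx ⟨i, hi, h⟩

end tarski2

end P6bpart

section P6cpart
open scoped Topology
open Set

section tarski3
open Polynomial

theorem pseudo_div {A : Type*} [CommRing A] (T : A[X]) (e : ℕ) (hT : T.natDegree ≤ e + 1) :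
    ∀ (n : ℕ) (P : A[X]), P.natDegree ≤ e + n →
      ∃ S R : A[X], C (T.coeff (e+1)) ^ n * P = S * T + R ∧ R.natDegree ≤ e := by
  intro n
  induction n with
  | zero => intro P hP; exact ⟨0, P, by simp, hP⟩
  | succ n ih =>
    intro P hP
    obtain ⟨S, R, h1, h2⟩ := ih (C (T.coeff (e+1)) * P - C (P.coeff (e+n+1)) * X^n * T) (by
      rw [natDegree_le_iff_coeff_eq_zero]
      intro N hN
      rw [coeff_sub, coeff_C_mul, mul_assoc, coeff_C_mul, coeff_X_pow_mul', if_pos (by omega)]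
      rcases Nat.lt_or_ge (e+n+1) N with h | h
      · rw [coeff_eq_zero_of_natDegree_lt (by omega : P.natDegree < N),
          coeff_eq_zero_of_natDegree_lt (by omega : T.natDegree < N - n)]
        simp
      · obtain rfl : N = e+n+1 := by omega
        rw [show e+n+1-n = e+1 by omega]; ring)
    refine ⟨S + C (T.coeff (e+1))^n * C (P.coeff (e+n+1)) * X^n, R, ?_, h2⟩
    linear_combination h1

theorem trunc_div {A : Type*} [CommRing A] (Q P : A[X]) (e : ℕ) :
    ∃ R : A[X], R.natDegree ≤ e ∧ ∀ φ : A →+* ℝ, φ (Q.coeff (e+1)) ≠ 0 →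
      (∀ j, e + 1 < j → φ (Q.coeff j) = 0) → ∀ z, (Q.map φ).eval z = 0 →
      SignType.sign ((P.map φ).eval z) = SignType.sign ((R.map φ).eval z) := by
  let T : A[X] := ∑ j ∈ Finset.range (e+2), C (Q.coeff j) * X^j
  have hTc : ∀ k, T.coeff k = if k < e+2 then Q.coeff k else 0 := by
    intro k
    simp only [T, finset_sum_coeff, coeff_C_mul_X_pow]
    rw [Finset.sum_ite_eq]
    simp
  have hT : T.natDegree ≤ e + 1 := by
    rw [natDegree_le_iff_coeff_eq_zero]
    intro N hN
    rw [hTc, if_neg (by omega)]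
  obtain ⟨S, R, h1, h2⟩ := pseudo_div T e hT (2 * P.natDegree) P (by omega)
  refine ⟨R, h2, fun φ hφ hφ2 z hz => ?_⟩
  have hTQ : T.map φ = Q.map φ := by
    ext k
    rw [coeff_map, coeff_map, hTc]
    split_ifs with h
    · rfl
    · rw [hφ2 k (by omega), map_zero]
  have h3 := congrArg (fun r => (r.map φ).eval z) h1
  simp only [Polynomial.map_mul, Polynomial.map_add, Polynomial.map_pow, eval_mul, eval_add,
    eval_pow, map_C, eval_C, hTQ, hz, mul_zero, zero_add] at h3
  have hp : 0 < φ (Q.coeff (e+1)) ^ (2 * P.natDegree) := by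
    rw [pow_mul]
    exact pow_pos (by positivity) _
  rw [← h3, hTc, if_pos (by omega), sign_mul, sign_pos hp, one_mul]

theorem tarski_aux {A : Type*} [CommRing A] (d : ℕ) : ∀ PP : Finset A[X],
    (∀ P ∈ PP, P.natDegree ≤ d) → ∃ 𝒜 : Finset A, ∀ φ ψ : A →+* ℝ,
      (∀ a ∈ 𝒜, SignType.sign (φ a) = SignType.sign (ψ a)) → ∃ f : ℝ → ℝ, Monotone f ∧
      ∀ P ∈ PP, ∀ t, SignType.sign ((P.map φ).eval t) = SignType.sign ((P.map ψ).eval (f t)) := by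
  classical
  induction d with
  | zero =>
    intro PP hPP
    refine ⟨PP.image fun P => P.coeff 0, fun φ ψ h => ⟨id, monotone_id, fun P hP t => ?_⟩⟩
    rw [eq_C_of_natDegree_le_zero (hPP P hP)]
    simp only [map_C, eval_C]
    exact h _ (Finset.mem_image_of_mem _ hP)
  | succ d ihd =>
    have main : ∀ k : ℕ, ∀ PP : Finset A[X], (∀ P ∈ PP, P.natDegree ≤ d+1) →
        (PP.filter fun P => P.natDegree = d+1).card ≤ k → ∃ 𝒜 : Finset A, ∀ φ ψ : A →+* ℝ,
        (∀ a ∈ 𝒜, SignType.sign (φ a) = SignType.sign (ψ a)) → ∃ f : ℝ → ℝ, Monotone f ∧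
        ∀ P ∈ PP, ∀ t, SignType.sign ((P.map φ).eval t) =
          SignType.sign ((P.map ψ).eval (f t)) := by
      intro k
      induction k with
      | zero =>
        intro PP hPP hc
        refine ihd PP fun P hP => ?_
        rw [Nat.le_zero, Finset.card_eq_zero, Finset.filter_eq_empty_iff] at hc
        have := hPP P hP
        have := hc hP
        omega
      | succ k ihk =>
        intro PP hPP hc
        by_cases hex : ∃ P ∈ PP, P.natDegree = d+1
        swap
        · exact ihk PP hPP (by
            rw [Finset.filter_eq_empty_iff.2 (fun P hP h => hex ⟨P, hP, h⟩)]; simp)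
        obtain ⟨P, hP, hPd⟩ := hex
        set rest := PP.erase P with hrest
        have hrc : (rest.filter fun P => P.natDegree = d+1).card ≤ k := by
          have : rest.filter (fun P => P.natDegree = d+1)
              = (PP.filter fun P => P.natDegree = d+1).erase P := by
            rw [hrest, Finset.filter_erase]
          rw [this, Finset.card_erase_of_mem (Finset.mem_filter.2 ⟨hP, hPd⟩)]
          omega
        have hrd : ∀ Q ∈ rest, Q.natDegree ≤ d+1 := fun Q hQ => hPP Q (Finset.mem_of_mem_erase hQ)
        have addlow : ∀ L : Finset A[X], (∀ Q ∈ L, Q.natDegree ≤ d) →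
            ∃ 𝒜 : Finset A, ∀ φ ψ : A →+* ℝ,
            (∀ a ∈ 𝒜, SignType.sign (φ a) = SignType.sign (ψ a)) → ∃ f : ℝ → ℝ, Monotone f ∧
            ∀ P ∈ rest ∪ L, ∀ t, SignType.sign ((P.map φ).eval t) =
              SignType.sign ((P.map ψ).eval (f t)) := by
          intro L hL
          refine ihk (rest ∪ L) (fun Q hQ => ?_) ?_
          · rcases Finset.mem_union.1 hQ with h | h
            · exact hrd Q h
            · exact (hL Q h).trans (by omega)
          · rw [Finset.filter_union, (Finset.filter_eq_empty_iff (s := L)).2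
              (fun Q hQ h => by have := hL Q hQ; omega), Finset.union_empty]
            exact hrc
        have hdP : (derivative P).natDegree ≤ d := by
          have := natDegree_derivative_le P; omega
        obtain ⟨𝒜l, hl⟩ := addlow {P.eraseLead} (by
          intro Q hQ
          rw [Finset.mem_singleton] at hQ
          rw [hQ]
          have := P.eraseLead_natDegree_le; omega)
        choose R hR1 hR2 using fun (Q : A[X]) (e : ℕ) => trunc_div Q P e
        set QQ := insert (derivative P) rest with hQQ
        have hQQd : ∀ Q ∈ QQ, Q.natDegree ≤ d+1 := by
          intro Q hQ
          rcases Finset.mem_insert.1 hQ with h | h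
          · rw [h]; omega
          · exact hrd Q h
        obtain ⟨𝒜h, hh⟩ := addlow (insert (derivative P)
          ((QQ ×ˢ Finset.range (d+1)).image fun q => R q.1 q.2)) (by
          intro Q hQ
          rcases Finset.mem_insert.1 hQ with h | h
          · rwa [h]
          · obtain ⟨q, hq, rfl⟩ := Finset.mem_image.1 h
            have := Finset.mem_range.1 (Finset.mem_product.1 hq).2
            exact (hR1 _ _).trans (by omega))
        refine ⟨𝒜l ∪ 𝒜h ∪ (insert P QQ).biUnion fun Q => (Finset.range (d+2)).image Q.coeff, ?_⟩
        have hcoef : ∀ φ ψ : A →+* ℝ, (∀ a ∈ 𝒜l ∪ 𝒜h ∪ (insert P QQ).biUnion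
            fun Q => (Finset.range (d+2)).image Q.coeff, SignType.sign (φ a) = SignType.sign (ψ a)) →
            ∀ Q ∈ insert P QQ, ∀ j, SignType.sign (φ (Q.coeff j)) = SignType.sign (ψ (Q.coeff j)) := by
          intro φ ψ h Q hQ j
          by_cases hj : j < d + 2
          · refine h _ (Finset.mem_union_right _ (Finset.mem_biUnion.2 ⟨Q, hQ, ?_⟩))
            exact Finset.mem_image_of_mem _ (Finset.mem_range.2 hj)
          · have : Q.natDegree ≤ d+1 := by
              rcases Finset.mem_insert.1 hQ with h | h
              · rw [h]; omega
              · exact hQQd Q h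
            rw [coeff_eq_zero_of_natDegree_lt (by omega)]; simp
        have hzero : ∀ {φ ψ : A →+* ℝ} {a : A}, SignType.sign (φ a) = SignType.sign (ψ a) →
            (φ a = 0 ↔ ψ a = 0) := by
          intro φ ψ a h
          rw [← sign_eq_zero_iff, h, sign_eq_zero_iff]
        -- the boundary condition
        have hbd : ∀ (φ ψ : A →+* ℝ) (f : ℝ → ℝ), (∀ a ∈ 𝒜l ∪ 𝒜h ∪ (insert P QQ).biUnion
            fun Q => (Finset.range (d+2)).image Q.coeff, SignType.sign (φ a) = SignType.sign (ψ a)) →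
            (∀ P_1 ∈ rest ∪ insert (derivative P)
              ((QQ ×ˢ Finset.range (d+1)).image fun q => R q.1 q.2), ∀ t,
              SignType.sign ((P_1.map φ).eval t) = SignType.sign ((P_1.map ψ).eval (f t))) →
            ∀ Q ∈ QQ, ∀ z, Q.map φ ≠ 0 → (Q.map φ).eval z = 0 →
            SignType.sign ((P.map φ).eval z) = SignType.sign ((P.map ψ).eval (f z)) := by
          intro φ ψ f hA hf Q hQ z hne hz
          have hco := hcoef φ ψ hA Q (Finset.mem_insert_of_mem hQ)
          have hdeg : (Q.map φ).natDegree ≤ d + 1 := natDegree_map_le.trans (hQQd Q hQ)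
          obtain ⟨e, he⟩ : ∃ e, (Q.map φ).natDegree = e + 1 := by
            refine Nat.exists_eq_succ_of_ne_zero fun h => hne ?_
            rw [eq_C_of_natDegree_eq_zero h] at hz ⊢
            rw [eval_C] at hz
            rw [hz, C_0]
          have c1 : φ (Q.coeff (e+1)) ≠ 0 := by
            rw [← coeff_map, ← he]
            exact leadingCoeff_ne_zero.2 hne
          have c2 : ∀ j, e + 1 < j → φ (Q.coeff j) = 0 := by
            intro j hj
            rw [← coeff_map]
            exact coeff_eq_zero_of_natDegree_lt (by omega)
          have hz2 : (Q.map ψ).eval (f z) = 0 := by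
            have := hf Q (by
              rcases Finset.mem_insert.1 hQ with h | h
              · rw [h]; simp
              · exact Finset.mem_union_left _ h) z
            rwa [hz, sign_zero, eq_comm, sign_eq_zero_iff] at this
          rw [hR2 Q e φ c1 c2 z hz, hR2 Q e ψ (fun h => c1 ((hzero (hco _)).2 h))
            (fun j hj => (hzero (hco _)).1 (c2 j hj)) (f z) hz2]
          refine hf _ (Finset.mem_union_right _ (Finset.mem_insert_of_mem ?_)) z
          exact Finset.mem_image.2 ⟨(Q, e), Finset.mem_product.2 ⟨hQ,
            Finset.mem_range.2 (by omega)⟩, rfl⟩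
        intro φ ψ hA
        have hA' : ∀ a ∈ 𝒜l ∪ 𝒜h ∪ (insert P QQ).biUnion
            fun Q => (Finset.range (d+2)).image Q.coeff,
            SignType.sign (ψ a) = SignType.sign (φ a) := fun a ha => (hA a ha).symm
        have hPc := hcoef φ ψ hA P (Finset.mem_insert_self _ _)
        by_cases hlc : φ P.leadingCoeff = 0
        · obtain ⟨f, hf1, hf2⟩ := hl φ ψ (fun a ha => hA a (by simp [ha]))
          refine ⟨f, hf1, fun Q hQ t => ?_⟩
          by_cases hQP : Q = P
          · have e1 : ∀ χ : A →+* ℝ, χ P.leadingCoeff = 0 → P.map χ = P.eraseLead.map χ := by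
              intro χ hχ
              have := congrArg (Polynomial.map χ) P.eraseLead_add_C_mul_X_pow
              rw [Polynomial.map_add, Polynomial.map_mul, map_C, hχ, C_0, zero_mul, add_zero] at this
              exact this.symm
            have hlc' : ψ P.leadingCoeff = 0 := (hzero (hPc _)).1 hlc
            rw [hQP, e1 φ hlc, e1 ψ hlc']
            exact hf2 _ (by simp) t
          · exact hf2 Q (Finset.mem_union_left _ (Finset.mem_erase.2 ⟨hQP, hQ⟩)) t
        · obtain ⟨f, hf1, hf2⟩ := hh φ ψ (fun a ha => hA a (by simp [ha]))
          obtain ⟨g, hg1, hg2⟩ := hh ψ φ (fun a ha => hA' a (by simp [ha]))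
          have hmem : ∀ Q ∈ QQ, Q ∈ rest ∪ insert (derivative P)
              ((QQ ×ˢ Finset.range (d+1)).image fun q => R q.1 q.2) := by
            intro Q hQ
            rcases Finset.mem_insert.1 hQ with h | h
            · rw [h]; simp
            · exact Finset.mem_union_left _ h
          obtain ⟨f', k1, k2, k3⟩ := step (ι := QQ) (fun Q => Q.1.map φ) (fun Q => Q.1.map ψ)
            (P.map φ) (P.map ψ) hf1 hg1 (fun Q t => hf2 Q.1 (hmem _ Q.2) t)
            (fun Q t => hg2 Q.1 (hmem _ Q.2) t) ⟨derivative P, Finset.mem_insert_self _ _⟩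
            (derivative_map P φ).symm (derivative_map P ψ).symm (by
              intro h
              have h1 := natDegree_eq_zero_of_derivative_eq_zero h
              have h2 := natDegree_map_of_leadingCoeff_ne_zero φ hlc
              omega)
            (fun Q z h1 h2 => hbd ψ φ g hA' hg2 Q.1 Q.2 z h1 h2)
            (fun Q z h1 h2 => hbd φ ψ f hA hf2 Q.1 Q.2 z h1 h2)
          refine ⟨f', k1, fun Q hQ t => ?_⟩
          by_cases hQP : Q = P
          · rw [hQP]; exact k3 t
          · exact k2 ⟨Q, Finset.mem_insert_of_mem (Finset.mem_erase.2 ⟨hQP, hQ⟩)⟩ t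
    intro PP hPP
    exact main _ PP hPP le_rfl

theorem tarski {A : Type*} [CommRing A] (PP : Finset A[X]) : ∃ 𝒜 : Finset A, ∀ φ ψ : A →+* ℝ,
      (∀ a ∈ 𝒜, SignType.sign (φ a) = SignType.sign (ψ a)) → ∃ f : ℝ → ℝ, Monotone f ∧
      ∀ P ∈ PP, ∀ t, SignType.sign ((P.map φ).eval t) = SignType.sign ((P.map ψ).eval (f t)) :=
  tarski_aux (PP.sup natDegree) PP fun _ hP => Finset.le_sup (f := natDegree) hP

end tarski3

end P6cpart

section P7part
open scoped Topology
open Set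

section semi
variable {E : Type} [NormedAddCommGroup E] [NormedSpace ℝ E]
  {F : Type} [NormedAddCommGroup F] [NormedSpace ℝ F]
  {G : Type} [NormedAddCommGroup G] [NormedSpace ℝ G]

/-- germ-semianalytic at `p` -/
def SemiAt (p : E) (S : Set E) : Prop :=
  ∃ (ι : Type) (_ : Finite ι) (f : ι → E → ℝ) (Sg : Set (ι → SignType)),
    (∀ i, AnalyticAt ℝ (f i) p) ∧ ∀ᶠ x in 𝓝 p, (x ∈ S ↔ (fun i => SignType.sign (f i x)) ∈ Sg)

theorem SemiAt.congr {p : E} {S T : Set E} (h : SemiAt p S) (hST : ∀ᶠ x in 𝓝 p, (x ∈ T ↔ x ∈ S)) :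
    SemiAt p T := by
  obtain ⟨ι, hι, f, Sg, hf, hS⟩ := h
  refine ⟨ι, hι, f, Sg, hf, ?_⟩
  filter_upwards [hS, hST] with x h1 h2
  rw [h2, h1]

theorem SemiAt.compl {p : E} {S : Set E} (h : SemiAt p S) : SemiAt p Sᶜ := by
  obtain ⟨ι, hι, f, Sg, hf, hS⟩ := h
  refine ⟨ι, hι, f, Sgᶜ, hf, ?_⟩
  filter_upwards [hS] with x h1
  rw [mem_compl_iff, mem_compl_iff, h1]

theorem SemiAt.inter {p : E} {S T : Set E} (h : SemiAt p S) (h' : SemiAt p T) : SemiAt p (S ∩ T) := by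
  obtain ⟨ι, hι, f, Sg, hf, hS⟩ := h
  obtain ⟨ι', hι', f', Sg', hf', hS'⟩ := h'
  refine ⟨ι ⊕ ι', inferInstance, Sum.elim f f',
    {s | (fun i => s (Sum.inl i)) ∈ Sg ∧ (fun i => s (Sum.inr i)) ∈ Sg'}, ?_, ?_⟩
  · rintro (i | i)
    · exact hf i
    · exact hf' i
  · filter_upwards [hS, hS'] with x h1 h2
    rw [mem_inter_iff, h1, h2]; rfl

theorem SemiAt.union {p : E} {S T : Set E} (h : SemiAt p S) (h' : SemiAt p T) :
    SemiAt p (S ∪ T) := by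
  have := (h.compl.inter h'.compl).compl
  rwa [← compl_union, compl_compl] at this

theorem SemiAt.univ (p : E) : SemiAt p univ :=
  ⟨Empty, inferInstance, fun i => i.elim, Set.univ, fun i => i.elim, by simp⟩

theorem SemiAt.of_notMem {p : E} {S : Set E} (h : ∀ᶠ x in 𝓝 p, x ∉ S) : SemiAt p S :=
  (SemiAt.univ p).compl.congr (by filter_upwards [h] with x hx; simp [hx])

theorem SemiAt.iInter {ι : Type} [Finite ι] {p : E} {S : ι → Set E} (h : ∀ i, SemiAt p (S i)) :
    SemiAt p (⋂ i, S i) := by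
  classical
  haveI := Fintype.ofFinite ι
  have : ∀ s : Finset ι, SemiAt p (⋂ i ∈ s, S i) := by
    intro s
    induction s using Finset.induction_on with
    | empty => simpa using SemiAt.univ p
    | insert a s ha ih => rw [Finset.set_biInter_insert]; exact (h a).inter ih
  simpa using this Finset.univ

theorem SemiAt.iUnion {ι : Type} [Finite ι] {p : E} {S : ι → Set E} (h : ∀ i, SemiAt p (S i)) :
    SemiAt p (⋃ i, S i) := by
  have := (SemiAt.iInter fun i => (h i).compl).compl
  rwa [← compl_iUnion, compl_compl] at this

theorem SemiAt.pos {p : E} {f : E → ℝ} (hf : AnalyticAt ℝ f p) : SemiAt p {x | 0 < f x} :=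
  ⟨Unit, inferInstance, fun _ => f, {s | s () = 1}, fun _ => hf, by simp [sign_eq_one_iff]⟩

theorem SemiAt.nonneg {p : E} {f : E → ℝ} (hf : AnalyticAt ℝ f p) : SemiAt p {x | 0 ≤ f x} :=
  (SemiAt.pos hf.neg).compl.congr (by simp)

theorem SemiAt.zero {p : E} {f : E → ℝ} (hf : AnalyticAt ℝ f p) : SemiAt p {x | f x = 0} :=
  ⟨Unit, inferInstance, fun _ => f, {s | s () = 0}, fun _ => hf, by simp⟩

theorem SemiAt.signEq {p : E} {f : E → ℝ} (hf : AnalyticAt ℝ f p) (s : SignType) :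
    SemiAt p {x | SignType.sign (f x) = s} :=
  ⟨Unit, inferInstance, fun _ => f, {s' | s' () = s}, fun _ => hf, by simp⟩

theorem SemiAt.preimage {p : E} {g : E → F} (hg : AnalyticAt ℝ g p) {S : Set F}
    (h : SemiAt (g p) S) : SemiAt p (g ⁻¹' S) := by
  obtain ⟨ι, hι, f, Sg, hf, hS⟩ := h
  refine ⟨ι, hι, fun i x => f i (g x), Sg, fun i => AnalyticAt.fun_comp (g := f i) (f := g) (hf i) hg, ?_⟩
  exact hg.continuousAt.eventually hS

theorem SemiAt.eventually {p : E} {S : Set E} (h : SemiAt p S) : ∀ᶠ q in 𝓝 p, SemiAt q S := by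
  obtain ⟨ι, hι, f, Sg, hf, hS⟩ := h
  filter_upwards [eventually_eventually_nhds.2 hS,
    Filter.eventually_all.2 fun i => (hf i).eventually_analyticAt] with q h1 h2
  exact ⟨ι, hι, f, Sg, h2, h1⟩

theorem Semianalytic.semiAt {S : Set E} (h : Semianalytic S) (p : E) : SemiAt p S := by
  obtain ⟨U, hU, a, b, f, g, hf, hg, hS⟩ := h p
  have hp := mem_of_mem_nhds hU
  refine SemiAt.congr (S := ⋃ i, ⋂ j, {y | f i j y = 0} ∩ {y | 0 < g i j y}) ?_ ?_
  · exact SemiAt.iUnion fun i => SemiAt.iInter fun j =>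
      (SemiAt.zero (hf i j p hp)).inter (SemiAt.pos (hg i j p hp))
  · filter_upwards [hU] with x hx
    have := Set.ext_iff.1 hS x
    simpa only [mem_inter_iff, hx, and_true] using this

theorem semianalytic_of {S : Set E} (h : ∀ p, SemiAt p S) : Semianalytic S := by
  classical
  intro p
  obtain ⟨ι, hι, f, Sg, hf, hS⟩ := h p
  haveI := Fintype.ofFinite ι
  have hU := Filter.eventually_all.2 fun i => (hf i).eventually_analyticAt
  refine ⟨_, hU.and hS, Fintype.card Sg, Fintype.card ι, fun i j x =>
      if ((Fintype.equivFin Sg).symm i).1 ((Fintype.equivFin ι).symm j) = 0 then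
        f ((Fintype.equivFin ι).symm j) x else 0, fun i j x =>
      if ((Fintype.equivFin Sg).symm i).1 ((Fintype.equivFin ι).symm j) = 0 then 1 else
      if ((Fintype.equivFin Sg).symm i).1 ((Fintype.equivFin ι).symm j) = 1 then
        f ((Fintype.equivFin ι).symm j) x else - f ((Fintype.equivFin ι).symm j) x, ?_, ?_, ?_⟩
  · intro i j x hx
    by_cases hc : ((Fintype.equivFin Sg).symm i).1 ((Fintype.equivFin ι).symm j) = 0
    · simp only [hc, if_true]; exact hx.1 _
    · simp only [hc, if_false]; exact analyticAt_const
  · intro i j x hx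
    by_cases hc : ((Fintype.equivFin Sg).symm i).1 ((Fintype.equivFin ι).symm j) = 0
    · simp only [hc, if_true]; exact analyticAt_const
    · by_cases hc' : ((Fintype.equivFin Sg).symm i).1 ((Fintype.equivFin ι).symm j) = 1
      · simp only [hc', if_true]; simpa using hx.1 _
      · simp only [hc, hc', if_false]; exact (hx.1 _).neg
  · ext x
    simp only [mem_inter_iff, and_congr_left_iff]
    intro hx
    rw [hx.2]
    have key : ∀ (s : SignType) (r : ℝ), ((if s = 0 then r else 0) = 0 ∧
        0 < (if s = 0 then 1 else if s = 1 then r else -r)) ↔ SignType.sign r = s := by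
      intro s r
      cases s <;> simp [sign_eq_zero_iff, sign_eq_one_iff, sign_eq_neg_one_iff]
    simp only [mem_iUnion, mem_iInter, mem_inter_iff, mem_setOf_eq]
    constructor
    · intro h
      refine ⟨Fintype.equivFin Sg ⟨_, h⟩, fun j => ?_⟩
      rw [key]
      simp
    · rintro ⟨i, hi⟩
      have : (fun i => SignType.sign (f i x)) = ((Fintype.equivFin Sg).symm i).1 := by
        funext k
        have := hi (Fintype.equivFin ι k)
        rw [key] at this
        simpa using this
      rw [this]
      exact ((Fintype.equivFin Sg).symm i).2

end semi

end P7part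

section P7bpart
open scoped Topology
open Set

section sub
variable {E : Type} [NormedAddCommGroup E] [NormedSpace ℝ E]
  {F : Type} [NormedAddCommGroup F] [NormedSpace ℝ F]
  {G : Type} [NormedAddCommGroup G] [NormedSpace ℝ G]

@[fun_prop] theorem an_fst' {f : E → F × G} {x : E} (hf : AnalyticAt ℝ f x) :
    AnalyticAt ℝ (fun x => (f x).1) x :=
  AnalyticAt.fun_comp (g := Prod.fst) (f := f) analyticAt_fst hf

@[fun_prop] theorem an_snd' {f : E → F × G} {x : E} (hf : AnalyticAt ℝ f x) :
    AnalyticAt ℝ (fun x => (f x).2) x :=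
  AnalyticAt.fun_comp (g := Prod.snd) (f := f) analyticAt_snd hf

theorem bump [FiniteDimensional ℝ E] (p : E) {U : Set E} (hU : U ∈ 𝓝 p) :
    ∃ ρ : E → ℝ, (∀ x, AnalyticAt ℝ ρ x) ∧ 0 < ρ p ∧ {x | 0 ≤ ρ x} ⊆ U ∧
      IsCompact {x | 0 ≤ ρ x} ∧ Convex ℝ {x | 0 ≤ ρ x} ∧ ∀ x, ¬ ∀ᶠ y in 𝓝 x, ρ y = 0 := by
  let e : E ≃L[ℝ] EuclideanSpace ℝ (Fin (Module.finrank ℝ E)) := toEuclidean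
  have hU' : e.symm ⁻¹' U ∈ 𝓝 (e p) := by
    apply e.symm.continuous.continuousAt.preimage_mem_nhds
    simpa using hU
  obtain ⟨r, hr, hb⟩ := Metric.nhds_basis_closedBall.mem_iff.1 hU'
  have hset : {x | 0 ≤ r^2 - ‖e x - e p‖^2} = e.symm '' (Metric.closedBall (e p) r) := by
    ext x
    constructor
    · intro hx
      refine ⟨e x, ?_, by simp⟩
      rw [mem_closedBall_iff_norm]
      simp only [mem_setOf_eq, sub_nonneg] at hx
      exact abs_le_of_sq_le_sq' hx hr.le |>.2
    · rintro ⟨y, hy, rfl⟩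
      rw [mem_closedBall_iff_norm] at hy
      simp only [mem_setOf_eq, sub_nonneg, ContinuousLinearEquiv.apply_symm_apply]
      gcongr
  have han : ∀ x, AnalyticAt ℝ (fun x => r^2 - ‖e x - e p‖^2) x := by
    intro x
    refine analyticAt_const.sub ?_
    have h1 : ∀ x, ‖e x - e p‖^2 = ∑ i, (e x i - e p i)^2 := by
      intro x
      rw [EuclideanSpace.norm_sq_eq]
      simp
    simp_rw [h1]
    refine Finset.analyticAt_fun_sum _ fun i _ => AnalyticAt.pow ?_ 2
    refine AnalyticAt.sub ?_ analyticAt_const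
    exact ((EuclideanSpace.proj i : EuclideanSpace ℝ (Fin (Module.finrank ℝ E)) →L[ℝ] ℝ).comp
      (e : E →L[ℝ] EuclideanSpace ℝ (Fin (Module.finrank ℝ E)))).analyticAt x
  refine ⟨fun x => r^2 - ‖e x - e p‖^2, han, by simpa using pow_pos hr 2, ?_, ?_, ?_, ?_⟩
  · rw [hset]
    rintro _ ⟨y, hy, rfl⟩
    exact hb hy
  · rw [hset]
    exact (isCompact_closedBall _ _).image e.symm.continuous
  · rw [hset]
    exact (convex_closedBall _ _).is_linear_image e.symm.toLinearEquiv.toLinearMap.isLinear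
  · intro x hx
    have := (AnalyticOnNhd.eqOn_zero_of_preconnected_of_eventuallyEq_zero
      (f := fun x => r^2 - ‖e x - e p‖^2) (U := univ) (fun x _ => han x) isPreconnected_univ
      (mem_univ x) hx) (mem_univ p)
    simp only [sub_self, norm_zero, Pi.zero_apply] at this
    have := pow_pos hr 2
    linarith

/-- germ-subanalytic at `p` -/
def SubAt (p : E) (T : Set E) : Prop :=
  ∃ (m : ℕ) (S : Set (E × (Fin m → ℝ))) (K : Set (Fin m → ℝ)), IsCompact K ∧
    (∀ z ∈ S, z.2 ∈ K) ∧ (∀ y, SemiAt (p, y) S) ∧ ∀ᶠ x in 𝓝 p, (x ∈ T ↔ ∃ y, (x, y) ∈ S)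

theorem SubAt.congr {p : E} {S T : Set E} (h : SubAt p S) (hST : ∀ᶠ x in 𝓝 p, (x ∈ T ↔ x ∈ S)) :
    SubAt p T := by
  obtain ⟨m, B, K, h1, h2, h3, h4⟩ := h
  refine ⟨m, B, K, h1, h2, h3, ?_⟩
  filter_upwards [h4, hST] with x h1 h2
  rw [h2, h1]

theorem SubAt.mk [FiniteDimensional ℝ F] {p : E} {T : Set E} (S : Set (E × F))
    (hS : ∀ y, SemiAt (p, y) S) {K : Set F} (hK : IsCompact K)
    (hSK : ∀ᶠ x in 𝓝 p, ∀ y, (x, y) ∈ S → y ∈ K)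
    (hT : ∀ᶠ x in 𝓝 p, (x ∈ T ↔ ∃ y, (x, y) ∈ S)) : SubAt p T := by
  have e : F ≃L[ℝ] (Fin (Module.finrank ℝ F) → ℝ) := ContinuousLinearEquiv.ofFinrankEq (by simp)
  refine ⟨_, {z | (z.1, e.symm z.2) ∈ S ∧ z.2 ∈ e '' K}, e '' K, hK.image e.continuous,
    fun z hz => hz.2, ?_, ?_⟩
  · intro y
    refine SemiAt.congr (S := (fun z : E × (Fin (Module.finrank ℝ F) → ℝ) =>
      (z.1, e.symm z.2)) ⁻¹' S) (SemiAt.preimage (analyticAt_fst.prod ?_) (hS _)) ?_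
    · exact ((e.symm : (Fin (Module.finrank ℝ F) → ℝ) →L[ℝ] F).comp
        (ContinuousLinearMap.snd ℝ E (Fin (Module.finrank ℝ F) → ℝ))).analyticAt _
    · filter_upwards [continuousAt_fst.eventually hSK] with z hz
      constructor
      · exact fun h => h.1
      · exact fun h => ⟨h, ⟨_, hz _ h, by simp⟩⟩
  · filter_upwards [hT, hSK] with x hx hx2
    rw [hx]
    constructor
    · rintro ⟨y, hy⟩
      exact ⟨e y, by simpa using hy, ⟨y, hx2 y hy, rfl⟩⟩
    · rintro ⟨y, hy⟩
      exact ⟨_, hy.1⟩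

theorem SemiAt.subAt {p : E} {T : Set E} (h : SemiAt p T) : SubAt p T :=
  ⟨0, Prod.fst ⁻¹' T, {0}, isCompact_singleton, fun z _ => Subsingleton.elim _ _,
    fun _ => SemiAt.preimage analyticAt_fst h, by simp⟩

theorem SubAt.strong {p : E} {T : Set E} (h : SubAt p T) :
    ∃ (m : ℕ) (S : Set (E × (Fin m → ℝ))) (K : Set (Fin m → ℝ)), IsCompact K ∧
    (∀ z ∈ S, z.2 ∈ K) ∧ (∀ᶠ q in 𝓝 p, ∀ y, SemiAt (q, y) S) ∧
      ∀ᶠ x in 𝓝 p, (x ∈ T ↔ ∃ y, (x, y) ∈ S) := by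
  obtain ⟨m, S, K, h1, h2, h3, h4⟩ := h
  refine ⟨m, S, K, h1, h2, ?_, h4⟩
  have := h1.eventually_forall_of_forall_eventually (x₀ := p)
    (P := fun q y => SemiAt (q, y) S) (fun y _ => by
      have := (h3 y).eventually
      exact this)
  filter_upwards [this] with q hq y
  by_cases hy : y ∈ K
  · exact hq y hy
  · refine SemiAt.of_notMem ?_
    have : ∀ᶠ z in 𝓝 (q, y), z.2 ∈ Kᶜ :=
      continuousAt_snd.eventually (h1.isClosed.isOpen_compl.mem_nhds hy)
    filter_upwards [this] with z hz hzS
    exact hz (h2 z hzS)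

theorem SubAt.eventually {p : E} {T : Set E} (h : SubAt p T) : ∀ᶠ q in 𝓝 p, SubAt q T := by
  obtain ⟨m, S, K, h1, h2, h3, h4⟩ := h.strong
  filter_upwards [h3, eventually_eventually_nhds.2 h4] with q h5 h6
  exact ⟨m, S, K, h1, h2, h5, h6⟩

theorem SubAt.inter {p : E} {S T : Set E} (h : SubAt p S) (h' : SubAt p T) :
    SubAt p (S ∩ T) := by
  obtain ⟨m, B, K, h1, h2, h3, h4⟩ := h
  obtain ⟨m', B', K', h1', h2', h3', h4'⟩ := h'
  refine SubAt.mk (F := (Fin m → ℝ) × (Fin m' → ℝ))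
    ({z | (z.1, z.2.1) ∈ B} ∩ {z | (z.1, z.2.2) ∈ B'}) ?_ (h1.prod h1') ?_ ?_
  · intro y
    refine (SemiAt.preimage (g := fun z : E × ((Fin m → ℝ) × (Fin m' → ℝ)) => (z.1, z.2.1))
      (by fun_prop) (h3 _)).inter (SemiAt.preimage
      (g := fun z : E × ((Fin m → ℝ) × (Fin m' → ℝ)) => (z.1, z.2.2)) (by fun_prop) (h3' _))
  · exact Filter.Eventually.of_forall fun x y hy => ⟨h2 _ hy.1, h2' _ hy.2⟩
  · filter_upwards [h4, h4'] with x hx hx'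
    rw [mem_inter_iff, hx, hx']
    constructor
    · rintro ⟨⟨y, hy⟩, ⟨y', hy'⟩⟩; exact ⟨(y, y'), hy, hy'⟩
    · rintro ⟨y, hy⟩; exact ⟨⟨_, hy.1⟩, ⟨_, hy.2⟩⟩

theorem SubAt.union {p : E} {S T : Set E} (h : SubAt p S) (h' : SubAt p T) :
    SubAt p (S ∪ T) := by
  obtain ⟨m, B, K, h1, h2, h3, h4⟩ := h
  obtain ⟨m', B', K', h1', h2', h3', h4'⟩ := h'
  refine SubAt.mk (F := (Fin m → ℝ) × (Fin m' → ℝ))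
    (({z | (z.1, z.2.1) ∈ B} ∩ ⋂ j, {z | z.2.2 j = 0}) ∪
      ({z | (z.1, z.2.2) ∈ B'} ∩ ⋂ j, {z | z.2.1 j = 0})) ?_
    ((h1.insert 0).prod (h1'.insert 0)) ?_ ?_
  · intro y
    have a1 : ∀ j, AnalyticAt ℝ (fun z : E × ((Fin m → ℝ) × (Fin m' → ℝ)) => z.2.1 j) (p, y) := by
      intro j
      exact ((ContinuousLinearMap.proj j).comp ((ContinuousLinearMap.fst ℝ _ _).comp
        (ContinuousLinearMap.snd ℝ E ((Fin m → ℝ) × (Fin m' → ℝ))))).analyticAt _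
    have a2 : ∀ j, AnalyticAt ℝ (fun z : E × ((Fin m → ℝ) × (Fin m' → ℝ)) => z.2.2 j) (p, y) := by
      intro j
      exact ((ContinuousLinearMap.proj j).comp ((ContinuousLinearMap.snd ℝ _ _).comp
        (ContinuousLinearMap.snd ℝ E ((Fin m → ℝ) × (Fin m' → ℝ))))).analyticAt _
    exact ((SemiAt.preimage (g := fun z : E × ((Fin m → ℝ) × (Fin m' → ℝ)) => (z.1, z.2.1))
      (by fun_prop) (h3 _)).inter (SemiAt.iInter fun j => SemiAt.zero (a2 j))).union
      ((SemiAt.preimage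
      (g := fun z : E × ((Fin m → ℝ) × (Fin m' → ℝ)) => (z.1, z.2.2)) (by fun_prop)
      (h3' _)).inter (SemiAt.iInter fun j => SemiAt.zero (a1 j)))
  · refine Filter.Eventually.of_forall fun x y hy => ?_
    rcases hy with hy | hy
    · refine ⟨Or.inr (h2 _ hy.1), Or.inl ?_⟩
      funext j
      exact mem_iInter.1 hy.2 j
    · refine ⟨Or.inl ?_, Or.inr (h2' _ hy.1)⟩
      funext j
      exact mem_iInter.1 hy.2 j
  · filter_upwards [h4, h4'] with x hx hx'
    rw [mem_union, hx, hx']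
    constructor
    · rintro (⟨y, hy⟩ | ⟨y, hy⟩)
      · exact ⟨(y, 0), Or.inl ⟨hy, by simp⟩⟩
      · exact ⟨(0, y), Or.inr ⟨hy, by simp⟩⟩
    · rintro ⟨y, hy | hy⟩
      · exact Or.inl ⟨_, hy.1⟩
      · exact Or.inr ⟨_, hy.1⟩

theorem SubAt.biInter {ι : Type*} (s : Finset ι) {p : E} {S : ι → Set E}
    (h : ∀ i ∈ s, SubAt p (S i)) : SubAt p (⋂ i ∈ s, S i) := by
  classical
  induction s using Finset.induction_on with
  | empty => simpa using (SemiAt.univ p).subAt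
  | insert a s ha ih =>
    rw [Finset.set_biInter_insert]
    exact (h a (by simp)).inter (ih fun i hi => h i (by simp [hi]))

theorem SubAt.biUnion {ι : Type*} (s : Finset ι) {p : E} {S : ι → Set E}
    (h : ∀ i ∈ s, SubAt p (S i)) : SubAt p (⋃ i ∈ s, S i) := by
  classical
  induction s using Finset.induction_on with
  | empty => simpa using (SemiAt.univ p).compl.subAt
  | insert a s ha ih =>
    rw [Finset.set_biUnion_insert]
    exact (h a (by simp)).union (ih fun i hi => h i (by simp [hi]))

theorem SubAt.preimage {p : E} {g : E → F} (hg : AnalyticAt ℝ g p) {T : Set F}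
    (h : SubAt (g p) T) : SubAt p (g ⁻¹' T) := by
  obtain ⟨m, B, K, h1, h2, h3, h4⟩ := h
  refine ⟨m, (fun z : E × (Fin m → ℝ) => (g z.1, z.2)) ⁻¹' B, K, h1, fun z hz => h2 _ hz, ?_,
    hg.continuousAt.eventually h4⟩
  intro y
  refine SemiAt.preimage (AnalyticAt.prod ?_ analyticAt_snd) (h3 y)
  exact AnalyticAt.fun_comp (g := g) (f := fun z : E × (Fin m → ℝ) => z.1) hg analyticAt_fst

theorem SubAt.proj [FiniteDimensional ℝ G] {p : E} {T : Set (E × G)} {K : Set G}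
    (hK : IsCompact K) (hTK : ∀ᶠ x in 𝓝 p, ∀ z, (x, z) ∈ T → z ∈ K)
    (hT : ∀ z, SubAt (p, z) T) : SubAt p {x | ∃ z, (x, z) ∈ T} := by
  have loc : ∀ z : G, ∃ W ∈ 𝓝 z, SubAt p {x | ∃ w ∈ W, (x, w) ∈ T} := by
    intro z
    obtain ⟨m, S, L, h1, h2, h3, h4⟩ := (hT z).strong
    have h5 := h3.and h4
    rw [nhds_prod_eq, Filter.eventually_prod_iff] at h5
    obtain ⟨pa, hpa, pb, hpb, h6⟩ := h5
    obtain ⟨ρ, r1, r2, r3, r4, -, -⟩ := bump z (U := {w | pb w}) hpb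
    refine ⟨{w | 0 ≤ ρ w}, ?_, ?_⟩
    · filter_upwards [(r1 z).continuousAt.eventually (lt_mem_nhds r2)] with w hw using hw.le
    refine SubAt.mk (F := G × (Fin m → ℝ)) ({q | 0 ≤ ρ q.2.1} ∩ {q | ((q.1, q.2.1), q.2.2) ∈ S})
      ?_ (r4.prod h1) ?_ ?_
    · rintro ⟨w, y⟩
      by_cases hw : 0 ≤ ρ w
      · refine SemiAt.inter (SemiAt.nonneg ?_) ?_
        · exact AnalyticAt.fun_comp (g := ρ) (f := fun q : E × (G × (Fin m → ℝ)) => q.2.1)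
            (r1 _) (by fun_prop)
        · exact SemiAt.preimage (g := fun q : E × (G × (Fin m → ℝ)) => ((q.1, q.2.1), q.2.2))
            (by fun_prop) ((h6 hpa.self_of_nhds (r3 hw)).1 y)
      · refine SemiAt.of_notMem ?_
        have hc : ContinuousAt (fun q : E × (G × (Fin m → ℝ)) => ρ q.2.1) (p, (w, y)) :=
          ContinuousAt.comp (g := ρ) (f := fun q : E × (G × (Fin m → ℝ)) => q.2.1)
            (r1 w).continuousAt (by fun_prop)
        filter_upwards [hc.eventually (gt_mem_nhds (not_le.1 hw))] with q hq hq2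
        exact absurd hq2.1 (not_le.2 hq)
    · exact Filter.Eventually.of_forall fun x y hy => ⟨hy.1, h2 _ hy.2⟩
    · filter_upwards [hpa] with x hx
      constructor
      · rintro ⟨w, hw, hw2⟩
        obtain ⟨y, hy⟩ := (h6 hx (r3 hw)).2.1 hw2
        exact ⟨(w, y), hw, hy⟩
      · rintro ⟨⟨w, y⟩, hw, hy⟩
        exact ⟨w, hw, (h6 hx (r3 hw)).2.2 ⟨y, hy⟩⟩
  choose W hW1 hW2 using loc
  obtain ⟨t, -, ht⟩ := hK.elim_nhds_subcover W fun z _ => hW1 z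
  refine (SubAt.biUnion t (S := fun z => {x | ∃ w ∈ W z, (x, w) ∈ T}) fun z _ => hW2 z).congr ?_
  filter_upwards [hTK] with x hx
  simp only [mem_setOf_eq, mem_iUnion]
  constructor
  · rintro ⟨z, hz⟩
    obtain ⟨i, hi, hzi⟩ := mem_iUnion₂.1 (ht (hx z hz))
    exact ⟨i, hi, z, hzi, hz⟩
  · rintro ⟨i, hi, z, _, hz⟩
    exact ⟨z, hz⟩

theorem comp_glue {p : E} {S : Set (E × F)} {K : Set F}
    (hK : IsCompact K) (hSK : ∀ᶠ x in 𝓝 p, ∀ z, (x, z) ∈ S → z ∈ K)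
    (loc : ∀ z : F, ∃ W ∈ 𝓝 z, SubAt p {x | ¬ ∃ w ∈ W, (x, w) ∈ S}) :
    SubAt p {x | ¬ ∃ z, (x, z) ∈ S} := by
  choose W hW1 hW2 using loc
  obtain ⟨t, -, ht⟩ := hK.elim_nhds_subcover W fun z _ => hW1 z
  refine (SubAt.biInter t (S := fun z => {x | ¬ ∃ w ∈ W z, (x, w) ∈ S}) fun z _ => hW2 z).congr ?_
  filter_upwards [hSK] with x hx
  simp only [mem_setOf_eq, mem_iInter]
  constructor
  · rintro h i hi ⟨w, _, hw⟩
    exact h ⟨w, hw⟩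
  · rintro h ⟨z, hz⟩
    obtain ⟨i, hi, hzi⟩ := mem_iUnion₂.1 (ht (hx z hz))
    exact h i hi ⟨z, hzi, hz⟩

theorem Subanalytic.subAt {T : Set E} (h : Subanalytic T) (p : E) : SubAt p T := by
  obtain ⟨U, hU, m, B, h1, h2, h3⟩ := h p
  refine ⟨m, B, Prod.snd '' closure B, h2.image continuous_snd,
    fun z hz => mem_image_of_mem _ (subset_closure hz), fun y => h1.semiAt _, ?_⟩
  filter_upwards [hU] with x hx
  have := Set.ext_iff.1 h3 x
  simp only [mem_inter_iff, hx, and_true] at this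
  rw [this]
  simp

theorem subanalytic_of [FiniteDimensional ℝ E] {T : Set E} (h : ∀ p, SubAt p T) :
    Subanalytic T := by
  intro p
  obtain ⟨m, S, K, h1, h2, h3, h4⟩ := (h p).strong
  obtain ⟨ρ, r1, r2, r3, r4, -, -⟩ := bump p h3
  have hU : {x | 0 ≤ ρ x} ∈ 𝓝 p := by
    filter_upwards [(r1 p).continuousAt.eventually (lt_mem_nhds r2)] with w hw using hw.le
  refine ⟨_, Filter.inter_mem hU h4, m, {z | 0 ≤ ρ z.1} ∩ S, semianalytic_of ?_, ?_, ?_⟩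
  · rintro ⟨x, y⟩
    by_cases hx : 0 ≤ ρ x
    · refine SemiAt.inter (SemiAt.nonneg ?_) (r3 hx y)
      exact AnalyticAt.fun_comp (g := ρ) (f := fun q : E × (Fin m → ℝ) => q.1)
            (r1 _) (by fun_prop)
    · refine SemiAt.of_notMem ?_
      have hc : ContinuousAt (fun q : E × (Fin m → ℝ) => ρ q.1) (x, y) :=
        ContinuousAt.comp (g := ρ) (f := fun q : E × (Fin m → ℝ) => q.1)
          (r1 x).continuousAt (by fun_prop)
      filter_upwards [hc.eventually (gt_mem_nhds (not_le.1 hx))] with q hq hq2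
      exact absurd hq2.1 (not_le.2 hq)
  · refine (r4.prod h1).closure_of_subset ?_
    rintro ⟨x, y⟩ hz
    exact ⟨hz.1, h2 _ hz.2⟩
  · ext x
    simp only [mem_inter_iff, and_congr_left_iff]
    rintro ⟨hx1, hx2⟩
    rw [show x ∈ T ↔ ∃ y, (x, y) ∈ S from hx2]
    constructor
    · rintro ⟨y, hy⟩; exact ⟨(x, y), ⟨hx1, hy⟩, rfl⟩
    · rintro ⟨⟨x', y⟩, ⟨_, hy⟩, rfl⟩; exact ⟨y, hy⟩

end sub

end P7bpart

section P8part
open scoped Topology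
open Set

section compl1
variable {E : Type} [NormedAddCommGroup E] [NormedSpace ℝ E]
  {F : Type} [NormedAddCommGroup F] [NormedSpace ℝ F]

/-- functions analytic at `q` -/
def AnP (q : E) : Subring (E → ℝ) where
  carrier := {f | AnalyticAt ℝ f q}
  mul_mem' ha hb := AnalyticAt.mul ha hb
  one_mem' := analyticAt_const
  add_mem' ha hb := AnalyticAt.add ha hb
  zero_mem' := analyticAt_const
  neg_mem' ha := AnalyticAt.neg ha

/-- evaluation -/
def AnP.ev (q q' : E) : AnP q →+* ℝ := (Pi.evalRingHom (fun _ : E => ℝ) q').comp (AnP q).subtype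

theorem AnP.ev_apply (q q' : E) (f : AnP q) : AnP.ev q q' f = f.1 q' := rfl

open Polynomial in
theorem tarski_semi {ι : Type} [Finite ι] (q0 : E) (d : ι → ℕ) (c : ∀ i, Fin (d i) → E → ℝ)
    (hc : ∀ i j, AnalyticAt ℝ (c i j) q0) (u : ι → SignType) (δ : ℝ) (Sg : Set (ι → SignType)) :
    SemiAt q0 {q | ∃ t : ℝ, -δ ≤ t ∧ t ≤ δ ∧
      (fun i => u i * SignType.sign (t ^ d i + ∑ j, c i j q * t ^ (j : ℕ))) ∈ Sg} := by
  classical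
  have := Fintype.ofFinite ι
  let Pl : ι → (AnP q0)[X] := fun i => X ^ d i + ∑ j, C (⟨c i j, hc i j⟩ : AnP q0) * X ^ (j : ℕ)
  let cd : AnP q0 := ⟨fun _ => δ, analyticAt_const⟩
  obtain ⟨AA, hA⟩ := tarski (insert (X + C cd) (insert (C cd - X) (Finset.univ.image Pl)))
  have hev : ∀ i q t, ((Pl i).map (AnP.ev q0 q)).eval t = t ^ d i + ∑ j, c i j q * t ^ (j : ℕ) := by
    intro i q t
    simp only [Pl, Polynomial.map_add, Polynomial.map_pow, map_X, Polynomial.map_sum,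
      Polynomial.map_mul, map_C, eval_add, eval_pow, eval_X, eval_finset_sum, eval_mul, eval_C]
    rfl
  have key : ∀ q q' : E, (∀ a ∈ AA, SignType.sign (a.1 q) = SignType.sign (a.1 q')) →
      (∃ t : ℝ, -δ ≤ t ∧ t ≤ δ ∧
      (fun i => u i * SignType.sign (t ^ d i + ∑ j, c i j q * t ^ (j : ℕ))) ∈ Sg) →
      (∃ t : ℝ, -δ ≤ t ∧ t ≤ δ ∧
      (fun i => u i * SignType.sign (t ^ d i + ∑ j, c i j q' * t ^ (j : ℕ))) ∈ Sg) := by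
    rintro q q' h ⟨t, ht1, ht2, ht3⟩
    obtain ⟨f, -, hf⟩ := hA (AnP.ev q0 q) (AnP.ev q0 q') h
    have h1 := hf (X + C cd) (by simp) t
    have h2 := hf (C cd - X) (by simp) t
    have nn : ∀ a b : ℝ, SignType.sign a = SignType.sign b → 0 ≤ a → 0 ≤ b := by
      intro a b hab ha
      by_contra hb
      rw [sign_neg (not_le.1 hb), sign_eq_neg_one_iff] at hab
      linarith
    refine ⟨f t, ?_, ?_, ?_⟩
    · have := nn _ _ h1 (by
        simp only [Polynomial.map_add, map_X, map_C, eval_add, eval_X, eval_C]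
        change 0 ≤ t + δ
        linarith)
      simp only [Polynomial.map_add, map_X, map_C, eval_add, eval_X, eval_C] at this
      change 0 ≤ f t + δ at this
      linarith
    · have := nn _ _ h2 (by
        simp only [Polynomial.map_sub, map_X, map_C, eval_sub, eval_X, eval_C]
        change 0 ≤ δ - t
        linarith)
      simp only [Polynomial.map_sub, map_X, map_C, eval_sub, eval_X, eval_C] at this
      change 0 ≤ δ - f t at this
      linarith
    · convert ht3 using 2 with i
      rw [← hev, ← hev]
      rw [hf (Pl i) (by simp) t]
  refine ⟨AA, inferInstance, fun a => a.1.1, {s | ∃ q, (∃ t : ℝ, -δ ≤ t ∧ t ≤ δ ∧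
      (fun i => u i * SignType.sign (t ^ d i + ∑ j, c i j q * t ^ (j : ℕ))) ∈ Sg) ∧
      s = fun a => SignType.sign (a.1.1 q)}, fun a => a.1.2, Filter.Eventually.of_forall fun q => ?_⟩
  constructor
  · intro h
    exact ⟨q, h, rfl⟩
  · rintro ⟨q', h1, h2⟩
    refine key q' q (fun a ha => ?_) h1
    exact (congrFun h2 ⟨a, ha⟩).symm

/-- regular points -/
def Reg (p : E) (y1 : F) (S : Set (E × F)) : Prop :=
  ∃ (ι : Type) (_ : Finite ι) (f : ι → E × F → ℝ) (Sg : Set (ι → SignType)),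
    (∀ i, AnalyticAt ℝ (f i) (p, y1)) ∧ (∀ i, ¬ ∀ᶠ y in 𝓝 y1, f i (p, y) = 0) ∧
    ∀ᶠ z in 𝓝 (p, y1), (z ∈ S ↔ (fun i => SignType.sign (f i z)) ∈ Sg)

/-- complement theorem for fibres of dimension `m` -/
def CompN (m : ℕ) : Prop :=
  ∀ (E : Type) [NormedAddCommGroup E] [NormedSpace ℝ E] [FiniteDimensional ℝ E]
    (F : Type) [NormedAddCommGroup F] [NormedSpace ℝ F] [FiniteDimensional ℝ F],
    Module.finrank ℝ F = m → ∀ (p : E) (S : Set (E × F)) (K : Set F), IsCompact K →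
    (∀ᶠ x in 𝓝 p, ∀ y, (x, y) ∈ S → y ∈ K) → (∀ y, SemiAt (p, y) S) →
    SubAt p {x | ¬ ∃ y, (x, y) ∈ S}

theorem prod_germ {ι : Type} (s : Finset ι) {f : ι → E → ℝ} {p : E}
    (hf : ∀ i, AnalyticAt ℝ (f i) p) (h : ∀ i, ¬ ∀ᶠ x in 𝓝 p, f i x = 0) :
    ¬ ∀ᶠ x in 𝓝 p, ∏ i ∈ s, f i x = 0 := by
  classical
  induction s using Finset.induction_on with
  | empty => intro h; simpa using h.self_of_nhds
  | insert a s ha ih =>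
    intro hc
    simp only [Finset.prod_insert ha] at hc
    rcases mul_zero_germ (hf a) (Finset.analyticAt_fun_prod _ fun i _ => hf i) hc with h1 | h1
    · exact h a h1
    · exact ih h1

theorem reg_step {m : ℕ} (hm : CompN m) [FiniteDimensional ℝ E] [FiniteDimensional ℝ F]
    (hF : Module.finrank ℝ F = m + 1) {p : E} {y1 : F} {S : Set (E × F)} (h : Reg p y1 S) :
    ∃ W ∈ 𝓝 y1, SubAt p {x | ¬ ∃ y ∈ W, (x, y) ∈ S} := by
  obtain ⟨ι, hι, f, Sg, hf, hn, hS⟩ := h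
  have := Fintype.ofFinite ι
  haveI : Nontrivial F := Module.nontrivial_of_finrank_pos (R := ℝ) (by omega)
  have hfp : ∀ i, AnalyticAt ℝ (fun y => f i (p, y)) y1 := fun i =>
    AnalyticAt.fun_comp (g := f i) (f := fun y => (p, y)) (hf i) (by fun_prop)
  obtain ⟨v, hv, hv2⟩ := exists_ray (f := fun y => ∏ i, f i (p, y))
    (Finset.analyticAt_fun_prod _ fun i _ => hfp i) (prod_germ _ hfp hn)
  obtain ⟨e, he⟩ := exists_equiv_prod hF hv
  let q0 : E × (Fin m → ℝ) := (p, 0)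
  let θ : (E × (Fin m → ℝ)) × ℝ → E × F := fun z => (z.1.1, y1 + e.symm (z.1.2, z.2))
  have hθa : ∀ z, AnalyticAt ℝ θ z := by
    intro z
    refine AnalyticAt.prod (by fun_prop) (analyticAt_const.add ?_)
    exact AnalyticAt.fun_comp (g := e.symm) (f := fun z : (E × (Fin m → ℝ)) × ℝ => (z.1.2, z.2))
      ((e.symm : (Fin m → ℝ) × ℝ →L[ℝ] F).analyticAt _) (by fun_prop)
  have hθ0 : θ (q0, 0) = (p, y1) := by
    have : ((0 : Fin m → ℝ), (0 : ℝ)) = 0 := rfl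
    simp only [θ, q0, this, map_zero, add_zero]
  have hFa : ∀ i, AnalyticAt ℝ (fun z => f i (θ z)) (q0, 0) := fun i =>
    AnalyticAt.fun_comp (g := f i) (f := θ) (by rw [hθ0]; exact hf i) (hθa _)
  have hFn : ∀ i, ¬ ∀ᶠ t in 𝓝 (0:ℝ), f i (θ (q0, t)) = 0 := by
    intro i hi
    apply hv2
    filter_upwards [hi] with t ht
    refine Finset.prod_eq_zero (Finset.mem_univ i) ?_
    have : θ (q0, t) = (p, y1 + t • v) := by
      have h1 : ((0 : Fin m → ℝ), t) = t • ((0 : Fin m → ℝ), (1:ℝ)) := by simp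
      simp only [θ, q0, h1, map_smul, ← he, ContinuousLinearEquiv.symm_apply_apply]
    rw [← this]; exact ht
  choose d U c hU hU0 hc hfac using fun i => wprep q0 (fun z => f i (θ z)) (hFa i) (hFn i)
  have hev : ∀ᶠ z in 𝓝 (q0, (0:ℝ)), (θ z ∈ S ↔ (fun i => SignType.sign (U i (q0, 0)) *
      SignType.sign (z.2 ^ d i + ∑ j, c i j z.1 * z.2 ^ (j : ℕ))) ∈ Sg) := by
    have h1 : ∀ᶠ z in 𝓝 (q0, (0:ℝ)), (θ z ∈ S ↔ (fun i => SignType.sign (f i (θ z))) ∈ Sg) :=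
      (hθa (q0, 0)).continuousAt.eventually (by rw [hθ0]; exact hS)
    have h2 : ∀ᶠ z in 𝓝 (q0, (0:ℝ)), ∀ i, SignType.sign (U i z) = SignType.sign (U i (q0, 0)) := by
      refine Filter.eventually_all.2 fun i => ?_
      rcases lt_or_gt_of_ne (hU0 i) with h | h
      · filter_upwards [(hU i).continuousAt.eventually (gt_mem_nhds h)] with z hz
        rw [sign_neg h, sign_neg hz]
      · filter_upwards [(hU i).continuousAt.eventually (lt_mem_nhds h)] with z hz
        rw [sign_pos h, sign_pos hz]
    filter_upwards [h1, h2, Filter.eventually_all.2 hfac] with z z1 z2 z3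
    rw [z1]
    simp only [z3, sign_mul, z2]
  rw [nhds_prod_eq, Filter.eventually_prod_iff] at hev
  obtain ⟨pa, hpa, pb, hpb, hev⟩ := hev
  obtain ⟨δ, hδ, hδb⟩ := Metric.nhds_basis_closedBall.mem_iff.1 hpb
  let S2 : Set (E × (Fin m → ℝ)) := {q | ∃ t : ℝ, -δ ≤ t ∧ t ≤ δ ∧
      (fun i => SignType.sign (U i (q0, 0)) *
        SignType.sign (t ^ d i + ∑ j, c i j q * t ^ (j : ℕ))) ∈ Sg}
  have hS2 : SemiAt q0 S2 := tarski_semi q0 d c hc _ δ Sg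
  have hev2 := hpa.and hS2.eventually
  rw [show q0 = (p, 0) from rfl, nhds_prod_eq, Filter.eventually_prod_iff] at hev2
  obtain ⟨pc, hpc, pd, hpd, hev2⟩ := hev2
  obtain ⟨ρ, r1, r2, r3, r4, -, -⟩ := bump (0 : Fin m → ℝ) (U := {w | pd w}) hpd
  have hmain := hm E (Fin m → ℝ) (by simp) p ({z | 0 ≤ ρ z.2} ∩ S2) _ r4
    (Filter.Eventually.of_forall fun x y hy => hy.1) (by
      intro y
      by_cases hy : 0 ≤ ρ y
      · refine SemiAt.inter (SemiAt.nonneg ?_) (hev2 hpc.self_of_nhds (r3 hy)).2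
        exact AnalyticAt.fun_comp (g := ρ) (f := fun q : E × (Fin m → ℝ) => q.2)
            (r1 _) (by fun_prop)
      · refine SemiAt.of_notMem ?_
        have hc : ContinuousAt (fun q : E × (Fin m → ℝ) => ρ q.2) (p, y) :=
          ContinuousAt.comp (g := ρ) (f := fun q : E × (Fin m → ℝ) => q.2)
            (r1 y).continuousAt (by fun_prop)
        filter_upwards [hc.eventually (gt_mem_nhds (not_le.1 hy))] with q hq hq2
        exact absurd hq2.1 (not_le.2 hq))
  have hen : ContinuousAt (fun y => e (y - y1)) y1 := by fun_prop
  have he0 : e (y1 - y1) = ((0 : Fin m → ℝ), (0 : ℝ)) := by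
    rw [sub_self, map_zero]; rfl
  refine ⟨{y | 0 ≤ ρ (e (y - y1)).1 ∧ (e (y - y1)).2 ∈ Metric.closedBall 0 δ}, ?_, hmain.congr ?_⟩
  · refine Filter.Eventually.and ?_ ?_
    · have : ContinuousAt (fun y => ρ (e (y - y1)).1) y1 :=
        ContinuousAt.comp (g := ρ) (f := fun y => (e (y - y1)).1) (r1 _).continuousAt (by fun_prop)
      filter_upwards [this.eventually (lt_mem_nhds (a := 0) (by simp only [he0]; exact r2))]
        with y hy using hy.le
    · have : ContinuousAt (fun y => (e (y - y1)).2) y1 := by fun_prop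
      exact this.eventually (by simp only [he0]; exact Metric.closedBall_mem_nhds _ hδ)
  · filter_upwards [hpc] with x hx
    refine not_congr ⟨?_, ?_⟩
    · rintro ⟨y, ⟨hy1, hy2⟩, hy3⟩
      refine ⟨(e (y - y1)).1, hy1, (e (y - y1)).2, ?_, ?_, ?_⟩
      · rw [Metric.mem_closedBall, Real.dist_eq, sub_zero] at hy2
        exact (abs_le.1 hy2).1
      · rw [Metric.mem_closedBall, Real.dist_eq, sub_zero] at hy2
        exact (abs_le.1 hy2).2
      · refine (hev (hev2 hx (r3 hy1)).1 (hδb hy2)).1 ?_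
        have h1 : θ ((x, (e (y - y1)).1), (e (y - y1)).2) = (x, y) := by
          change (x, y1 + e.symm (e (y - y1))) = (x, y)
          rw [ContinuousLinearEquiv.symm_apply_apply, add_sub_cancel]
        rw [h1]; exact hy3
    · rintro ⟨y', hy', t, ht1, ht2, ht3⟩
      have ht : t ∈ Metric.closedBall (0:ℝ) δ := by
        rw [Metric.mem_closedBall, Real.dist_eq, sub_zero]; exact abs_le.2 ⟨ht1, ht2⟩
      refine ⟨y1 + e.symm (y', t), ⟨by simpa using hy', by simpa using ht⟩, ?_⟩
      exact (hev (hev2 hx (r3 hy')).1 (hδb ht)).2 ht3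

end compl1

end P8part

section P8bpart
open scoped Topology
open Set

section compl2
variable {E : Type} [NormedAddCommGroup E] [NormedSpace ℝ E]
  {F : Type} [NormedAddCommGroup F] [NormedSpace ℝ F]

theorem an_app {κ : Type} [Fintype κ] {f : E → κ → ℝ} {x : E} (hf : AnalyticAt ℝ f x) (j : κ) :
    AnalyticAt ℝ (fun x => f x j) x :=
  AnalyticAt.fun_comp (g := fun v : κ → ℝ => v j) (f := f)
    ((ContinuousLinearMap.proj (R := ℝ) (φ := fun _ : κ => ℝ) j).analyticAt _) hf

theorem compN_zero : CompN 0 := by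
  intro E _ _ _ F _ _ _ hF p S K hK hSK hS
  have hsub : Subsingleton F := Module.finrank_zero_iff.1 hF
  refine SemiAt.subAt (SemiAt.congr (S := ((fun x : E => (x, (0:F))) ⁻¹' S)ᶜ) ?_ ?_)
  · exact (SemiAt.preimage (g := fun x : E => (x, (0:F))) (by fun_prop) (hS 0)).compl
  · refine Filter.Eventually.of_forall fun x => not_congr ⟨?_, fun h => ⟨0, h⟩⟩
    rintro ⟨y, hy⟩
    rwa [Subsingleton.elim y 0] at hy

theorem main_local {m : ℕ} (hm : CompN m) [FiniteDimensional ℝ E] [FiniteDimensional ℝ F]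
    (hF : Module.finrank ℝ F = m + 1) {p : E} {y0 : F} {S : Set (E × F)} (h : SemiAt (p, y0) S) :
    ∃ W ∈ 𝓝 y0, SubAt p {x | ¬ ∃ y ∈ W, (x, y) ∈ S} := by
  classical
  obtain ⟨ι, hι, f, Sg, hf, hS⟩ := h
  have := Fintype.ofFinite ι
  choose Λ hΛ1 hΛ2 a h ha hh hsum hne using fun i => sepS p y0 (f i) (hf i)
  have hev : ∀ᶠ z in 𝓝 (p, y0), (z ∈ S ↔ (fun i => SignType.sign (f i z)) ∈ Sg) ∧
      (∀ i, f i z = ∑ γ, a i γ z.1 * h i γ z) ∧ (∀ i γ, AnalyticAt ℝ (h i γ) z) :=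
    hS.and ((Filter.eventually_all.2 hsum).and (Filter.eventually_all.2 fun i =>
      Filter.eventually_all.2 fun γ => (hh i γ).eventually_analyticAt))
  rw [nhds_prod_eq, Filter.eventually_prod_iff] at hev
  obtain ⟨pa, hpa, pb, hpb, hev⟩ := hev
  obtain ⟨ρ, r1, r2, r3, r4, r5, r6⟩ := bump y0 (U := {w | pb w}) hpb
  have hWn : {y | 0 ≤ ρ y} ∈ 𝓝 y0 := by
    filter_upwards [(r1 y0).continuousAt.eventually (lt_mem_nhds r2)] with w hw using hw.le
  let V : Type := (Σ i, Λ i) → ℝ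
  let S' : (ι → SignType) → Set ((E × ((Σ i, Λ i) → ℝ)) × F) := fun s =>
    {z | 0 ≤ ρ z.2 ∧ (fun i => s i * SignType.sign
      (∑ γ, z.1.2 ⟨i, γ⟩ * h i γ (z.1.1, z.2))) ∈ Sg}
  have hT' : ∀ (κ : ∀ i, Λ i) (s : ι → SignType) (v0 : (Σ i, Λ i) → ℝ), (∀ i, v0 ⟨i, κ i⟩ = 1) →
      SubAt (p, v0) {q | ¬ ∃ y, (q, y) ∈ S' s} := by
    intro κ s v0 hv0
    refine comp_glue r4 (Filter.Eventually.of_forall fun x y hy => hy.1) fun y1 => ?_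
    by_cases hy1 : 0 ≤ ρ y1
    swap
    · refine ⟨{y | ρ y < 0}, (r1 y1).continuousAt.eventually (gt_mem_nhds (not_le.1 hy1)), ?_⟩
      refine (SemiAt.univ _).subAt.congr (Filter.Eventually.of_forall fun q => ?_)
      refine ⟨fun _ => trivial, fun _ => ?_⟩
      rintro ⟨y, hy, hy2⟩
      exact absurd hy2.1 (not_le.2 hy)
    · refine reg_step hm hF ⟨Option ι, inferInstance, fun o => o.elim (fun z => ρ z.2)
        (fun i z => ∑ γ, z.1.2 ⟨i, γ⟩ * h i γ (z.1.1, z.2)),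
        {σ | 0 ≤ σ none ∧ (fun i => s i * σ (some i)) ∈ Sg}, ?_, ?_, ?_⟩
      · rintro (_ | i)
        · exact AnalyticAt.fun_comp (g := ρ) (f := fun z : (E × ((Σ i, Λ i) → ℝ)) × F => z.2) (r1 _)
            (by fun_prop)
        · refine Finset.analyticAt_fun_sum _ fun γ _ => AnalyticAt.mul ?_ ?_
          · exact an_app (f := fun z : (E × ((Σ i, Λ i) → ℝ)) × F => z.1.2) (by fun_prop) _
          · exact AnalyticAt.fun_comp (g := h i γ)
              (f := fun z : (E × ((Σ i, Λ i) → ℝ)) × F => (z.1.1, z.2))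
              ((hev hpa.self_of_nhds (r3 hy1)).2.2 i γ) (by fun_prop)
      · rintro (_ | i)
        · exact r6 y1
        · intro hz
          have hAn : AnalyticOnNhd ℝ (fun y => ∑ γ, v0 ⟨i, γ⟩ * h i γ (p, y)) {y | 0 ≤ ρ y} := by
            intro y hy
            refine Finset.analyticAt_fun_sum _ fun γ _ => AnalyticAt.mul analyticAt_const ?_
            exact AnalyticAt.fun_comp (g := h i γ) (f := fun y : F => (p, y))
              ((hev hpa.self_of_nhds (r3 hy)).2.2 i γ) (by fun_prop)
          have hEq := hAn.eqOn_zero_of_preconnected_of_eventuallyEq_zero r5.isPreconnected hy1 hz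
          refine hne i (fun γ => v0 ⟨i, γ⟩) (fun h0 => ?_) ?_
          · have := congrFun h0 (κ i)
            simp only [hv0, Pi.zero_apply] at this
            exact one_ne_zero this
          · filter_upwards [hWn] with y hy using hEq hy
      · refine Filter.Eventually.of_forall fun z => ?_
        simp only [S', mem_setOf_eq, Option.elim]
        refine and_congr ?_ Iff.rfl
        exact (sign_nonneg_iff).symm
  let C : (∀ i, Λ i) → (ι → SignType) → Set (E × ((Σ i, Λ i) → ℝ)) := fun κ s =>
    (⋂ j, {q | 0 ≤ 1 - (q.2 j)^2}) ∩
      ((⋂ j : Σ i, Λ i, {q | a j.1 (κ j.1) q.1 * q.2 j - a j.1 j.2 q.1 = 0}) ∩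
      ⋂ i, {q | SignType.sign (a i (κ i) q.1) = s i})
  let C1 : (∀ i, Λ i) → Set (E × ((Σ i, Λ i) → ℝ)) := fun κ => ⋂ i, {q | q.2 ⟨i, κ i⟩ - 1 = 0}
  have hC : ∀ κ s v0, SemiAt (p, v0) (C κ s) := by
    intro κ s v0
    have hv : ∀ j, AnalyticAt ℝ (fun q : E × ((Σ i, Λ i) → ℝ) => q.2 j) (p, v0) := fun j =>
      an_app (f := fun q : E × ((Σ i, Λ i) → ℝ) => q.2) (by fun_prop) j
    have hax : ∀ i γ, AnalyticAt ℝ (fun q : E × ((Σ i, Λ i) → ℝ) => a i γ q.1) (p, v0) :=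
      fun i γ => AnalyticAt.fun_comp (g := a i γ) (f := fun q : E × ((Σ i, Λ i) → ℝ) => q.1)
        (ha i γ) (by fun_prop)
    refine (SemiAt.iInter fun j => SemiAt.nonneg (analyticAt_const.sub ((hv j).pow 2))).inter
      ((SemiAt.iInter fun j => SemiAt.zero (((hax _ _).mul (hv j)).sub (hax _ _))).inter
      (SemiAt.iInter fun i => SemiAt.signEq (hax _ _) _))
  have hC1 : ∀ κ v0, SemiAt (p, v0) (C1 κ) := by
    intro κ v0
    have hv : ∀ j, AnalyticAt ℝ (fun q : E × ((Σ i, Λ i) → ℝ) => q.2 j) (p, v0) := fun j =>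
      an_app (f := fun q : E × ((Σ i, Λ i) → ℝ) => q.2) (by fun_prop) j
    exact SemiAt.iInter fun j => SemiAt.zero ((hv _).sub analyticAt_const)
  have hQ : ∀ κ s, SubAt p {x | ∃ v, (x, v) ∈ (C1 κ ∩ C κ s) ∩ {q | ¬ ∃ y, (q, y) ∈ S' s}} := by
    intro κ s
    refine SubAt.proj (K := Metric.closedBall 0 1) (isCompact_closedBall _ _)
      (Filter.Eventually.of_forall ?_) ?_
    · intro x v hv
      rw [mem_closedBall_zero_iff, pi_norm_le_iff_of_nonneg zero_le_one]
      intro j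
      have := mem_iInter.1 hv.1.2.1 j
      simp only [mem_setOf_eq] at this
      rw [Real.norm_eq_abs]
      exact abs_le_of_sq_le_sq (by linarith) zero_le_one
    · intro v0
      by_cases hv0 : ∀ i, v0 ⟨i, κ i⟩ = 1
      · exact ((hC1 κ v0).inter (hC κ s v0)).subAt.inter (hT' κ s v0 hv0)
      · refine SemiAt.subAt (SemiAt.of_notMem ?_)
        obtain ⟨i, hi⟩ := not_forall.1 hv0
        have hc : ContinuousAt (fun q : E × ((Σ i, Λ i) → ℝ) => q.2 ⟨i, κ i⟩) (p, v0) := by fun_prop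
        filter_upwards [hc.eventually (isOpen_ne.mem_nhds hi)] with q hq hq2
        have := mem_iInter.1 hq2.1.1 i
        exact hq (sub_eq_zero.1 this)
  refine ⟨{y | 0 ≤ ρ y}, hWn, (SubAt.biUnion (Finset.univ : Finset ((∀ i, Λ i) × (ι → SignType)))
    (fun i _ => hQ i.1 i.2)).congr ?_⟩
  filter_upwards [hpa] with x hx
  have key : ∀ κ s v, (x, v) ∈ C κ s → ∀ y, 0 ≤ ρ y → ((x, y) ∈ S ↔ ((x, v), y) ∈ S' s) := by
    intro κ s v hv y hy
    obtain ⟨e1, e2, -⟩ := hev hx (r3 hy)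
    rw [e1]
    have : ∀ i, SignType.sign (f i (x, y)) = s i * SignType.sign (∑ γ, v ⟨i, γ⟩ * h i γ (x, y)) := by
      intro i
      have h3 : SignType.sign (a i (κ i) x) = s i := mem_iInter.1 hv.2.2 i
      rw [e2 i, ← h3, ← sign_mul, Finset.mul_sum]
      congr 1
      refine Finset.sum_congr rfl fun γ _ => ?_
      have h4 : a i (κ i) x * v ⟨i, γ⟩ - a i γ x = 0 := mem_iInter.1 hv.2.1 ⟨i, γ⟩
      rw [← mul_assoc, sub_eq_zero.1 h4]
    simp only [this]
    exact ⟨fun h => ⟨hy, h⟩, fun h => h.2⟩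
  constructor
  · intro hno
    have : ∀ i, ∃ k : Λ i, ∀ γ, |a i γ x| ≤ |a i k x| := by
      intro i
      obtain ⟨k, -, hk⟩ := Finset.exists_max_image Finset.univ (fun γ => |a i γ x|)
        Finset.univ_nonempty
      exact ⟨k, fun γ => hk γ (Finset.mem_univ _)⟩
    choose κ hκ using this
    refine mem_iUnion₂.2 ⟨(κ, fun i => SignType.sign (a i (κ i) x)), Finset.mem_univ _, ?_⟩
    let v : (Σ i, Λ i) → ℝ := fun j => if a j.1 (κ j.1) x = 0 then 1 else
      a j.1 j.2 x / a j.1 (κ j.1) x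
    have hvC : (x, v) ∈ C κ fun i => SignType.sign (a i (κ i) x) := by
      refine ⟨mem_iInter.2 fun j => ?_, mem_iInter.2 fun j => ?_, mem_iInter.2 fun i => rfl⟩
      · simp only [mem_setOf_eq, v, sub_nonneg]
        split_ifs with h0
        · norm_num
        · rw [sq_le_one_iff_abs_le_one, abs_div]
          exact div_le_one_of_le₀ (hκ _ _) (abs_nonneg _)
      · simp only [mem_setOf_eq, v]
        split_ifs with h0
        · have := hκ j.1 j.2
          rw [h0, abs_zero] at this
          rw [h0, abs_nonpos_iff.1 this]; simp
        · field_simp; simp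
    refine ⟨v, ⟨⟨mem_iInter.2 fun i => ?_, hvC⟩, ?_⟩⟩
    · simp only [mem_setOf_eq, v]
      split_ifs with h0
      · simp
      · rw [div_self h0, sub_self]
    · rintro ⟨y, hy⟩
      exact hno ⟨y, hy.1, (key _ _ _ hvC y hy.1).2 hy⟩
  · intro hx2
    obtain ⟨⟨κ, s⟩, -, v, ⟨⟨-, hvC⟩, hv2⟩⟩ := mem_iUnion₂.1 hx2
    rintro ⟨y, hy1, hy2⟩
    exact hv2 ⟨y, (key _ _ _ hvC y hy1).1 hy2⟩

theorem compN (m : ℕ) : CompN m := by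
  induction m with
  | zero => exact compN_zero
  | succ m ih =>
    intro E _ _ _ F _ _ _ hF p S K hK hSK hS
    exact comp_glue hK hSK fun y => main_local ih hF (hS y)

theorem SubAt.compl [FiniteDimensional ℝ E] {p : E} {T : Set E} (h : SubAt p T) :
    SubAt p Tᶜ := by
  obtain ⟨m, S, K, h1, h2, h3, h4⟩ := h
  refine (compN m E (Fin m → ℝ) (by simp) p S K h1
    (Filter.Eventually.of_forall fun x y hy => h2 _ hy) h3).congr ?_
  filter_upwards [h4] with x hx
  rw [mem_compl_iff, hx]

end compl2

end P8bpart

open scoped Topology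
open Set

/-- **Subanalyticity of the distance function** (Bierstone–Milman, Remark 3.11).
If `A` is a subanalytic subset of `ℝⁿ`, the function `x ↦ dist(x, A)` is subanalytic,
i.e. its graph is a subanalytic subset of `ℝⁿ × ℝ`. -/
theorem subanalytic_graph_infDist {n : ℕ} (A : Set (EuclideanSpace ℝ (Fin n)))
    (hA : Subanalytic A) :
    Subanalytic {p : EuclideanSpace ℝ (Fin n) × ℝ | p.2 = Metric.infDist p.1 A} := by
  rcases A.eq_empty_or_nonempty with rfl | hne
  · refine subanalytic_of fun p => SemiAt.subAt ?_
    simp only [Metric.infDist_empty]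
    exact SemiAt.zero (by fun_prop)
  have hD : ∀ p : EuclideanSpace ℝ (Fin n) × ℝ,
      SubAt p {p : EuclideanSpace ℝ (Fin n) × ℝ | Metric.infDist p.1 A < p.2} := by
    rintro ⟨x0, s0⟩
    have hpr := SubAt.proj (p := (x0, s0)) (G := EuclideanSpace ℝ (Fin n))
      (K := Metric.closedBall x0 (s0 + 2))
      (T := {z | z.2 ∈ A} ∩ ({z | 0 < z.1.2} ∩ {z | 0 < z.1.2 ^ 2 - ‖z.1.1 - z.2‖ ^ 2}))
      (isCompact_closedBall _ _) ?_ ?_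
    · refine hpr.congr (Filter.Eventually.of_forall fun q => ?_)
      change Metric.infDist q.1 A < q.2 ↔ _
      rw [Metric.infDist_lt_iff hne]
      constructor
      · rintro ⟨y, hy, hd⟩
        have hs : 0 < q.2 := lt_of_le_of_lt dist_nonneg hd
        refine ⟨y, hy, hs, ?_⟩
        change 0 < q.2 ^ 2 - ‖q.1 - y‖ ^ 2
        rw [dist_eq_norm] at hd
        rw [sub_pos]
        gcongr
      · rintro ⟨y, hy, hs, hd⟩
        change 0 < q.2 ^ 2 - ‖q.1 - y‖ ^ 2 at hd
        refine ⟨y, hy, ?_⟩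
        rw [dist_eq_norm]
        exact lt_of_pow_lt_pow_left₀ 2 (le_of_lt hs) (by linarith)
    · have h1 : ∀ᶠ q : EuclideanSpace ℝ (Fin n) × ℝ in 𝓝 (x0, s0), dist q.1 x0 < 1 :=
        (continuousAt_fst (p := ((x0, s0) : EuclideanSpace ℝ (Fin n) × ℝ)))
          (Metric.ball_mem_nhds x0 one_pos)
      have h2 : ∀ᶠ q : EuclideanSpace ℝ (Fin n) × ℝ in 𝓝 (x0, s0), q.2 < s0 + 1 :=
        continuousAt_snd.eventually (gt_mem_nhds (by simp))
      filter_upwards [h1, h2] with q hq1 hq2 y hy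
      obtain ⟨-, hs, hd⟩ := hy
      change 0 < q.2 ^ 2 - ‖q.1 - y‖ ^ 2 at hd
      have hd' : ‖q.1 - y‖ < q.2 := lt_of_pow_lt_pow_left₀ 2 (le_of_lt hs) (by linarith)
      rw [← dist_eq_norm] at hd'
      rw [Metric.mem_closedBall]
      have := dist_triangle_left y x0 q.1
      linarith
    · intro y0
      refine SubAt.inter (SubAt.preimage (g := Prod.snd) analyticAt_snd (hA.subAt _))
        (SemiAt.subAt ((SemiAt.pos (by fun_prop)).inter (SemiAt.pos ?_)))
      refine AnalyticAt.sub (by fun_prop) ?_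
      simp only [EuclideanSpace.norm_sq_eq]
      refine Finset.analyticAt_fun_sum _ fun i _ => ?_
      have hpi : ∀ w : EuclideanSpace ℝ (Fin n), ‖w i‖ ^ 2 = (w i) ^ 2 := fun w => by simp
      simp only [hpi]
      refine AnalyticAt.pow ?_ 2
      exact AnalyticAt.fun_comp (g := (EuclideanSpace.proj i : EuclideanSpace ℝ (Fin n) →L[ℝ] ℝ))
        (f := fun z : (EuclideanSpace ℝ (Fin n) × ℝ) × EuclideanSpace ℝ (Fin n) => z.1.1 - z.2)
        (ContinuousLinearMap.analyticAt _ _) (by fun_prop)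
  have hL : ∀ p : EuclideanSpace ℝ (Fin n) × ℝ,
      SubAt p {p : EuclideanSpace ℝ (Fin n) × ℝ | p.2 < Metric.infDist p.1 A} := by
    rintro ⟨x0, t0⟩
    have hpr := SubAt.proj (p := (x0, t0)) (G := ℝ)
      (K := Icc (t0 - 1) (t0 + 2))
      (T := {z : (EuclideanSpace ℝ (Fin n) × ℝ) × ℝ | Metric.infDist z.1.1 A < z.2}ᶜ ∩
        ({z | 0 < z.2 - z.1.2} ∩ {z | 0 ≤ z.1.2 + 1 - z.2}))
      isCompact_Icc ?_ ?_
    · refine hpr.congr (Filter.Eventually.of_forall fun q => ?_)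
      constructor
      · intro hq
        have hq' : q.2 < Metric.infDist q.1 A := hq
        refine ⟨min (q.2 + 1) (Metric.infDist q.1 A), ?_, ?_, ?_⟩
        · change ¬ Metric.infDist q.1 A < min (q.2 + 1) (Metric.infDist q.1 A)
          exact not_lt.2 (min_le_right _ _)
        · exact sub_pos.2 (lt_min (by linarith) hq')
        · change 0 ≤ q.2 + 1 - min (q.2 + 1) (Metric.infDist q.1 A)
          exact sub_nonneg.2 (min_le_left _ _)
      · rintro ⟨s, h1, h2, -⟩
        have h1' : ¬ Metric.infDist q.1 A < s := h1
        have h2' : 0 < s - q.2 := h2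
        change q.2 < Metric.infDist q.1 A
        linarith [not_lt.1 h1']
    · have h1 : ∀ᶠ q : EuclideanSpace ℝ (Fin n) × ℝ in 𝓝 (x0, t0), q.2 < t0 + 1 :=
        continuousAt_snd.eventually (gt_mem_nhds (by simp))
      have h2 : ∀ᶠ q : EuclideanSpace ℝ (Fin n) × ℝ in 𝓝 (x0, t0), t0 - 1 < q.2 :=
        continuousAt_snd.eventually (lt_mem_nhds (by simp))
      filter_upwards [h1, h2] with q hq1 hq2 s hs
      have h3 : q.2 < s := sub_pos.1 hs.2.1
      have h4 : s ≤ q.2 + 1 := sub_nonneg.1 hs.2.2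
      exact ⟨by linarith, by linarith⟩
    · intro s0
      refine SubAt.inter (SubAt.compl ?_) (SemiAt.subAt
        ((SemiAt.pos (by fun_prop)).inter (SemiAt.nonneg (by fun_prop))))
      exact SubAt.preimage (g := fun z : (EuclideanSpace ℝ (Fin n) × ℝ) × ℝ => (z.1.1, z.2))
        (by fun_prop) (hD _)
  refine subanalytic_of fun p => ((hD p).compl.inter (hL p).compl).congr
    (Filter.Eventually.of_forall fun q => ?_)
  constructor
  · intro h
    have h' : q.2 = Metric.infDist q.1 A := h
    exact ⟨not_lt.2 h'.le, not_lt.2 h'.ge⟩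
  · rintro ⟨h1, h2⟩
    exact le_antisymm (not_lt.1 h1) (not_lt.1 h2)
end
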